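/- arXiv:math/0411245 — 4 statements merged into one kernel-verified Lean document; each statement's English description precedes it below -/
import Mathlib

section
/- Let f : X → X be a polynomial map of a nonempty closed complex algebraic subset X of ℂ^N to itself, equipped with the strong (Euclidean) topology. Assume f is an open map, the coimage X − f(X) is finite, and Ω ⊆ X is a cofinite subset of X (X − Ω is finite) with f(Ω) ⊆ Ω. Then there exists K > 0 such that f^k(Ω) = f^K(Ω) for all k ≥ K, and the stable image ⋂_{k>0} f^k(Ω) is an open cofinite subset of Ω. -/
open MvPolynomial in
lemma point_of_ideal {σ : Type} [Finite σ] (J : Ideal (MvPolynomial σ ℂ)) (hJ : J ≠ ⊤) :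
    ∃ x : σ → ℂ, ∀ p ∈ J, eval x p = 0 := by
  obtain ⟨M, hM, hJM⟩ := Ideal.exists_le_maximal J hJ
  obtain ⟨x, hx⟩ := (isMaximal_iff_eq_vanishingIdeal_singleton).1 hM
  refine ⟨x, fun p hp => ?_⟩
  have := hJM hp
  rw [hx, mem_vanishingIdeal_singleton_iff] at this
  simpa [aeval_eq_eval] using this

open MvPolynomial in
lemma noether_data {N : ℕ} (P : Ideal (MvPolynomial (Fin N) ℂ)) [hP : P.IsPrime] :
    ∃ (s : ℕ) (π : Fin s → MvPolynomial (Fin N) ℂ),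
      (∀ g, g ∉ P → ∃ c : MvPolynomial (Fin s) ℂ, c ≠ 0 ∧
        ∀ z : Fin N → ℂ, (∀ p ∈ P, eval z p = 0) → eval z g = 0 →
          eval (fun j => eval z (π j)) c = 0) ∧
      (∀ h : MvPolynomial (Fin N) ℂ, ∃ μ : Polynomial (MvPolynomial (Fin s) ℂ), μ.Monic ∧
        (∀ z : Fin N → ℂ, (∀ p ∈ P, eval z p = 0) →
          (μ.map (eval (fun j => eval z (π j)))).eval (eval z h) = 0) ∧
        ∀ (w : Fin s → ℂ) (r : ℂ), (μ.map (eval w)).eval r = 0 →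
          ∃ z : Fin N → ℂ, (∀ p ∈ P, eval z p = 0) ∧ (∀ j, eval z (π j) = w j) ∧
            eval z h = r) := by
  classical
  let R := MvPolynomial (Fin N) ℂ ⧸ P
  obtain ⟨s, φ, hinj, hintg⟩ := exists_integral_inj_algHom_of_fg ℂ R
  let : Algebra (MvPolynomial (Fin s) ℂ) R := φ.toRingHom.toAlgebra
  have halg : ∀ x, algebraMap (MvPolynomial (Fin s) ℂ) R x = φ x := fun x => rfl
  have : Algebra.IsIntegral (MvPolynomial (Fin s) ℂ) R := ⟨hintg⟩
  have : FaithfulSMul (MvPolynomial (Fin s) ℂ) R :=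
    (faithfulSMul_iff_algebraMap_injective _ _).2 hinj
  have hπ : ∀ j, ∃ q : MvPolynomial (Fin N) ℂ, Ideal.Quotient.mk P q = φ (X j) :=
    fun j => Ideal.Quotient.mk_surjective _
  choose π hπ using hπ
  -- evaluation at a point of the zero locus
  have hev : ∀ z : Fin N → ℂ, (∀ p ∈ P, eval z p = 0) →
      ∃ e : R →ₐ[ℂ] ℂ, (∀ q, e (Ideal.Quotient.mk P q) = eval z q) ∧
        ∀ c, e (φ c) = eval (fun j => eval z (π j)) c := by
    intro z hz
    let e : R →ₐ[ℂ] ℂ := Ideal.Quotient.liftₐ P (aeval z) (by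
      intro a ha; simpa [aeval_eq_eval] using hz a ha)
    have he : ∀ q, e (Ideal.Quotient.mk P q) = eval z q := by
      intro q
      have : e (Ideal.Quotient.mk P q) = aeval z q := rfl
      rw [this]; simp [aeval_eq_eval]
    refine ⟨e, he, fun c => ?_⟩
    have : e.comp φ = aeval (fun j => eval z (π j)) := by
      apply MvPolynomial.algHom_ext
      intro j
      simp [← hπ, he]
    have h2 := DFunLike.congr_fun this c
    simpa [aeval_eq_eval] using h2
  refine ⟨s, π, ?_, ?_⟩
  · intro g hg
    have hg0 : (Ideal.Quotient.mk P g : R) ≠ 0 := by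
      rwa [Ne, Ideal.Quotient.eq_zero_iff_mem]
    have := Ideal.comap_ne_bot_of_integral_mem (R := MvPolynomial (Fin s) ℂ)
      (I := Ideal.span {(Ideal.Quotient.mk P g : R)}) hg0
      (Ideal.mem_span_singleton_self _) (Algebra.IsIntegral.isIntegral _)
    obtain ⟨c, hc, hc0⟩ := Submodule.exists_mem_ne_zero_of_ne_bot this
    refine ⟨c, hc0, fun z hz hgz => ?_⟩
    obtain ⟨e, he, he'⟩ := hev z hz
    rw [Ideal.mem_comap, Ideal.mem_span_singleton] at hc
    obtain ⟨d, hd⟩ := hc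
    rw [← he', ← halg, hd, map_mul, he, hgz, zero_mul]
  · intro h
    set hb : R := Ideal.Quotient.mk P h with hhb
    have hbi : IsIntegral (MvPolynomial (Fin s) ℂ) hb := Algebra.IsIntegral.isIntegral _
    refine ⟨minpoly (MvPolynomial (Fin s) ℂ) hb, minpoly.monic hbi, ?_, ?_⟩
    · intro z hz
      obtain ⟨e, he, he'⟩ := hev z hz
      have h1 := minpoly.aeval (MvPolynomial (Fin s) ℂ) hb
      have h2 := congrArg e h1
      rw [map_zero, Polynomial.aeval_def] at h2
      have h3 := Polynomial.hom_eval₂ (minpoly (MvPolynomial (Fin s) ℂ) hb)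
        (algebraMap (MvPolynomial (Fin s) ℂ) R) e.toRingHom hb
      have h4 : (e.toRingHom.comp (algebraMap (MvPolynomial (Fin s) ℂ) R)) =
          eval (fun j => eval z (π j)) := by
        refine RingHom.ext fun c => ?_
        exact he' c
      rw [h4] at h3
      rw [Polynomial.eval_map, ← he h]
      exact h3.symm.trans h2
    · intro w r hr
      set ψ : Polynomial (MvPolynomial (Fin s) ℂ) →+* R :=
        (Polynomial.aeval hb).toRingHom with hψ
      have hker := minpoly.ker_eval hbi
      let ε : Polynomial (MvPolynomial (Fin s) ℂ) →+* ℂ := Polynomial.eval₂RingHom (eval w) r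
      have hM : (RingHom.ker ε).IsPrime := RingHom.ker_isPrime _
      let : Algebra (Polynomial (MvPolynomial (Fin s) ℂ)) R := ψ.toAlgebra
      have : IsScalarTower (MvPolynomial (Fin s) ℂ) (Polynomial (MvPolynomial (Fin s) ℂ)) R :=
        IsScalarTower.of_algebraMap_eq (fun x => by
          change _ = (Polynomial.aeval hb) (Polynomial.C x)
          simp)
      have : Algebra.IsIntegral (Polynomial (MvPolynomial (Fin s) ℂ)) R :=
        Algebra.IsIntegral.tower_top (R := MvPolynomial (Fin s) ℂ)
      obtain ⟨Q, hQ, hQM⟩ := Ideal.exists_ideal_over_prime_of_isIntegral_of_isDomain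
        (S := R) (RingHom.ker ε) (by
          change RingHom.ker ψ ≤ _
          rw [hker, Ideal.span_le, Set.singleton_subset_iff]
          change ε _ = 0
          simpa [ε, Polynomial.eval_map] using hr)
      have hQ' : (Q.comap (Ideal.Quotient.mk P)) ≠ ⊤ := by
        have := hQ.comap (Ideal.Quotient.mk P)
        exact Ideal.IsPrime.ne_top this
      obtain ⟨z, hz⟩ := point_of_ideal _ hQ'
      have key : ∀ (q : MvPolynomial (Fin N) ℂ) (t : Polynomial (MvPolynomial (Fin s) ℂ)),
          Ideal.Quotient.mk P q = ψ t → ε t = 0 → eval z q = 0 := by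
        intro q t h1 h2
        apply hz
        rw [Ideal.mem_comap, h1]
        have : t ∈ Q.comap (algebraMap (Polynomial (MvPolynomial (Fin s) ℂ)) R) := by
          rw [hQM]; exact h2
        exact this
      refine ⟨z, fun p hp => key p 0 (by simpa [Ideal.Quotient.eq_zero_iff_mem] using hp)
        (map_zero _), fun j => ?_, ?_⟩
      · have := key (π j - C (w j)) (Polynomial.C (X j - C (w j))) (by
          rw [map_sub, hπ]
          change _ = (Polynomial.aeval hb) (Polynomial.C (X j - C (w j)))
          rw [Polynomial.aeval_C, halg, map_sub]
          congr 1
          exact (φ.commutes (w j)).symm) (by simp [ε])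
        simpa [sub_eq_zero] using this
      · have := key (h - C r) (Polynomial.X - Polynomial.C (C r)) (by
          rw [map_sub]
          change _ = (Polynomial.aeval hb) (Polynomial.X - Polynomial.C (C r))
          rw [map_sub, Polynomial.aeval_X, Polynomial.aeval_C, halg]
          congr 1
          exact (φ.commutes r).symm) (by simp [ε])
        simpa [sub_eq_zero] using this

lemma root_near (p : Polynomial ℂ) (hp : p.Monic) (hd : 0 < p.natDegree) (a : ℂ) :
    ∃ r, p.eval r = 0 ∧ ‖a - r‖ ≤ 2 * ‖p.eval a‖ ^ ((p.natDegree : ℝ)⁻¹) := by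
  have hs : p.Splits := IsAlgClosed.splits p
  by_contra! h
  have hlt : ∀ r ∈ p.roots, 2 * ‖p.eval a‖ ^ ((p.natDegree : ℝ)⁻¹) ≤ ‖a - r‖ := by
    intro r hr
    exact (h r (Polynomial.isRoot_of_mem_roots hr)).le
  have hcard : p.roots.card = p.natDegree := hs.natDegree_eq_card_roots.symm
  have heval : ‖p.eval a‖ = (p.roots.map (fun r => ‖a - r‖)).prod := by
    rw [hs.eval_eq_prod_roots_of_monic hp]
    have := (Multiset.prod_hom (p.roots.map (fun r => a - r)) (normHom : ℂ →*₀ ℝ))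
    rw [Multiset.map_map] at this
    exact this.symm
  have hne : p.eval a ≠ 0 := by
    intro h0
    have := h a h0
    rw [sub_self, norm_zero] at this
    exact absurd this (not_lt.2 (by positivity))
  have hpos : 0 < ‖p.eval a‖ ^ ((p.natDegree : ℝ)⁻¹) :=
    Real.rpow_pos_of_pos (norm_pos_iff.2 hne) _
  have := Multiset.prod_map_le_prod_map₀ (s := p.roots)
    (fun _ => 2 * ‖p.eval a‖ ^ ((p.natDegree : ℝ)⁻¹)) (fun r => ‖a - r‖)
    (fun r hr => by positivity) hlt
  rw [← heval, Multiset.map_const', Multiset.prod_replicate, hcard, mul_pow,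
    Real.rpow_inv_natCast_pow (norm_nonneg _) hd.ne'] at this
  have h2 : (1 : ℝ) < 2 ^ p.natDegree := one_lt_pow₀ (by norm_num) hd.ne'
  nlinarith [norm_pos_iff.2 hne]

lemma root_bound (p : Polynomial ℂ) (hp : p.Monic) (a : ℂ) (h : p.eval a = 0) :
    ‖a‖ ≤ 1 + ∑ i ∈ Finset.range p.natDegree, ‖p.coeff i‖ := by
  have h1 := Polynomial.IsRoot.norm_lt_cauchyBound hp.ne_zero h
  have h2 : p.cauchyBound ≤ 1 + ∑ i ∈ Finset.range p.natDegree, ‖p.coeff i‖₊ := by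
    unfold Polynomial.cauchyBound
    rw [hp.leadingCoeff, nnnorm_one, div_one, add_comm]
    gcongr
    apply Finset.sup_le
    intro i hi
    exact Finset.single_le_sum (f := fun i => ‖p.coeff i‖₊) (fun _ _ => zero_le) hi
  have := h1.le.trans h2
  have h3 := NNReal.coe_le_coe.2 this
  simpa using h3

open MvPolynomial Filter Topology in
/-- approach any point along points where a nonzero polynomial does not vanish -/
lemma approach {s : ℕ} (c : MvPolynomial (Fin s) ℂ) (hc : c ≠ 0) (w : Fin s → ℂ) :
    ∃ u : ℕ → (Fin s → ℂ), Tendsto u atTop (𝓝 w) ∧ ∀ n, eval (u n) c ≠ 0 := by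
  obtain ⟨v, hv⟩ : ∃ v, eval v c ≠ 0 := by
    by_contra! h
    exact hc (MvPolynomial.funext (fun x => by simp [h x]))
  let q : Polynomial ℂ := aeval (fun j => Polynomial.C (w j) + Polynomial.X *
    Polynomial.C (v j - w j)) c
  have hq : ∀ t, q.eval t = eval (fun j => w j + t * (v j - w j)) c := by
    intro t
    have : (Polynomial.evalRingHom t).comp
        (aeval (fun j => Polynomial.C (w j) + Polynomial.X *
          Polynomial.C (v j - w j)) : MvPolynomial (Fin s) ℂ →ₐ[ℂ] Polynomial ℂ).toRingHom =
        eval (fun j => w j + t * (v j - w j)) := by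
      apply MvPolynomial.ringHom_ext
      · intro r; simp
      · intro i; simp
    exact DFunLike.congr_fun this c
  have hq0 : q ≠ 0 := by
    intro h0
    have := hq 1
    rw [h0] at this
    simp at this
    exact hv this.symm
  have hev : ∀ᶠ t in 𝓝[≠] (0 : ℂ), q.eval t ≠ 0 := by
    have hfin : {t | q.eval t = 0}.Finite := by
      apply (q.roots.toFinset.finite_toSet).subset
      intro t ht
      simpa [hq0] using ht
    have hcl : IsClosed ({t | q.eval t = 0} \ {0}) := (hfin.subset Set.sdiff_subset).isClosed
    have : ({t | q.eval t = 0} \ {0})ᶜ ∈ 𝓝 (0 : ℂ) := hcl.isOpen_compl.mem_nhds (by simp)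
    rw [eventually_nhdsWithin_iff]
    filter_upwards [this] with t ht ht0 h0
    exact ht ⟨h0, ht0⟩
  have hfr : ∃ᶠ t in 𝓝[≠] (0 : ℂ), q.eval t ≠ 0 := hev.frequently
  obtain ⟨τ, hτ, hτ'⟩ := Filter.exists_seq_forall_of_frequently hfr
  refine ⟨fun n j => w j + τ n * (v j - w j), ?_, fun n => ?_⟩
  · rw [tendsto_pi_nhds]
    intro j
    have h1 : Tendsto τ atTop (𝓝 0) := hτ.mono_right nhdsWithin_le_nhds
    have := (h1.mul_const (v j - w j)).const_add (w j)
    simpa using this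
  · rw [← hq]; exact hτ' n

open MvPolynomial Filter Topology in
/-- In the zero locus of a prime ideal, a nonempty strongly open set is Zariski dense. -/
lemma strong_dense {N : ℕ} (P : Ideal (MvPolynomial (Fin N) ℂ)) [P.IsPrime]
    (z : Fin N → ℂ) (hz : ∀ p ∈ P, eval z p = 0) (U : Set (Fin N → ℂ)) (hU : IsOpen U)
    (hzU : z ∈ U) (g : MvPolynomial (Fin N) ℂ) (hg : g ∉ P) :
    ∃ ζ ∈ U, (∀ p ∈ P, eval ζ p = 0) ∧ eval ζ g ≠ 0 := by
  classical
  obtain ⟨s, π, h1, h2⟩ := noether_data P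
  set w0 : Fin s → ℂ := fun j => eval z (π j) with hw0
  have hm := fun i : Fin N => h2 (X i)
  choose m hmm hmr _ using hm
  simp only [eval_X] at hmr
  have hfib : {y : Fin N → ℂ | (∀ p ∈ P, eval y p = 0) ∧ (fun j => eval y (π j)) = w0}.Finite := by
    have : (Set.pi Set.univ (fun i : Fin N => {t : ℂ | ((m i).map (eval w0)).eval t = 0})).Finite := by
      apply Set.Finite.pi
      intro i
      apply (((m i).map (eval w0)).roots.toFinset.finite_toSet).subset
      intro t ht
      simpa [((hmm i).map (eval w0)).ne_zero] using ht
    apply this.subset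
    rintro y ⟨hy, hyw⟩ i _
    have := hmr i y hy
    rw [hyw] at this
    exact this
  -- a polynomial separating `z` from the other points of its fibre
  obtain ⟨h, hhz, hh⟩ : ∃ h : MvPolynomial (Fin N) ℂ, eval z h ≠ 0 ∧
      ∀ y : Fin N → ℂ, (∀ p ∈ P, eval y p = 0) → (fun j => eval y (π j)) = w0 → y ≠ z →
        eval y h = 0 := by
    have hi : ∀ y : Fin N → ℂ, ∃ q : MvPolynomial (Fin N) ℂ, y ≠ z →
        eval z q ≠ 0 ∧ eval y q = 0 := by
      intro y
      by_cases hy : y = z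
      · exact ⟨0, fun h => absurd hy h⟩
      · obtain ⟨i, hi⟩ := Function.ne_iff.1 hy
        refine ⟨X i - C (y i), fun _ => ⟨?_, by simp⟩⟩
        simpa [sub_eq_zero] using hi.symm
    choose q hq using hi
    refine ⟨∏ y ∈ hfib.toFinset.erase z, q y, ?_, ?_⟩
    · rw [map_prod, Finset.prod_ne_zero_iff]
      intro y hy
      exact (hq y (Finset.ne_of_mem_erase hy)).1
    · intro y hy hyw hyz
      rw [map_prod]
      apply Finset.prod_eq_zero (i := y)
      · simp only [Finset.mem_erase, Set.Finite.mem_toFinset]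
        exact ⟨hyz, hy, hyw⟩
      · exact (hq y hyz).2
  obtain ⟨μ, hμ, hμz, hμl⟩ := h2 h
  have hd : 0 < μ.natDegree := by
    rw [Nat.pos_iff_ne_zero]
    intro h0
    have := hμz z hz
    rw [hμ.natDegree_eq_zero.1 h0] at this
    simp at this
  obtain ⟨c, hc0, hc⟩ := h1 g hg
  obtain ⟨u, hu, huc⟩ := approach c hc0 w0
  have hdeg : ∀ w : Fin s → ℂ, (μ.map (eval w)).natDegree = μ.natDegree := fun w =>
    hμ.natDegree_map _
  have hroot : ∀ n, ∃ ζ : Fin N → ℂ, (∀ p ∈ P, eval ζ p = 0) ∧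
      (∀ j, eval ζ (π j) = u n j) ∧ ‖eval z h - eval ζ h‖ ≤
        2 * ‖(μ.map (eval (u n))).eval (eval z h)‖ ^ ((μ.natDegree : ℝ)⁻¹) := by
    intro n
    obtain ⟨r, hr, hr'⟩ := root_near (μ.map (eval (u n))) (hμ.map _)
      (by rw [hdeg]; exact hd) (eval z h)
    obtain ⟨ζ, hζ, hζw, hζh⟩ := hμl (u n) r hr
    refine ⟨ζ, hζ, hζw, ?_⟩
    rw [hdeg] at hr'
    rwa [hζh]
  choose ζ hζ hζw hζh using hroot
  have hcont : ∀ a : ℂ, Continuous (fun w : Fin s → ℂ => (μ.map (eval w)).eval a) := by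
    intro a
    have : (fun w : Fin s → ℂ => (μ.map (eval w)).eval a) =
        fun w => eval w (μ.eval (C a)) := by
      funext w
      rw [Polynomial.eval_map, ← Polynomial.eval₂_at_apply, eval_C]
    rw [this]
    exact MvPolynomial.continuous_eval _
  have hlim : Tendsto (fun n => eval (ζ n) h) atTop (𝓝 (eval z h)) := by
    have t1 : Tendsto (fun n => (μ.map (eval (u n))).eval (eval z h)) atTop (𝓝 0) := by
      have := ((hcont (eval z h)).tendsto w0).comp hu
      rw [hμz z hz] at this
      exact this
    have t2 : Tendsto (fun n => 2 * ‖(μ.map (eval (u n))).eval (eval z h)‖ ^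
        ((μ.natDegree : ℝ)⁻¹)) atTop (𝓝 0) := by
      have hpos : (0 : ℝ) < (μ.natDegree : ℝ)⁻¹ := by positivity
      have := ((t1.norm).rpow_const (p := (μ.natDegree : ℝ)⁻¹) (Or.inr hpos.le)).const_mul 2
      simpa [Real.zero_rpow hpos.ne'] using this
    rw [tendsto_iff_norm_sub_tendsto_zero]
    refine squeeze_zero (fun _ => norm_nonneg _) (fun n => ?_) t2
    rw [norm_sub_rev]
    exact hζh n
  -- boundedness
  have hbd : ∀ i, ∃ B : ℝ, ∀ n, ‖ζ n i‖ ≤ B := by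
    intro i
    have t : Tendsto (fun n => 1 + ∑ k ∈ Finset.range (m i).natDegree,
        ‖eval (u n) ((m i).coeff k)‖) atTop
        (𝓝 (1 + ∑ k ∈ Finset.range (m i).natDegree, ‖eval w0 ((m i).coeff k)‖)) := by
      apply Tendsto.const_add
      apply tendsto_finsetSum
      intro k _
      exact (((MvPolynomial.continuous_eval ((m i).coeff k)).tendsto w0).comp hu).norm
    obtain ⟨B, hB⟩ := t.bddAbove_range
    refine ⟨B, fun n => le_trans ?_ (hB ⟨n, rfl⟩)⟩
    have h3 := hmr i (ζ n) (hζ n)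
    have h4 : (fun j => eval (ζ n) (π j)) = u n := funext (hζw n)
    rw [h4] at h3
    have h5 := root_bound _ ((hmm i).map _) _ h3
    rw [(hmm i).natDegree_map] at h5
    simpa using h5
  choose B hB using hbd
  have hK : IsCompact (Set.pi Set.univ (fun i : Fin N => Metric.closedBall (0 : ℂ) (B i))) :=
    isCompact_univ_pi fun i => isCompact_closedBall _ _
  obtain ⟨y, _, φ, hφ, hy⟩ := hK.tendsto_subseq (x := ζ) (fun n i _ => by
    simpa using hB i n)
  have hyev : ∀ p : MvPolynomial (Fin N) ℂ,
      Tendsto (fun n => eval (ζ (φ n)) p) atTop (𝓝 (eval y p)) := fun p =>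
    ((MvPolynomial.continuous_eval p).tendsto y).comp hy
  have hyP : ∀ p ∈ P, eval y p = 0 := by
    intro p hp
    refine tendsto_nhds_unique (hyev p) ?_
    simp [hζ _ p hp]
  have hyw : (fun j => eval y (π j)) = w0 := by
    funext j
    refine tendsto_nhds_unique (hyev (π j)) ?_
    simp only [hζw]
    exact ((tendsto_pi_nhds.1 hu j).comp hφ.tendsto_atTop)
  have hyh : eval y h = eval z h :=
    tendsto_nhds_unique (hyev h) (hlim.comp hφ.tendsto_atTop)
  have hyz : y = z := by
    by_contra hne
    exact hhz (hyh ▸ hh y hyP hyw hne)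
  rw [hyz] at hy
  obtain ⟨n, hn⟩ := (hy.eventually (hU.mem_nhds hzU)).exists
  refine ⟨ζ (φ n), hn, hζ _, fun h0 => ?_⟩
  have := hc _ (hζ (φ n)) h0
  have h4 : (fun j => eval (ζ (φ n)) (π j)) = u (φ n) := funext (hζw _)
  rw [h4] at this
  exact huc _ this

open MvPolynomial Topology in
/-- Chevalley-type lifting lemma. -/
lemma generic_lift {N : ℕ} {σ : Type} [Finite σ] (P : Ideal (MvPolynomial (Fin N) ℂ)) [P.IsPrime]
    (J : Ideal (MvPolynomial (Fin N ⊕ σ) ℂ))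
    (hJ : ∀ g, g ∉ P → ∃ (ζ : Fin N → ℂ) (η : σ → ℂ), (∀ p ∈ P, eval ζ p = 0) ∧
      eval ζ g ≠ 0 ∧ ∀ q ∈ J, eval (Sum.elim ζ η) q = 0) :
    ∃ a, a ∉ P ∧ ∀ ζ : Fin N → ℂ, (∀ p ∈ P, eval ζ p = 0) → eval ζ a ≠ 0 →
      ∃ η : σ → ℂ, ∀ q ∈ J, eval (Sum.elim ζ η) q = 0 := by
  classical
  let ι : MvPolynomial (Fin N) ℂ →+* MvPolynomial (Fin N ⊕ σ) ℂ := (rename Sum.inl).toRingHom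
  have hι : ∀ (ζ : Fin N → ℂ) (η : σ → ℂ) p, eval (Sum.elim ζ η) (ι p) = eval ζ p := by
    intro ζ η p
    change eval (Sum.elim ζ η) (rename Sum.inl p) = _
    rw [eval_rename]; rfl
  have hfp : ι.FinitePresentation := by
    apply RingHom.FinitePresentation.of_finiteType.1
    apply RingHom.FiniteType.of_comp_finiteType (f := (C : ℂ →+* MvPolynomial (Fin N) ℂ))
    have : ι.comp C = C := by
      ext x <;> simp [ι]
    rw [this]
    exact (RingHom.finiteType_algebraMap (A := ℂ)
      (B := MvPolynomial (Fin N ⊕ σ) ℂ)).2 inferInstance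
  have hcon : IsConstructible (PrimeSpectrum.zeroLocus (J : Set (MvPolynomial (Fin N ⊕ σ) ℂ))) := by
    rw [← isConstructible_compl]
    apply IsRetrocompact.isConstructible
    · exact (PrimeSpectrum.isClosed_zeroLocus _).isOpen_compl
    · intro V hV hVo
      exact TopologicalSpace.NoetherianSpace.isCompact _
  have him := PrimeSpectrum.isConstructible_comap_image hfp hcon
  obtain ⟨S, hS⟩ := PrimeSpectrum.exists_constructibleSetData_iff.2 him
  -- points as primes
  let pt : ∀ {τ : Type} (x : τ → ℂ), PrimeSpectrum (MvPolynomial τ ℂ) :=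
    fun x => ⟨RingHom.ker (eval x), RingHom.ker_isPrime _⟩
  have hpt : ∀ (ζ : Fin N → ℂ) (η : σ → ℂ), PrimeSpectrum.comap ι (pt (Sum.elim ζ η)) = pt ζ := by
    intro ζ η
    ext p
    simp [pt, PrimeSpectrum.comap_asIdeal, Ideal.mem_comap, RingHom.mem_ker, hι]
  have hg : ∀ D ∈ S, ∃ g, g ∉ P ∧ ((∃ i, D.g i ∉ P) → ∃ i, g = D.g i) := by
    intro D _
    by_cases h : ∃ i, D.g i ∉ P
    · obtain ⟨i, hi⟩ := h
      exact ⟨D.g i, hi, fun _ => ⟨i, rfl⟩⟩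
    · exact ⟨1, (Ideal.ne_top_iff_one _).1 (Ideal.IsPrime.ne_top inferInstance),
        fun h' => absurd h' h⟩
  choose! γ hγ hγ' using hg
  obtain ⟨ζ, η, hζP, hζg, hζJ⟩ := hJ (∏ D ∈ S, γ D) (by
    intro hmem
    obtain ⟨D, hD, hD'⟩ := (Ideal.IsPrime.prod_mem_iff (p := P)).1 hmem
    exact hγ D hD hD')
  have hmem : pt ζ ∈ S.toSet := by
    rw [hS]
    refine ⟨pt (Sum.elim ζ η), ?_, hpt ζ η⟩
    intro q hq
    exact hζJ q hq
  obtain ⟨D, hDS, hD⟩ : ∃ D ∈ S, pt ζ ∈ D.toSet := by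
    simpa [PrimeSpectrum.ConstructibleSetData.toSet] using hmem
  have hDg : ∀ i, D.g i ∈ P := by
    by_contra! h
    obtain ⟨i, hi⟩ := hγ' D hDS h
    apply hζg
    rw [map_prod]
    apply Finset.prod_eq_zero hDS
    rw [hi]
    exact hD.1 ⟨i, rfl⟩
  refine ⟨D.f, ?_, ?_⟩
  · intro hf
    apply hD.2
    intro x hx
    rw [Set.mem_singleton_iff.1 hx]
    exact hζP _ hf
  · intro ζ' hζ' hf'
    have hmem' : pt ζ' ∈ S.toSet := by
      have : pt ζ' ∈ D.toSet := by
        refine ⟨?_, ?_⟩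
        · rintro _ ⟨i, rfl⟩
          exact hζ' _ (hDg i)
        · intro h
          exact hf' (h (Set.mem_singleton _))
      simp only [PrimeSpectrum.ConstructibleSetData.toSet, Set.mem_iUnion]
      exact ⟨D, hDS, this⟩
    rw [hS] at hmem'
    obtain ⟨Q, hQJ, hQ⟩ := hmem'
    obtain ⟨x, hx⟩ := point_of_ideal Q.asIdeal (Ideal.IsPrime.ne_top Q.2)
    have hxe : x = Sum.elim ζ' (fun j => x (Sum.inr j)) := by
      funext k
      rcases k with i | j
      · have h1 : X i - C (ζ' i) ∈ (PrimeSpectrum.comap ι Q).asIdeal := by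
          rw [hQ]
          simp [pt, RingHom.mem_ker]
        have h2 := hx _ h1
        simpa [ι, sub_eq_zero] using h2
      · rfl
    refine ⟨fun j => x (Sum.inr j), fun q hq => ?_⟩
    rw [← hxe]
    exact hx q (hQJ hq)

open MvPolynomial in
/-- A minimal prime of a radical ideal can be isolated from the others. -/
lemma isolate {N : ℕ} (I : Ideal (MvPolynomial (Fin N) ℂ)) (hI : I.IsRadical)
    (Q : Ideal (MvPolynomial (Fin N) ℂ)) (hQ : Q ∈ I.minimalPrimes) :
    ∃ b, b ∉ Q ∧ ∀ p ∈ Q, p * b ∈ I := by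
  classical
  have hfin : I.minimalPrimes.Finite := Ideal.finite_minimalPrimes_of_isNoetherianRing _ I
  have hQp : Q.IsPrime := hQ.1.1
  have hc : ∀ M : Ideal (MvPolynomial (Fin N) ℂ), ∃ b, M ∈ I.minimalPrimes → M ≠ Q →
      b ∈ M ∧ b ∉ Q := by
    intro M
    by_cases h : M ≤ Q
    · refine ⟨0, fun hM hne => absurd (le_antisymm h (hQ.2 hM.1 h)) hne⟩
    · obtain ⟨b, hb, hb'⟩ := Set.not_subset.1 h
      exact ⟨b, fun _ _ => ⟨hb, hb'⟩⟩
  choose β hβ using hc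
  refine ⟨∏ M ∈ hfin.toFinset.erase Q, β M, ?_, ?_⟩
  · intro h
    obtain ⟨M, hM, hM'⟩ := (Ideal.IsPrime.prod_mem_iff (p := Q)).1 h
    rw [Finset.mem_erase, Set.Finite.mem_toFinset] at hM
    exact (hβ M hM.2 hM.1).2 hM'
  · intro p hp
    have hII : sInf I.minimalPrimes = I := by rw [Ideal.sInf_minimalPrimes, hI.radical]
    refine hII.le ?_
    rw [Ideal.mem_sInf]
    intro M hM
    by_cases h : M = Q
    · rw [h]; exact Ideal.mul_mem_right _ _ hp
    · refine Ideal.mul_mem_left _ _ ?_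
      rw [← Finset.mul_prod_erase (hfin.toFinset.erase Q) β (a := M) (by simp [h, hM])]
      exact Ideal.mul_mem_right _ _ (hβ M hM h).1

open MvPolynomial Topology in
/-- Core step: the Zariski closure of a tail of the orbit. -/
lemma core {N : ℕ} (P : Set (MvPolynomial (Fin N) ℂ)) (X : Set (Fin N → ℂ))
    (hX : X = {x | ∀ p ∈ P, MvPolynomial.eval x p = 0})
    (F : (Fin N → ℂ) → (Fin N → ℂ)) (q : Fin N → MvPolynomial (Fin N) ℂ)
    (hq : ∀ x i, F x i = MvPolynomial.eval x (q i))
    (hmaps : Set.MapsTo F X X)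
    (hopen : IsOpenMap (Set.MapsTo.restrict F X X hmaps))
    (x : ℕ → Fin N → ℂ) (hxX : ∀ i, x i ∈ X) (hxF : ∀ i, F (x i) = x (i + 1))
    (huniq : ∀ i, ∀ y ∈ X, F y = x (i + 1) → y = x i) :
    ∃ L, ∃ Z ⊆ X, x L ∈ Z ∧ Set.SurjOn F Z Z := by
  classical
  have hFq : F = fun v i => eval v (q i) := by funext v i; exact hq v i
  have hFc : Continuous F := by
    rw [hFq]
    exact continuous_pi fun i => MvPolynomial.continuous_eval _
  let I : ℕ →o Ideal (MvPolynomial (Fin N) ℂ) :=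
    ⟨fun L => vanishingIdeal ℂ (x '' Set.Ici L), fun a b hab =>
      vanishingIdeal_anti_mono (Set.image_mono (Set.Ici_subset_Ici.2 hab))⟩
  have hI : ∀ L p, p ∈ I L ↔ ∀ i ≥ L, eval (x i) p = 0 := by
    intro L p
    change p ∈ vanishingIdeal ℂ (x '' Set.Ici L) ↔ _
    simp [mem_vanishingIdeal_iff, aeval_eq_eval]
  obtain ⟨L, hL⟩ := monotone_stabilizes_iff_noetherian.2
    (inferInstanceAs (IsNoetherian (MvPolynomial (Fin N) ℂ) (MvPolynomial (Fin N) ℂ))) I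
  let Z : Set (Fin N → ℂ) := zeroLocus ℂ (I L)
  have hZ : ∀ v, v ∈ Z ↔ ∀ p ∈ I L, eval v p = 0 := by
    intro v
    simp [Z, aeval_eq_eval]
  have hZX : Z ⊆ X := by
    intro v hv
    rw [hX]
    intro p hp
    refine (hZ v).1 hv p ((hI L p).2 fun i _ => ?_)
    have := hxX i
    rw [hX] at this
    exact this p hp
  have hxZ : ∀ i ≥ L, x i ∈ Z := fun i hi => (hZ _).2 fun p hp => (hI L p).1 hp i hi
  have hcomp : ∀ p v, eval v (bind₁ q p) = eval (F v) p := by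
    intro p v
    have : (eval v).comp (bind₁ q).toRingHom = eval (F v) := by
      apply MvPolynomial.ringHom_ext
      · intro r; simp
      · intro i; simp [hq]
    exact DFunLike.congr_fun this p
  have hZZ : Set.MapsTo F Z Z := by
    intro v hv
    refine (hZ _).2 fun p hp => ?_
    rw [← hcomp]
    refine (hZ v).1 hv _ ((hI L _).2 fun i hi => ?_)
    rw [hcomp, hxF]
    exact (hI L p).1 hp _ (by omega)
  have hrad : (I L).IsRadical := by
    intro p ⟨n, hn⟩
    rw [hI] at hn ⊢
    intro i hi
    have := hn i hi
    rw [map_pow] at this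
    exact eq_zero_of_pow_eq_zero this
  have hinj : Set.InjOn F Z := by
    intro z hz z' hz' hzz'
    by_contra hne
    -- strongly open neighbourhood all of whose points have a second partner
    obtain ⟨U, hUo, hzU, hU⟩ : ∃ U : Set (Fin N → ℂ), IsOpen U ∧ z ∈ U ∧
        ∀ ζ ∈ U, ζ ∈ X → ∃ y ∈ X, y ≠ ζ ∧ F y = F ζ := by
      obtain ⟨A, B, hA, hB, hzA, hzB, hAB⟩ := t2_separation hne
      have h1 : IsOpen ((Subtype.val : X → Fin N → ℂ) ⁻¹' B) := hB.preimage continuous_subtype_val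
      obtain ⟨V, hV, hV'⟩ := isOpen_induced_iff.1 (hopen _ h1)
      have hmemV : ∀ y : X, y.1 ∈ V ↔ ∃ t : X, t.1 ∈ B ∧ F t.1 = y.1 := by
        intro y
        have : y.1 ∈ V ↔ y ∈ (Subtype.val : X → Fin N → ℂ) ⁻¹' V := Iff.rfl
        rw [this, hV']
        constructor
        · rintro ⟨t, ht, rfl⟩
          exact ⟨t, ht, rfl⟩
        · rintro ⟨t, ht, h⟩
          exact ⟨t, ht, Subtype.ext h⟩
      refine ⟨A ∩ F ⁻¹' V, hA.inter (hV.preimage hFc), ⟨hzA, ?_⟩, ?_⟩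
      · exact (hmemV ⟨F z, hmaps (hZX hz)⟩).2 ⟨⟨z', hZX hz'⟩, hzB, hzz'.symm⟩
      · rintro ζ ⟨hζA, hζV⟩ hζX
        obtain ⟨t, htB, ht⟩ := (hmemV ⟨F ζ, hmaps hζX⟩).1 hζV
        refine ⟨t.1, t.2, ?_, ht⟩
        rintro rfl
        exact Set.disjoint_left.1 hAB hζA htB
    -- a component through `z`
    have hle : I L ≤ RingHom.ker (eval z) := fun p hp => (hZ z).1 hz p hp
    have : (RingHom.ker (eval z)).IsPrime := RingHom.ker_isPrime _
    obtain ⟨Q, hQ, hQz⟩ := Ideal.exists_minimalPrimes_le hle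
    have hQp : Q.IsPrime := hQ.1.1
    obtain ⟨b, hbQ, hb⟩ := isolate (I L) hrad Q hQ
    have hQZ : ∀ ζ : Fin N → ℂ, (∀ p ∈ Q, eval ζ p = 0) → ζ ∈ Z := fun ζ hζ =>
      (hZ ζ).2 fun p hp => hζ p (hQ.1.2 hp)
    let W : Set (Fin N ⊕ (Fin N ⊕ Fin N) → ℂ) :=
      {v | (fun i => v (.inr (.inl i))) ∈ X ∧
        F (fun i => v (.inr (.inl i))) = F (fun i => v (.inl i)) ∧
        ∑ i, v (.inr (.inr i)) * (v (.inl i) - v (.inr (.inl i))) = 1}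
    have hJmem : ∀ p, p ∈ vanishingIdeal ℂ W ↔ ∀ v ∈ W, eval v p = 0 := by
      intro p
      simp [mem_vanishingIdeal_iff, aeval_eq_eval]
    obtain ⟨a, haQ, ha⟩ := generic_lift Q (vanishingIdeal ℂ W) (by
      intro g hg
      obtain ⟨ζ, hζU, hζQ, hζg⟩ := strong_dense Q z (fun p hp => hQz hp) U hUo hzU g hg
      obtain ⟨y, hyX, hyζ, hFy⟩ := hU ζ hζU (hZX (hQZ ζ hζQ))
      obtain ⟨i, hi⟩ := Function.ne_iff.1 hyζ
      refine ⟨ζ, Sum.elim y (Pi.single i (ζ i - y i)⁻¹), hζQ, hζg, fun p hp => ?_⟩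
      refine (hJmem p).1 hp _ ⟨hyX, hFy, ?_⟩
      have hi' : ζ i - y i ≠ 0 := sub_ne_zero.2 (Ne.symm hi)
      simp only [Sum.elim_inr, Sum.elim_inl]
      rw [Finset.sum_eq_single i]
      · simp [hi']
      · intro j _ hj
        simp [hj]
      · simp)
    have hab : a * b ∉ I (L + 1) := by
      rw [← hL (L + 1) (by omega)]
      intro h
      rcases hQp.mem_or_mem (hQ.1.2 h) with h | h
      · exact haQ h
      · exact hbQ h
    rw [hI] at hab
    push Not at hab
    obtain ⟨l, hl, hlab⟩ := hab
    rw [map_mul, mul_ne_zero_iff] at hlab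
    have hlQ : ∀ p ∈ Q, eval (x l) p = 0 := by
      intro p hp
      have := (hI L _).1 (hb p hp) l (by omega)
      rw [map_mul] at this
      exact (mul_eq_zero.1 this).resolve_right hlab.2
    obtain ⟨η, hη⟩ := ha (x l) hlQ hlab.1
    let y : Fin N → ℂ := fun i => η (.inl i)
    have hyX : y ∈ X := by
      rw [hX]
      intro p hp
      have := hη (rename (fun i => .inr (.inl i)) p) ((hJmem _).2 (by
        rintro v ⟨hv, _⟩
        rw [eval_rename]
        rw [hX] at hv
        exact hv p hp))
      rw [eval_rename] at this
      exact this
    have hFy : F y = F (x l) := by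
      funext j
      have := hη (rename (fun i => .inr (.inl i)) (q j) - rename .inl (q j)) ((hJmem _).2 (by
        rintro v ⟨_, hv, _⟩
        rw [map_sub, eval_rename, eval_rename, sub_eq_zero]
        have := congrFun hv j
        rw [hq, hq] at this
        exact this))
      rw [map_sub, eval_rename, eval_rename, sub_eq_zero] at this
      rw [hq, hq]
      exact this
    have hyne : y ≠ x l := by
      intro hy
      have := hη (∑ i, MvPolynomial.X (.inr (.inr i)) *
        (MvPolynomial.X (.inl i) - MvPolynomial.X (.inr (.inl i))) - 1) ((hJmem _).2 (by
        rintro v ⟨_, _, hv⟩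
        simp [hv]))
      have h0 : ∀ i, x l i - η (.inl i) = 0 := fun i => by rw [← hy]; simp [y]
      simp [h0] at this
    exact hyne (huniq l y hyX (by rw [hFy, hxF]))
  refine ⟨L, Z, hZX, hxZ L le_rfl, ?_⟩
  have := ax_grothendieck_zeroLocus (I L) q
  rw [hFq] at hZZ hinj ⊢
  exact this hZZ hinj

/-- Iterated images are cofinite. -/
lemma cofinite_iter {α : Type} (X Ω : Set α) (F : α → α)
    (hcoim : (X \ F '' X).Finite) (hΩcof : (X \ Ω).Finite) (k : ℕ) :
    (X \ F^[k] '' Ω).Finite := by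
  induction k with
  | zero => simpa using hΩcof
  | succ k ih =>
    apply (hcoim.union (ih.image F)).subset
    rintro y ⟨hyX, hy⟩
    by_cases h : y ∈ F '' X
    · obtain ⟨t, ht, rfl⟩ := h
      refine Or.inr ⟨t, ⟨ht, ?_⟩, rfl⟩
      rintro ⟨w, hw, rfl⟩
      exact hy ⟨w, hw, Function.iterate_succ_apply' F k w⟩
    · exact Or.inl ⟨hyX, h⟩

/-- Combinatorial step: if the images never stabilize, there is an orbit with unique preimages. -/
lemma exists_orbit {α : Type} (X Ω : Set α) (F : α → α) (hΩX : Ω ⊆ X)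
    (hcoim : (X \ F '' X).Finite) (hΩcof : (X \ Ω).Finite) (hinv : F '' Ω ⊆ Ω)
    (hne : ∀ k, (F^[k] '' Ω \ F^[k + 1] '' Ω).Nonempty) :
    ∃ (x : ℕ → α) (k0 : ℕ), (∀ i, x i ∈ F^[k0 + i] '' Ω \ F^[k0 + i + 1] '' Ω) ∧
      (∀ i, F (x i) = x (i + 1)) ∧ (∀ i, ∀ y ∈ X, F y = x (i + 1) → y = x i) := by
  classical
  set A : ℕ → Set α := fun k => F^[k] '' Ω with hA
  have hAs : ∀ k, A (k + 1) = F '' A k := by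
    intro k
    simp only [hA, Function.iterate_succ', Set.image_comp]
  have hA0 : A 0 = Ω := by simp [hA]
  have hanti1 : ∀ k, A (k + 1) ⊆ A k := by
    intro k
    induction k with
    | zero => rw [hAs, hA0]; exact hinv
    | succ k ih => rw [hAs (k + 1)]; nth_rw 2 [hAs k]; exact Set.image_mono ih
  have hanti : Antitone A := antitone_nat_of_succ_le hanti1
  have hAX : ∀ k, A k ⊆ X := fun k => (hanti (Nat.zero_le k)).trans (hA0 ▸ hΩX)
  have hAcof : ∀ k, (X \ A k).Finite := cofinite_iter X Ω F hcoim hΩcof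
  set M : ℕ → Set α := fun k => A k \ A (k + 1) with hM
  have hMfin : ∀ k, (M k).Finite := fun k =>
    (hAcof (k + 1)).subset (fun y hy => ⟨hAX k hy.1, hy.2⟩)
  have hMsub : ∀ k, M (k + 1) ⊆ F '' M k := by
    rintro k y ⟨hy, hy'⟩
    rw [hAs] at hy
    obtain ⟨t, ht, rfl⟩ := hy
    refine ⟨t, ⟨ht, fun h => hy' ?_⟩, rfl⟩
    rw [hAs]
    exact ⟨t, h, rfl⟩
  have hcard : ∀ k, (M (k + 1)).ncard ≤ (M k).ncard := fun k =>
    (Set.ncard_le_ncard (hMsub k) ((hMfin k).image F)).trans (Set.ncard_image_le (hMfin k))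
  obtain ⟨k0, hk0⟩ : ∃ k0, ∀ k ≥ k0, (M (k + 1)).ncard = (M k).ncard := by
    have hanc : Antitone (fun k => (M k).ncard) := antitone_nat_of_succ_le hcard
    obtain ⟨k0, hk0⟩ : ∃ k0, ∀ k, (M k0).ncard ≤ (M k).ncard := by
      obtain ⟨k0, hk0⟩ := Function.argmin_le (f := fun k : ℕ => (M k).ncard) |> fun h =>
        (⟨Function.argmin (fun k : ℕ => (M k).ncard), fun k => h k⟩ :
          ∃ k0, ∀ k, (M k0).ncard ≤ (M k).ncard)
      exact ⟨k0, hk0⟩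
    refine ⟨k0, fun k hk => le_antisymm (hcard k) ((hanc hk).trans (hk0 _))⟩
  have himg : ∀ k ≥ k0, F '' M k = M (k + 1) := by
    intro k hk
    symm
    apply Set.eq_of_subset_of_ncard_le (hMsub k) _ ((hMfin k).image F)
    rw [hk0 k hk]
    exact Set.ncard_image_le (hMfin k)
  have hinjM : ∀ k ≥ k0, Set.InjOn F (M k) := by
    intro k hk
    apply Set.injOn_of_ncard_image_eq _ (hMfin k)
    rw [himg k hk, hk0 k hk]
  have hdisj : ∀ j k, j < k → ∀ y, y ∈ M j → y ∉ M k := fun j k hjk y hy hy' =>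
    hy.2 (hanti hjk hy'.1)
  obtain ⟨y0, hy0⟩ := hne k0
  have hyM : ∀ i, F^[i] y0 ∈ M (k0 + i) := by
    intro i
    induction i with
    | zero => exact hy0
    | succ i ih =>
      rw [Function.iterate_succ_apply', ← add_assoc, ← himg _ (by omega)]
      exact ⟨_, ih, rfl⟩
  have hyinj : Function.Injective (fun i => F^[i] y0) := by
    intro i j hij
    by_contra hne
    rcases lt_or_gt_of_ne hne with h | h
    · exact hdisj (k0 + i) (k0 + j) (by omega) _ (hyM i) (by
        have := hyM j; simp only at hij; rwa [← hij] at this)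
    · exact hdisj (k0 + j) (k0 + i) (by omega) _ (hyM j) (by
        have := hyM i; simp only at hij; rwa [hij] at this)
  -- avoid the finite image of the complement of `A k0`
  have hfin : {i | F^[i] y0 ∈ F '' (X \ A k0)}.Finite :=
    ((hAcof k0).image F).preimage hyinj.injOn
  obtain ⟨i0, hi0⟩ := hfin.bddAbove
  have hmain : ∀ i > i0, ∀ y ∈ X, F y = F^[i + 1] y0 → y = F^[i] y0 := by
    intro i hi y hyX hy
    have hyA : y ∈ A k0 := by
      by_contra h
      have := hi0 (show i + 1 ∈ {i | F^[i] y0 ∈ F '' (X \ A k0)} from ⟨y, ⟨hyX, h⟩, hy⟩)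
      omega
    have hex : ∃ k, y ∉ A k := by
      by_contra! h
      have h1 := (hyM (i + 1)).2
      rw [hAs] at h1
      exact h1 ⟨y, h _, hy⟩
    obtain ⟨j, hj⟩ : ∃ j, Nat.find hex = j + 1 := by
      apply Nat.exists_eq_succ_of_ne_zero
      intro h0
      have := Nat.find_spec hex
      rw [h0] at this
      exact this (hanti (Nat.zero_le _) hyA)
    have hyMj : y ∈ M j := by
      refine ⟨?_, ?_⟩
      · by_contra h
        have := Nat.find_min' hex h
        omega
      · rw [← hj]; exact Nat.find_spec hex
    have hjk : k0 ≤ j := by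
      by_contra h
      exact hyMj.2 (hanti (by omega) hyA)
    have h2 : F y ∈ M (j + 1) := by
      rw [← himg j hjk]; exact ⟨y, hyMj, rfl⟩
    have h3 : F y ∈ M (k0 + (i + 1)) := hy ▸ hyM (i + 1)
    have h4 : j = k0 + i := by
      by_contra hne
      rcases lt_or_gt_of_ne hne with h | h
      · exact hdisj _ _ (by omega) _ h2 h3
      · exact hdisj _ _ (by omega) _ h3 h2
    subst h4
    apply hinjM _ hjk hyMj (hyM i)
    rw [hy, Function.iterate_succ_apply']
  refine ⟨fun i => F^[i0 + 1 + i] y0, k0 + (i0 + 1), fun i => ?_, fun i => ?_, fun i y hy h => ?_⟩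
  · have := hyM (i0 + 1 + i)
    rw [← add_assoc k0] at this
    exact this
  · exact (Function.iterate_succ_apply' F _ y0).symm
  · exact hmain (i0 + 1 + i) (by omega) y hy h

theorem iterated_images_stabilize
    (N : ℕ) (P : Set (MvPolynomial (Fin N) ℂ))
    (X : Set (Fin N → ℂ))
    (hX : X = {x | ∀ p ∈ P, MvPolynomial.eval x p = 0})
    (hXne : X.Nonempty)
    (F : (Fin N → ℂ) → (Fin N → ℂ))
    (hFpoly : ∃ q : Fin N → MvPolynomial (Fin N) ℂ,
      ∀ x i, F x i = MvPolynomial.eval x (q i))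
    (hmaps : Set.MapsTo F X X)
    (hopen : IsOpenMap (Set.MapsTo.restrict F X X hmaps))
    (hcoim : (X \ F '' X).Finite)
    (Ω : Set (Fin N → ℂ)) (hΩX : Ω ⊆ X) (hΩcof : (X \ Ω).Finite)
    (hinv : F '' Ω ⊆ Ω) :
    (∃ K > 0, ∀ k ≥ K, F^[k] '' Ω = F^[K] '' Ω) ∧
    (∃ U : Set (Fin N → ℂ), IsOpen U ∧ (⋂ k > 0, F^[k] '' Ω) = U ∩ Ω) ∧
    (Ω \ ⋂ k > 0, F^[k] '' Ω).Finite := by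
  classical
  obtain ⟨q, hq⟩ := hFpoly
  have hs : ∀ k, F^[k + 1] '' Ω = F '' (F^[k] '' Ω) := by
    intro k
    rw [Function.iterate_succ', Set.image_comp]
  have hanti1 : ∀ k, F^[k + 1] '' Ω ⊆ F^[k] '' Ω := by
    intro k
    rw [Function.iterate_succ, Set.image_comp]
    exact Set.image_mono hinv
  have hanti : Antitone (fun k => F^[k] '' Ω) := antitone_nat_of_succ_le hanti1
  have hsubΩ : ∀ k, F^[k] '' Ω ⊆ Ω := fun k => by
    have := hanti (Nat.zero_le k)
    simpa using this
  have hstab : ∃ k, F^[k] '' Ω ⊆ F^[k + 1] '' Ω := by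
    by_contra! hno
    have hne : ∀ k, (F^[k] '' Ω \ F^[k + 1] '' Ω).Nonempty := fun k =>
      Set.sdiff_nonempty.2 (hno k)
    obtain ⟨x, k0, hxM, hxF, huniq⟩ := exists_orbit X Ω F hΩX hcoim hΩcof hinv hne
    have hxΩ : ∀ i, x i ∈ Ω := fun i => hsubΩ _ (hxM i).1
    obtain ⟨L, Z, hZX, hxZ, hsurj⟩ := core P X hX F q hq hmaps hopen x
      (fun i => hΩX (hxΩ i)) hxF huniq
    have hg : ∀ z : Z, ∃ y : Z, F y = z := by
      rintro ⟨z, hz⟩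
      obtain ⟨y, hy, h⟩ := hsurj hz
      exact ⟨⟨y, hy⟩, h⟩
    choose g hg using hg
    let c : ℕ → Z := fun n => g^[n] ⟨x L, hxZ⟩
    have hc : ∀ n, F (c (n + 1)) = c n := by
      intro n
      simp only [c, Function.iterate_succ_apply', hg]
    have hc' : ∀ m n, F^[m] (c (n + m)) = c n := by
      intro m
      induction m with
      | zero => intro n; rfl
      | succ m ih =>
        intro n
        rw [Function.iterate_succ_apply, ← add_assoc, hc, ih]
    have hcL : ∀ n, F^[n] (c n) = x L := by
      intro n
      have := hc' n 0
      rwa [zero_add] at this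
    have hcE : ∀ n, (c (n + (k0 + L + 1)) : Fin N → ℂ) ∈ X \ Ω := by
      intro n
      refine ⟨hZX (c _).2, fun h => (hxM L).2 ?_⟩
      exact hanti (show k0 + L + 1 ≤ n + (k0 + L + 1) by omega) ⟨_, h, hcL _⟩
    obtain ⟨a, b, hab, habe⟩ : ∃ a b : ℕ, a < b ∧ (c a : Fin N → ℂ) = c b := by
      have hninj : ¬ Function.Injective (fun n => (c (n + (k0 + L + 1)) : Fin N → ℂ)) := by
        intro hinj
        exact Set.infinite_range_of_injective hinj
          (hΩcof.subset (by rintro _ ⟨n, rfl⟩; exact hcE n))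
      rw [Function.Injective] at hninj
      push Not at hninj
      obtain ⟨a, b, h, hne⟩ := hninj
      rcases lt_or_gt_of_ne hne with h' | h'
      · exact ⟨_, _, by omega, h⟩
      · exact ⟨_, _, by omega, h.symm⟩
    -- `x L` is periodic
    have hxit : ∀ m, F^[m] (x L) = x (L + m) := by
      intro m
      induction m with
      | zero => rfl
      | succ m ih => rw [Function.iterate_succ_apply', ih, hxF]; rfl
    have hper : x (L + (b - a)) = x L := by
      have h1 : F^[b - a] (c b) = c a := by
        have := hc' (b - a) a
        rwa [show a + (b - a) = b by omega] at this
      rw [← hxit, ← hcL a, ← Function.iterate_add_apply, add_comm, Function.iterate_add_apply]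
      nth_rw 1 [habe]
      rw [h1]
    have h1 := (hxM (L + (b - a))).1
    rw [hper] at h1
    exact (hxM L).2 (hanti (show k0 + L + 1 ≤ k0 + (L + (b - a)) by omega) h1)
  obtain ⟨k1, hk1⟩ := hstab
  have hst : ∀ m, F^[k1 + m] '' Ω = F^[k1] '' Ω := by
    intro m
    induction m with
    | zero => rfl
    | succ m ih =>
      rw [← add_assoc, hs, ih, ← hs]
      exact (hanti1 k1).antisymm hk1
  have hst' : ∀ k ≥ k1, F^[k] '' Ω = F^[k1] '' Ω := by
    intro k hk
    obtain ⟨m, rfl⟩ := Nat.exists_eq_add_of_le hk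
    exact hst m
  have hInt : (⋂ k > 0, F^[k] '' Ω) = F^[k1 + 1] '' Ω := by
    apply Set.Subset.antisymm
    · exact Set.iInter₂_subset (k1 + 1) (Nat.succ_pos _)
    · refine Set.subset_iInter₂ fun k _ => ?_
      rcases le_total k (k1 + 1) with h | h
      · exact hanti h
      · rw [hst' k (by omega), hst' (k1 + 1) (by omega)]
  have hopenk : ∀ k, ∃ U : Set (Fin N → ℂ), IsOpen U ∧ F^[k] '' Ω = U ∩ X := by
    intro k
    induction k with
    | zero =>
      refine ⟨(X \ Ω)ᶜ, hΩcof.isClosed.isOpen_compl, ?_⟩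
      ext v
      simp only [Function.iterate_zero, Set.image_id, Set.mem_inter_iff, Set.mem_compl_iff,
        Set.mem_sdiff, not_and, not_not]
      exact ⟨fun h => ⟨fun _ => h, hΩX h⟩, fun h => h.1 h.2⟩
    | succ k ih =>
      obtain ⟨U, hU, hUe⟩ := ih
      obtain ⟨V, hV, hVe⟩ := isOpen_induced_iff.1
        (hopen _ (hU.preimage (continuous_subtype_val : Continuous (Subtype.val : X → _))))
      refine ⟨V, hV, ?_⟩
      rw [hs, hUe]
      ext v
      constructor
      · rintro ⟨t, ⟨htU, htX⟩, rfl⟩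
        refine ⟨?_, hmaps htX⟩
        have : (⟨F t, hmaps htX⟩ : X) ∈ (Subtype.val : X → Fin N → ℂ) ⁻¹' V := by
          rw [hVe]
          exact ⟨⟨t, htX⟩, htU, rfl⟩
        exact this
      · rintro ⟨hvV, hvX⟩
        have : (⟨v, hvX⟩ : X) ∈ (Subtype.val : X → Fin N → ℂ) ⁻¹' V := hvV
        rw [hVe] at this
        obtain ⟨t, ht, hte⟩ := this
        exact ⟨t.1, ⟨ht, t.2⟩, congrArg Subtype.val hte⟩
  refine ⟨⟨k1 + 1, Nat.succ_pos _, fun k hk => ?_⟩, ?_, ?_⟩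
  · rw [hst' k (by omega), hst' (k1 + 1) (by omega)]
  · obtain ⟨U, hU, hUe⟩ := hopenk (k1 + 1)
    refine ⟨U, hU, ?_⟩
    rw [hInt]
    apply Set.Subset.antisymm
    · intro v hv
      exact ⟨(hUe ▸ hv : v ∈ U ∩ X).1, hsubΩ _ hv⟩
    · rintro v ⟨hvU, hvΩ⟩
      rw [hUe]
      exact ⟨hvU, hΩX hvΩ⟩
  · rw [hInt]
    exact (cofinite_iter X Ω F hcoim hΩcof (k1 + 1)).subset fun v hv => ⟨hΩX hv.1, hv.2⟩
end

section
/- Let n > 1, let Ω be a cofinite subset of ℂ^n (ℂ^n − Ω is finite), and let f : Ω → Ω be the restriction of a polynomial map F : ℂ^n → ℂ^n such that f maps Ω into Ω, the Jacobian determinant of F is nonzero at every point of Ω, and f(Ω) is a cofinite subset of Ω. Then the iterated images f^k(Ω) stabilize: there exists K > 0 with f^k(Ω) = f^K(Ω) for all k ≥ K, and the stable image ⋂_{k>0} f^k(Ω) is an open, simply connected, cofinite subset of Ω (with respect to the Euclidean topology). -/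
section SC
open MeasureTheory Set
variable {E : Type*} [NormedAddCommGroup E] [NormedSpace ℝ E]

lemma sc_convex {S C : Set E} (hC : Convex ℝ C) (hCS : C ⊆ S) {x y : S} (p q : Path x y)
    (hp : ∀ t, (p t : E) ∈ C) (hq : ∀ t, (q t : E) ∈ C) : p.Homotopic q := by
  have hx : (x : E) ∈ C := by simpa using hp 0
  have hy : (y : E) ∈ C := by simpa using hp 1
  have hne : C.Nonempty := ⟨_, hx⟩
  have : ContractibleSpace C := hC.contractibleSpace hne
  let lift (r : Path x y) (hr : ∀ t, (r t : E) ∈ C) : Path (⟨x, hx⟩ : C) ⟨y, hy⟩ :=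
    { toFun := fun t => ⟨r t, hr t⟩
      continuous_toFun := by fun_prop
      source' := by simp
      target' := by simp }
  have h := SimplyConnectedSpace.paths_homotopic (lift p hp) (lift q hq)
  let ι : C(C, S) := ⟨fun c => ⟨c, hCS c.2⟩, by fun_prop⟩
  have h2 := h.map ι
  exact h2

lemma sc_seg {S : Set E} (x y : S) (h : segment ℝ (x : E) y ⊆ S) :
    ∃ p : Path x y, ∀ t, (p t : E) ∈ segment ℝ (x : E) y := by
  have key : ∀ t : unitInterval, AffineMap.lineMap (x : E) (y : E) (t : ℝ) ∈ segment ℝ (x : E) y := by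
    intro t
    rw [segment_eq_image_lineMap]
    exact ⟨t, t.2, rfl⟩
  refine ⟨{ toFun := fun t => ⟨AffineMap.lineMap (x : E) (y : E) (t : ℝ), h (key t)⟩
            continuous_toFun := by
              refine Continuous.subtype_mk ?_ _
              simp only [AffineMap.lineMap_apply_module]
              fun_prop
            source' := by simp
            target' := by simp }, key⟩

def SCGood [MeasureSpace E] {S : Set E} {x y : S} (γ : Path x y) : Prop :=
  ∀ᵐ p : E, ∃ (hp : p ∈ S) (α : Path x ⟨p, hp⟩) (β : Path ⟨p, hp⟩ y),
    segment ℝ (x : E) p ⊆ S ∧ segment ℝ p (y : E) ⊆ S ∧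
    (∀ t, (α t : E) ∈ segment ℝ (x : E) p) ∧ (∀ t, (β t : E) ∈ segment ℝ p (y : E)) ∧
    γ.Homotopic (α.trans β)

variable [MeasureSpace E]

lemma SCGood.congr {S : Set E} {x y : S} {γ γ' : Path x y} (h : SCGood γ)
    (h' : γ.Homotopic γ') : SCGood γ' := by
  filter_upwards [h] with p ⟨hp, α, β, h1, h2, h3, h4, h5⟩
  exact ⟨hp, α, β, h1, h2, h3, h4, h'.symm.trans h5⟩

lemma SCGood.of_cast {S : Set E} {x y x' y' : S} {γ : Path x y} (hx : x' = x) (hy : y' = y)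
    (h : SCGood (γ.cast hx hy)) : SCGood γ := by
  subst hx hy
  exact h

lemma SCGood.trans {S : Set E} {x y z : S} {γ : Path x y} {γ' : Path y z} (h : SCGood γ)
    (h' : SCGood γ') : SCGood (γ.trans γ') := by
  filter_upwards [h, h'] with p ⟨hp, α, β, h1, h2, h3, h4, h5⟩ ⟨_, α', β', h1', h2', h3', h4', h5'⟩
  refine ⟨hp, α, β', h1, h2', h3, h4', ?_⟩
  have e : (β.trans α').Homotopic (Path.refl _) := by
    refine sc_convex (convex_segment p (y : E)) h2 _ _ ?_ ?_
    · intro t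
      rw [Path.trans_apply]
      split_ifs
      · exact h4 _
      · rw [segment_symm]; exact h3' _
    · intro t
      exact left_mem_segment ℝ _ _
  rw [← Path.Homotopic.Quotient.eq] at *
  simp only [Path.Homotopic.Quotient.mk_trans] at *
  rw [h5, h5']
  have a1 := Path.Homotopic.Quotient.trans_assoc (Path.Homotopic.Quotient.mk α)
    (Path.Homotopic.Quotient.mk β) ((Path.Homotopic.Quotient.mk α').trans (Path.Homotopic.Quotient.mk β'))
  rw [a1, ← Path.Homotopic.Quotient.trans_assoc (Path.Homotopic.Quotient.mk β), e]
  simp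

variable [BorelSpace E] [FiniteDimensional ℝ E] [(volume : Measure E).IsAddHaarMeasure]

lemma sc_ae (hdim : 2 < Module.finrank ℝ E) {A : Set E} (hA : A.Finite) (x y : E)
    (hxy : segment ℝ x y ⊆ Aᶜ) : ∀ᵐ p : E, convexHull ℝ {p, x, y} ⊆ Aᶜ := by
  have : ∀ a ∈ A, ∀ᵐ p : E, a ∉ convexHull ℝ {p, x, y} := by
    intro a ha
    let V : AffineSubspace ℝ E := AffineSubspace.mk' a (Submodule.span ℝ {x - a, y - a})
    have hV : V ≠ ⊤ := by
      intro h
      have h2 : V.direction = ⊤ := by rw [h]; simp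
      rw [AffineSubspace.direction_mk'] at h2
      classical
      have h3 := finrank_span_le_card (R := ℝ) ({x - a, y - a} : Set E)
      rw [h2, finrank_top] at h3
      have h4 : ({x - a, y - a} : Set E).toFinset.card ≤ 2 := by
        rw [← Set.ncard_eq_toFinset_card']
        exact (Set.ncard_insert_le _ _).trans (by simp)
      omega
    have h0 := Measure.addHaar_affineSubspace (volume : Measure E) V hV
    have h1 : ∀ᵐ p : E, p ∉ (V : Set E) := by
      rw [ae_iff]; simpa using h0
    filter_upwards [h1] with p hp hmem
    apply hp
    rw [convexHull_insert (by simp), convexHull_pair, mem_convexJoin] at hmem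
    obtain ⟨p', hp', w, hw, hseg⟩ := hmem
    obtain rfl : p' = p := hp'
    have hwa : w ≠ a := fun h => hxy hw (h ▸ ha)
    obtain ⟨s, t, hs, ht, hst, rfl⟩ := hseg
    obtain ⟨s', t', hs', ht', hst', rfl⟩ := hw
    have hs0 : s ≠ 0 := by
      rintro rfl
      obtain rfl : t = 1 := by linarith
      simp at hwa
    set a := s • p' + t • (s' • x + t' • y) with hadef
    change p' ∈ AffineSubspace.mk' a _
    rw [AffineSubspace.mem_mk', Submodule.mem_span_pair]
    refine ⟨-(t * s') / s, -(t * t') / s, ?_⟩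
    have : s • (p' -ᵥ a) = s • ((-(t * s') / s) • (x - a) + (-(t * t') / s) • (y - a)) := by
      rw [smul_add, smul_smul, smul_smul, mul_div_cancel₀ _ hs0, mul_div_cancel₀ _ hs0, vsub_eq_sub]
      have e1 : s • p' = a - t • (s' • x + t' • y) := by rw [hadef]; abel
      rw [smul_sub, e1]
      have e2 : s = 1 - t * s' - t * t' := by rw [← mul_one t] at hst; rw [← hst'] at hst; linarith
      rw [e2]
      module
    exact (smul_right_injective E hs0 this).symm
  have h2 := (ae_ball_iff hA.countable).2 this
  filter_upwards [h2] with p hp z hz hzA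
  exact hp z hzA hz

lemma sc_base (hdim : 2 < Module.finrank ℝ E) {A : Set E} (hA : A.Finite) {x y : ↥(Aᶜ)}
    (γ : Path x y) {C : Set E} (hC : Convex ℝ C) (hCA : C ⊆ Aᶜ) (h : ∀ t, (γ t : E) ∈ C) :
    SCGood γ := by
  have hx : (x : E) ∈ C := by simpa using h 0
  have hy : (y : E) ∈ C := by simpa using h 1
  have hseg := (hC.segment_subset hx hy).trans hCA
  filter_upwards [sc_ae hdim hA x y hseg] with p hp
  have m1 : p ∈ convexHull ℝ {p, (x : E), (y : E)} := subset_convexHull _ _ (by simp)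
  have m2 : (x : E) ∈ convexHull ℝ {p, (x : E), (y : E)} := subset_convexHull _ _ (by simp)
  have m3 : (y : E) ∈ convexHull ℝ {p, (x : E), (y : E)} := subset_convexHull _ _ (by simp)
  have cv := convex_convexHull ℝ {p, (x : E), (y : E)}
  have s1 := (cv.segment_subset m2 m1)
  have s2 := (cv.segment_subset m1 m3)
  have s3 := (cv.segment_subset m2 m3)
  obtain ⟨α, hα⟩ := sc_seg x ⟨p, hp m1⟩ (s1.trans hp)
  obtain ⟨β, hβ⟩ := sc_seg ⟨p, hp m1⟩ y (s2.trans hp)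
  obtain ⟨δ, hδ⟩ := sc_seg x y (s3.trans hp)
  refine ⟨hp m1, α, β, s1.trans hp, s2.trans hp, hα, hβ, ?_⟩
  refine (sc_convex hC hCA γ δ h fun t => hC.segment_subset hx hy (hδ t)).trans ?_
  refine sc_convex cv hp _ _ (fun t => s3 (hδ t)) fun t => ?_
  rw [Path.trans_apply]
  split_ifs
  · exact s1 (hα _)
  · exact s2 (hβ _)

lemma sc_all (hdim : 2 < Module.finrank ℝ E) {A : Set E} (hA : A.Finite) {x y : ↥(Aᶜ)}
    (γ : Path x y) : SCGood γ := by
  have hopen : IsOpen Aᶜ := hA.isClosed.isOpen_compl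
  have hball : ∀ z : ↥(Aᶜ), ∃ r > 0, Metric.ball (z : E) r ⊆ Aᶜ := fun z =>
    Metric.isOpen_iff.1 hopen z z.2
  choose r hr hball using hball
  obtain ⟨t, ht0, htm, ⟨N, hN⟩, hcov⟩ :=
    exists_monotone_Icc_subset_open_cover_unitInterval
    (c := fun z : ↥(Aᶜ) => {s | (γ s : E) ∈ Metric.ball (z : E) (r z)})
    (fun z => Metric.isOpen_ball.preimage (by fun_prop))
    (fun s _ => mem_iUnion.2 ⟨γ s, Metric.mem_ball_self (hr _)⟩)
  have hstep : ∀ n, SCGood (γ.subpath (t n) (t (n+1))) := by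
    intro n
    obtain ⟨z, hz⟩ := hcov n
    refine sc_base hdim hA _ (convex_ball (z : E) (r z)) (hball z) ?_
    intro s
    have : γ.subpath (t n) (t (n+1)) s ∈ range (γ.subpath (t n) (t (n+1))) := ⟨s, rfl⟩
    rw [Path.range_subpath_of_le _ _ _ (htm (Nat.le_succ n))] at this
    obtain ⟨u, hu, hu2⟩ := this
    rw [← hu2]
    exact hz hu
  have hind : ∀ n, SCGood (γ.subpath (t 0) (t n)) := by
    intro n
    induction n with
    | zero =>
      rw [Path.subpath_self]
      exact sc_base hdim hA _ (convex_ball ((γ (t 0)) : E) (r _)) (hball _)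
        (fun s => Metric.mem_ball_self (hr _))
    | succ n ih => exact (ih.trans (hstep n)).congr ⟨Path.Homotopy.subpathTransSubpath γ _ _ _⟩
  have h1 := hind N
  rw [ht0, hN N le_rfl, Path.subpath_zero_one] at h1
  exact h1.of_cast

theorem sc_main (hdim : 2 < Module.finrank ℝ E) {A : Set E} (hA : A.Finite) :
    SimplyConnectedSpace ↥(Aᶜ) := by
  rw [simply_connected_iff_paths_homotopic']
  constructor
  · rw [← isPathConnected_iff_pathConnectedSpace]
    refine Set.Countable.isPathConnected_compl_of_one_lt_rank ?_ hA.countable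
    rw [← Module.finrank_eq_rank]
    exact_mod_cast (by omega : 1 < Module.finrank ℝ E)
  · intro x y p₁ p₂
    have := (sc_all hdim hA p₁).and (sc_all hdim hA p₂)
    obtain ⟨p, ⟨hp, α, β, h1, h2, h3, h4, h5⟩, ⟨_, α', β', h1', h2', h3', h4', h5'⟩⟩ := this.exists
    refine h5.trans (Path.Homotopic.trans ?_ h5'.symm)
    exact Path.Homotopic.hcomp (sc_convex (convex_segment _ _) h1 _ _ h3 h3')
      (sc_convex (convex_segment _ _) h2 _ _ h4 h4')
end SC



section Et
open MvPolynomial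

lemma pderiv_rename_inl {R σ τ : Type*} [CommRing R] (i : σ) (p : MvPolynomial σ R) :
    pderiv (Sum.inl i : σ ⊕ τ) (rename Sum.inl p) = rename Sum.inl (pderiv i p) :=
  pderiv_rename Sum.inl_injective i p

lemma pderiv_rename_inr {R σ τ : Type*} [CommRing R] (i : τ) (p : MvPolynomial σ R) :
    pderiv (Sum.inr i : σ ⊕ τ) (rename Sum.inl p) = 0 := by
  apply pderiv_eq_zero_of_notMem_vars
  intro h
  classical
  have := vars_rename (Sum.inl : σ → σ ⊕ τ) p h
  simp at this

noncomputable def etRel {R : Type*} [CommRing R] {n : ℕ} (v : Fin n → MvPolynomial (Fin n) R)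
    (H : MvPolynomial (Fin n) R) : Fin n ⊕ Unit → MvPolynomial (Fin n ⊕ Unit) R :=
  Sum.elim (fun i => rename Sum.inl (v i)) (fun _ => X (Sum.inr ()) * rename Sum.inl H - 1)

lemma etRel_inl {R : Type*} [CommRing R] {n : ℕ} (v : Fin n → MvPolynomial (Fin n) R)
    (H : MvPolynomial (Fin n) R) (i : Fin n) : etRel v H (Sum.inl i) = rename Sum.inl (v i) := rfl

lemma etRel_inr {R : Type*} [CommRing R] {n : ℕ} (v : Fin n → MvPolynomial (Fin n) R)
    (H : MvPolynomial (Fin n) R) (i : Unit) :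
    etRel v H (Sum.inr i) = X (Sum.inr ()) * rename Sum.inl H - 1 := rfl

abbrev EtAlg {R : Type*} [CommRing R] {n : ℕ} (v : Fin n → MvPolynomial (Fin n) R)
    (H : MvPolynomial (Fin n) R) : Type _ :=
  MvPolynomial (Fin n ⊕ Unit) R ⧸ Ideal.span (Set.range (etRel v H))

lemma etAlg_smooth {R : Type*} [CommRing R] {n : ℕ} (v : Fin n → MvPolynomial (Fin n) R)
    (H : MvPolynomial (Fin n) R) (hH : (Matrix.of fun i j => pderiv j (v i)).det ∣ H) :
    Algebra.IsStandardSmooth R (EtAlg v H) := by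
  let P := Algebra.PreSubmersivePresentation.naive (v := etRel v H) id Function.injective_id
  have hunit : IsUnit (Ideal.Quotient.mk (Ideal.span (Set.range (etRel v H))) (rename Sum.inl H)) := by
    rw [isUnit_iff_exists_inv']
    refine ⟨Ideal.Quotient.mk _ (X (Sum.inr ())), ?_⟩
    rw [← map_mul, ← map_one (Ideal.Quotient.mk _), Ideal.Quotient.eq]
    exact Ideal.subset_span ⟨Sum.inr (), rfl⟩
  have hJ : IsUnit P.jacobian := by
    rw [P.jacobian_eq_jacobiMatrix_det]
    have : P.jacobiMatrix = Matrix.fromBlocks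
        ((Matrix.of fun i j => pderiv j (v i)).map (rename Sum.inl)).transpose
        (Matrix.of fun i _ => pderiv (Sum.inl i) (X (Sum.inr ()) * rename Sum.inl H - 1))
        0
        (Matrix.of fun _ _ => rename Sum.inl H) := by
      ext1 i j
      rw [Algebra.PreSubmersivePresentation.jacobiMatrix_naive]
      rcases i with i | i <;> rcases j with j | j
      · simp [etRel, pderiv_rename_inl]
      · simp [etRel]
      · simp [etRel, pderiv_rename_inr]
      · simp [etRel, pderiv_rename_inr]
    rw [this]
    have e2 : (Matrix.fromBlocks
        ((Matrix.of fun i j => pderiv j (v i)).map (rename Sum.inl)).transpose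
        (Matrix.of fun i (_ : Unit) => pderiv (Sum.inl i) (X (Sum.inr ()) * rename Sum.inl H - 1))
        0
        (Matrix.of fun (_ _ : Unit) => rename (R := R) (Sum.inl : Fin n → Fin n ⊕ Unit) H)).det
        = rename Sum.inl (Matrix.of fun i j => pderiv j (v i)).det * rename Sum.inl H := by
      rw [Matrix.det_fromBlocks_zero₂₁, Matrix.det_transpose,
        AlgHom.map_det (rename (R := R) (Sum.inl : Fin n → Fin n ⊕ Unit))]
      congr 1
      exact Matrix.det_unique _
    have e3 := congrArg (Ideal.Quotient.mk (Ideal.span (Set.range (etRel v H)))) e2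
    refine (iff_of_eq (congrArg IsUnit e3)).2 ?_
    rw [map_mul]
    refine IsUnit.mul ?_ hunit
    refine isUnit_of_dvd_unit ?_ hunit
    exact map_dvd _ (map_dvd _ hH)
  exact Algebra.SubmersivePresentation.isStandardSmooth ⟨P, hJ⟩

lemma exists_point {R A : Type} [CommRing R] [CommRing A] [Algebra R A] [Algebra ℂ R] [Algebra ℂ A]
    [IsScalarTower ℂ R A] [Algebra.FiniteType ℂ A]
    (φ : R →ₐ[ℂ] ℂ) (Q : Ideal A) (hQ : Q.IsPrime)
    (h : Q.comap (algebraMap R A) = RingHom.ker φ) :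
    ∃ ψ : A →ₐ[ℂ] ℂ, ∀ r, ψ (algebraMap R A r) = φ r := by
  obtain ⟨M, hM, hQM⟩ := Ideal.exists_le_maximal Q hQ.ne_top
  let _ : Field (A ⧸ M) := Ideal.Quotient.field M
  have hfin : Module.Finite ℂ (A ⧸ M) := finite_of_finite_type_of_isJacobsonRing ℂ (A ⧸ M)
  have hbij : Function.Bijective (algebraMap ℂ (A ⧸ M)) :=
    IsAlgClosed.algebraMap_bijective_of_isIntegral
  let e : ℂ ≃ₐ[ℂ] (A ⧸ M) := AlgEquiv.ofBijective (Algebra.ofId ℂ (A ⧸ M)) hbij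
  let ψ : A →ₐ[ℂ] ℂ := e.symm.toAlgHom.comp (Ideal.Quotient.mkₐ ℂ M)
  refine ⟨ψ, fun r => ?_⟩
  have hr : r - algebraMap ℂ R (φ r) ∈ Q.comap (algebraMap R A) := by
    rw [h, RingHom.mem_ker, map_sub, AlgHom.commutes]; simp
  have hr2 : ψ (algebraMap R A (r - algebraMap ℂ R (φ r))) = 0 := by
    have : Ideal.Quotient.mk M (algebraMap R A (r - algebraMap ℂ R (φ r))) = 0 :=
      Ideal.Quotient.eq_zero_iff_mem.2 (hQM hr)
    simp only [ψ, AlgHom.comp_apply, Ideal.Quotient.mkₐ_eq_mk]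
    rw [this, map_zero]
  rw [map_sub, map_sub, ← IsScalarTower.algebraMap_apply, AlgHom.commutes, sub_eq_zero] at hr2
  simpa using hr2

/-- Zariski openness of the projection from the fibre product off the diagonal. -/
lemma et_open {n : ℕ} (q : Fin n → MvPolynomial (Fin n) ℂ) (x₀ y₀ : Fin n → ℂ)
    (hq : ∀ i, eval x₀ (q i) = eval y₀ (q i)) (g : MvPolynomial (Fin n) ℂ) (hg : eval y₀ g ≠ 0)
    (hdet : (Matrix.of fun i j => eval y₀ (pderiv j (q i))).det ≠ 0) (hne : x₀ ≠ y₀) :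
    ∃ P : MvPolynomial (Fin n) ℂ, eval x₀ P ≠ 0 ∧ ∀ x, eval x P ≠ 0 →
      ∃ y, y ≠ x ∧ eval y g ≠ 0 ∧ ∀ i, eval x (q i) = eval y (q i) := by
  obtain ⟨k, hk⟩ := Function.ne_iff.1 hne
  let R := MvPolynomial (Fin n) ℂ
  let v : Fin n → MvPolynomial (Fin n) R := fun i => map C (q i) - C (q i)
  let H : MvPolynomial (Fin n) R := (Matrix.of fun i j => pderiv j (v i)).det *
    (map C g * (X k - C (X k)))
  have hsm : Algebra.IsStandardSmooth R (EtAlg v H) := etAlg_smooth v H ⟨_, rfl⟩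
  have : Algebra.Smooth R (EtAlg v H) := inferInstance
  have hopen := PrimeSpectrum.isOpenMap_comap_of_hasGoingDown_of_finitePresentation
    (R := R) (S := EtAlg v H)
  -- evaluation
  have ev : ∀ (x y : Fin n → ℂ) (p : MvPolynomial (Fin n) ℂ),
      eval₂ (eval x : R →+* ℂ) y (map C p) = eval y p := by
    intro x y p
    rw [eval₂_map]
    have : (eval x : R →+* ℂ).comp C = RingHom.id ℂ := by ext <;> simp
    rw [this]; rfl
  have evdet : eval₂Hom (eval x₀ : R →+* ℂ) y₀ (Matrix.of fun i j => pderiv j (v i)).det ≠ 0 := by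
    rw [RingHom.map_det]
    convert hdet using 2
    ext i j
    simp only [v, RingHom.mapMatrix_apply, Matrix.map_apply, Matrix.of_apply, map_sub, pderiv_C,
      sub_zero, coe_eval₂Hom, pderiv_map, ev]
  have evH : eval₂Hom (eval x₀ : R →+* ℂ) y₀ H ≠ 0 := by
    simp only [H]
    rw [map_mul, map_mul]
    refine mul_ne_zero evdet (mul_ne_zero ?_ ?_)
    · rw [coe_eval₂Hom, ev]; exact hg
    · simpa [sub_eq_zero] using hk.symm
  -- the point of the algebra
  let w : Fin n ⊕ Unit → ℂ := Sum.elim y₀ fun _ => (eval₂Hom (eval x₀ : R →+* ℂ) y₀ H)⁻¹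
  have hw : ∀ p : MvPolynomial (Fin n) R,
      eval₂Hom (eval x₀ : R →+* ℂ) w (rename Sum.inl p) = eval₂Hom (eval x₀ : R →+* ℂ) y₀ p := by
    intro p
    simp only [coe_eval₂Hom, eval₂_rename]; rfl
  let ψ₀ : EtAlg v H →+* ℂ := Ideal.Quotient.lift _ (eval₂Hom (eval x₀ : R →+* ℂ) w) (by
    intro a ha
    have : Ideal.span (Set.range (etRel v H)) ≤ RingHom.ker (eval₂Hom (eval x₀ : R →+* ℂ) w) := by
      rw [Ideal.span_le]
      rintro _ ⟨i | i, rfl⟩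
      · simp only [etRel, Sum.elim_inl, SetLike.mem_coe, RingHom.mem_ker]
        rw [hw]
        simp only [v, map_sub, coe_eval₂Hom, ev, eval₂_C, hq, sub_self]
      · simp only [etRel, Sum.elim_inr, SetLike.mem_coe, RingHom.mem_ker]
        rw [map_sub, map_mul, hw, map_one, coe_eval₂Hom, eval₂_X]
        simp only [w, Sum.elim_inr]
        rw [inv_mul_cancel₀ evH, sub_self]
    exact this ha)
  let Q₀ : PrimeSpectrum (EtAlg v H) := ⟨RingHom.ker ψ₀, RingHom.ker_isPrime ψ₀⟩
  let pt : (Fin n → ℂ) → PrimeSpectrum R := fun x => ⟨RingHom.ker (eval x), RingHom.ker_isPrime _⟩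
  have hQ₀ : PrimeSpectrum.comap (algebraMap R (EtAlg v H)) Q₀ = pt x₀ := by
    ext r
    change ψ₀ (Ideal.Quotient.mk _ (C r)) = 0 ↔ eval x₀ r = 0
    have : ψ₀ (Ideal.Quotient.mk _ (C r)) = eval x₀ r := by
      change eval₂Hom (eval x₀ : R →+* ℂ) w (C r) = _
      rw [coe_eval₂Hom, eval₂_C]
    rw [this]
  have hran := hopen.isOpen_range
  have hmem : pt x₀ ∈ Set.range (PrimeSpectrum.comap (algebraMap R (EtAlg v H))) := ⟨Q₀, hQ₀⟩
  obtain ⟨_, ⟨P, rfl⟩, hxP, hPsub⟩ :=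
    PrimeSpectrum.isTopologicalBasis_basic_opens.exists_subset_of_mem_open hmem hran
  refine ⟨P, hxP, fun x hx => ?_⟩
  obtain ⟨Q, hQ⟩ := hPsub (show pt x ∈ _ from hx)
  have hft : Algebra.FiniteType ℂ (EtAlg v H) :=
    Algebra.FiniteType.trans (S := R) inferInstance inferInstance
  obtain ⟨ψ, hψ⟩ := exists_point (R := R) (A := EtAlg v H) (aeval x) Q.asIdeal Q.isPrime
    (congrArg PrimeSpectrum.asIdeal hQ)
  let y : Fin n → ℂ := fun j => ψ (Ideal.Quotient.mk _ (X (Sum.inl j)))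
  have hy : ∀ p : MvPolynomial (Fin n) R,
      ψ (Ideal.Quotient.mk _ (rename Sum.inl p)) = eval₂Hom (eval x : R →+* ℂ) y p := by
    intro p
    have : (ψ.toRingHom.comp (Ideal.Quotient.mk (Ideal.span (Set.range (etRel v H))))).comp
        (rename (R := R) (Sum.inl : Fin n → Fin n ⊕ Unit)).toRingHom
        = eval₂Hom (eval x : R →+* ℂ) y := by
      apply MvPolynomial.ringHom_ext
      · intro r
        have h1 : ψ (Ideal.Quotient.mk _ (C r)) = eval x r := hψ r
        rw [coe_eval₂Hom, eval₂_C, ← h1]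
        change ψ (Ideal.Quotient.mk _ (rename Sum.inl (C r))) = _
        rw [rename_C]
      · intro i
        simp [y]
    exact congrArg (fun f => f p) this
  have hrel : ∀ i, ψ (Ideal.Quotient.mk _ (etRel v H i)) = 0 := by
    intro i
    rw [Ideal.Quotient.eq_zero_iff_mem.2 (Ideal.subset_span (Set.mem_range_self i)), map_zero]
  have hH : eval₂Hom (eval x : R →+* ℂ) y H ≠ 0 := by
    intro h0
    have := hrel (Sum.inr ())
    rw [etRel_inr, map_sub, map_sub, map_mul, map_mul, hy, h0] at this
    simp at this
  simp only [H] at hH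
  rw [map_mul, map_mul] at hH
  have hH2 := right_ne_zero_of_mul hH
  refine ⟨y, ?_, ?_, ?_⟩
  · rintro h
    apply right_ne_zero_of_mul hH2
    simp [h]
  · have := left_ne_zero_of_mul hH2
    rwa [coe_eval₂Hom, ev] at this
  · intro i
    have := hrel (Sum.inl i)
    rw [etRel_inl, hy] at this
    simp only [v, map_sub, coe_eval₂Hom, ev, eval₂_C] at this
    exact (sub_eq_zero.1 this).symm

end Et

section Comb
variable {X : Type*} {Ω : Set X} {F : X → X}

lemma iter_image_succ (k : ℕ) : F^[k+1] '' Ω = F '' (F^[k] '' Ω) := by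
  rw [Function.iterate_succ', Set.image_comp]

lemma iter_anti (hmaps : Set.MapsTo F Ω Ω) : Antitone fun k => F^[k] '' Ω := by
  apply antitone_nat_of_succ_le
  intro k
  rw [Function.iterate_succ, Set.image_comp]
  exact Set.image_mono hmaps.image_subset

lemma iter_cofin (hfin : (Ω \ F '' Ω).Finite) (k : ℕ) : (Ω \ F^[k] '' Ω).Finite := by
  induction k with
  | zero => simp
  | succ k ih =>
    refine (hfin.union (ih.image F)).subset ?_
    rintro x ⟨hx, hxn⟩
    by_cases h : x ∈ F '' Ω
    · right
      obtain ⟨y, hy, rfl⟩ := h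
      refine ⟨y, ⟨hy, fun hy2 => hxn ?_⟩, rfl⟩
      rw [iter_image_succ]
      exact ⟨y, hy2, rfl⟩
    · exact Or.inl ⟨hx, h⟩

lemma comb_main (hmaps : Set.MapsTo F Ω Ω) (hfin : (Ω \ F '' Ω).Finite)
    (hchain : ∀ b : ℕ → X, (∀ j, b j ∈ Ω) → (∀ j, F (b j) = b (j+1)) →
      (∀ j, ∀ x ∈ Ω, F x = b (j+1) → x = b j) → ∀ k, b 0 ∈ F^[k] '' Ω) :
    ∃ k, F^[k+1] '' Ω = F^[k] '' Ω := by
  by_contra! hne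
  have hanti := iter_anti hmaps
  have hsub : ∀ k, F^[k] '' Ω ⊆ Ω := fun k => by simpa using hanti (Nat.zero_le k)
  let B : ℕ → Set X := fun k => F^[k] '' Ω \ F^[k+1] '' Ω
  have hBne : ∀ k, (B k).Nonempty := by
    intro k
    rw [Set.nonempty_iff_ne_empty]
    intro h
    exact hne k (le_antisymm (hanti (Nat.le_succ k)) (Set.sdiff_eq_empty.1 h))
  have hBfin : ∀ k, (B k).Finite := fun k =>
    (iter_cofin hfin (k+1)).subset (Set.sdiff_subset_sdiff_left (hsub k))
  have hBsub : ∀ k, B (k+1) ⊆ F '' B k := by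
    rintro k x ⟨hx, hxn⟩
    rw [iter_image_succ] at hx
    obtain ⟨y, hy, rfl⟩ := hx
    refine ⟨y, ⟨hy, fun h => hxn ?_⟩, rfl⟩
    rw [iter_image_succ]
    exact ⟨y, h, rfl⟩
  have hcard : Antitone fun k => (B k).ncard := by
    apply antitone_nat_of_succ_le
    intro k
    exact (Set.ncard_le_ncard (hBsub k) ((hBfin k).image F)).trans (Set.ncard_image_le (hBfin k))
  obtain ⟨k0, hk0⟩ : ∃ k0, ∀ k, (B k0).ncard ≤ (B k).ncard :=
    ⟨Function.argmin (fun k => (B k).ncard), fun k => Function.argmin_le (fun k => (B k).ncard) k⟩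
  have hceq : ∀ k ≥ k0, (B k).ncard = (B k0).ncard := fun k hk => le_antisymm (hcard hk) (hk0 k)
  have himg : ∀ k ≥ k0, F '' B k = B (k+1) := by
    intro k hk
    refine (Set.eq_of_subset_of_ncard_le (hBsub k) ?_ ((hBfin k).image F)).symm
    rw [hceq (k+1) (by omega), ← hceq k hk]
    exact Set.ncard_image_le (hBfin k)
  have hinj : ∀ k ≥ k0, Set.InjOn F (B k) := by
    intro k hk
    apply Set.injOn_of_ncard_image_eq _ (hBfin k)
    rw [himg k hk, hceq (k+1) (by omega), ← hceq k hk]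
  have hdisj : ∀ i j x, x ∈ B i → x ∈ B j → i = j := by
    intro i j x hi hj
    by_contra hij
    rcases Nat.lt_or_gt_of_ne hij with h | h
    · exact hi.2 (hanti (show i + 1 ≤ j from h) hj.1)
    · exact hj.2 (hanti (show j + 1 ≤ i from h) hi.1)
  obtain ⟨b0, hb0⟩ := hBne k0
  let b : ℕ → X := fun j => F^[j] b0
  have hbs : ∀ j, F (b j) = b (j+1) := fun j => (Function.iterate_succ_apply' F j b0).symm
  have hbB : ∀ j, b j ∈ B (k0 + j) := by
    intro j
    induction j with
    | zero => exact hb0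
    | succ j ih =>
      rw [← hbs, ← add_assoc, ← himg _ (by omega)]
      exact ⟨_, ih, rfl⟩
  have hbinj : Function.Injective b := by
    intro i j hij
    have h1 := hbB i
    rw [hij] at h1
    have := hdisj _ _ _ h1 (hbB j)
    omega
  have hT : (F '' (Ω \ F^[k0] '' Ω)).Finite := (iter_cofin hfin k0).image F
  obtain ⟨N, hN⟩ := (hT.preimage hbinj.injOn).bddAbove
  have hNb : ∀ j, b (N + j + 1) ∉ F '' (Ω \ F^[k0] '' Ω) := by
    intro j h
    have := hN (show N + j + 1 ∈ _ from h)
    omega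
  have := hchain (fun j => b (N + j)) (fun j => hsub _ (hbB _).1) (fun j => hbs _) ?_ (k0 + N + 1)
  · exact (hbB N).2 this
  · intro j x hx hFx
    have hFx' : F x = b (N + j + 1) := hFx
    have hx0 : x ∈ F^[k0] '' Ω := by
      by_contra h
      exact hNb j ⟨x, ⟨hx, h⟩, hFx'⟩
    have hex : ∃ i, x ∉ F^[i] '' Ω := by
      refine ⟨k0 + (N + j + 1), fun h => (hbB (N+j+1)).2 ?_⟩
      rw [iter_image_succ, ← hFx']
      exact ⟨x, h, rfl⟩
    classical
    have hi := Nat.find_spec hex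
    have hmin := fun m => Nat.find_min hex (m := m)
    set i := Nat.find hex
    have hik : k0 < i := by
      by_contra h
      exact hi (hanti (show i ≤ k0 by omega) hx0)
    obtain ⟨i', hi'⟩ : ∃ i', i = i' + 1 := ⟨i - 1, by omega⟩
    have hxB : x ∈ B i' := ⟨not_not.1 (hmin i' (by omega)), hi' ▸ hi⟩
    have h1 : F x ∈ B (i' + 1) := by
      rw [← himg i' (by omega)]; exact ⟨x, hxB, rfl⟩
    rw [hFx'] at h1
    have h2 := hdisj _ _ _ h1 (hbB _)
    have h3 : i' = k0 + (N + j) := by omega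
    rw [h3] at hxB
    exact hinj _ (by omega) hxB (hbB _) (by rw [hFx', hbs])
end Comb

open FirstOrder in
lemma finite_definable {n : ℕ} [Ring.CompatibleRing ℂ] {A : Set (Fin n → ℂ)} (hA : A.Finite) :
    (Set.univ : Set ℂ).Definable Language.ring A := by
  induction A, hA using Set.Finite.induction_on with
  | empty => exact Set.definable_empty
  | @insert a s _ _ ih =>
    rw [Set.insert_eq]
    refine Set.Definable.union ?_ ih
    classical
    have h := Ring.mvPolynomial_zeroLocus_definable
      (Finset.univ.image fun i : Fin n => (MvPolynomial.X i - MvPolynomial.C (a i) : MvPolynomial (Fin n) ℂ))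
    have h2 := h.mono (Set.subset_univ _)
    convert h2 using 1
    ext x
    rw [MvPolynomial.zeroLocus_span]
    simp [sub_eq_zero, funext_iff]

lemma exists_avoid {n : ℕ} {A : Set (Fin n → ℂ)} (hA : A.Finite) (y : Fin n → ℂ) (hy : y ∉ A) :
    ∃ g : MvPolynomial (Fin n) ℂ, MvPolynomial.eval y g ≠ 0 ∧ ∀ a ∈ A, MvPolynomial.eval a g = 0 := by
  have : ∀ a : Fin n → ℂ, ∃ g : MvPolynomial (Fin n) ℂ, MvPolynomial.eval a g = 0 ∧
      (a ≠ y → MvPolynomial.eval y g ≠ 0) := by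
    intro a
    by_cases h : a = y
    · exact ⟨0, by simp, fun h' => absurd h h'⟩
    · obtain ⟨j, hj⟩ := Function.ne_iff.1 h
      exact ⟨MvPolynomial.X j - MvPolynomial.C (a j), by simp,
        fun _ => by simpa [sub_eq_zero] using hj.symm⟩
  choose g hg hg2 using this
  refine ⟨∏ a ∈ hA.toFinset, g a, ?_, ?_⟩
  · rw [map_prod, Finset.prod_ne_zero_iff]
    intro a ha
    exact hg2 a (fun h => hy (h ▸ hA.mem_toFinset.1 ha))
  · intro a ha
    rw [map_prod]
    exact Finset.prod_eq_zero (hA.mem_toFinset.2 ha) (hg a)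

lemma chain_contra
    (n : ℕ) (Ω : Set (Fin n → ℂ)) (hΩcof : Ωᶜ.Finite)
    (F : (Fin n → ℂ) → (Fin n → ℂ))
    (q : Fin n → MvPolynomial (Fin n) ℂ)
    (hq : ∀ x i, F x i = MvPolynomial.eval x (q i))
    (hmaps : Set.MapsTo F Ω Ω)
    (hetale : ∀ x ∈ Ω,
      (Matrix.of fun i j => MvPolynomial.eval x (MvPolynomial.pderiv j (q i))).det ≠ 0)
    (b : ℕ → Fin n → ℂ) (hb : ∀ j, b j ∈ Ω) (hbs : ∀ j, F (b j) = b (j+1))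
    (huniq : ∀ j, ∀ x ∈ Ω, F x = b (j+1) → x = b j) (k : ℕ) : b 0 ∈ F^[k] '' Ω := by
  classical
  have hF : F = fun v i => MvPolynomial.eval v (q i) := by ext x i; exact hq x i
  let I : Ideal (MvPolynomial (Fin n) ℂ) := MvPolynomial.vanishingIdeal ℂ (Set.range b)
  have hI : ∀ p, p ∈ I ↔ ∀ j, MvPolynomial.eval (b j) p = 0 := by
    intro p
    simp [I, MvPolynomial.mem_vanishingIdeal_iff, MvPolynomial.aeval_eq_eval]
  let Z : Set (Fin n → ℂ) := MvPolynomial.zeroLocus ℂ I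
  have hZ : ∀ x, x ∈ Z ↔ ∀ p ∈ I, MvPolynomial.eval x p = 0 := by
    intro x
    simp [Z, MvPolynomial.mem_zeroLocus_iff, MvPolynomial.aeval_eq_eval]
  have hbZ : ∀ j, b j ∈ Z := fun j => (hZ _).2 fun p hp => (hI p).1 hp j
  let _ := FirstOrder.Ring.compatibleRingOfRing ℂ
  have hdef : (Set.univ : Set ℂ).Definable FirstOrder.Language.ring (Z ∩ Ω) := by
    refine Set.Definable.inter ?_ ?_
    · obtain ⟨T, hT⟩ := (inferInstance : IsNoetherianRing (MvPolynomial (Fin n) ℂ)).noetherian I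
      have h := FirstOrder.Ring.mvPolynomial_zeroLocus_definable T
      have h2 := h.mono (Set.subset_univ _)
      have h3 : Ideal.span (T : Set (MvPolynomial (Fin n) ℂ)) = I := hT
      rw [h3] at h2
      exact h2
    · have := (finite_definable hΩcof).compl
      rwa [compl_compl] at this
  have hmZ : Set.MapsTo F (Z ∩ Ω) (Z ∩ Ω) := by
    rintro x ⟨hxZ, hxΩ⟩
    refine ⟨(hZ _).2 fun p hp => ?_, hmaps hxΩ⟩
    have key : ∀ y, MvPolynomial.eval (F y) p = MvPolynomial.eval y (MvPolynomial.bind₁ q p) := by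
      intro y
      rw [hF]
      exact (MvPolynomial.eval₂Hom_bind₁ (RingHom.id ℂ) y q p).symm
    rw [key]
    refine (hZ x).1 hxZ _ ((hI _).2 fun j => ?_)
    rw [← key, hbs]
    exact (hI p).1 hp _
  have hinj : Set.InjOn F (Z ∩ Ω) := by
    rintro x ⟨hxZ, hxΩ⟩ y ⟨_, hyΩ⟩ hxy
    by_contra hne
    obtain ⟨g, hg, hgA⟩ := exists_avoid hΩcof y (fun h => h hyΩ)
    obtain ⟨P, hP, hP2⟩ := et_open q x y (fun i => by rw [← hq, ← hq, hxy]) g hg (hetale y hyΩ) hne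
    refine hP ((hZ x).1 hxZ P ((hI P).2 fun j => ?_))
    by_contra hj
    obtain ⟨z, hz, hzg, hze⟩ := hP2 _ hj
    refine hz (huniq j z ?_ ?_)
    · by_contra h
      exact hzg (hgA z h)
    · rw [← hbs]
      ext i
      rw [hq, hq, hze]
  have hsurj : Set.SurjOn F (Z ∩ Ω) (Z ∩ Ω) := by
    subst hF
    exact ax_grothendieck_of_definable (Z ∩ Ω) hdef q hmZ hinj
  have := hsurj.iterate k ⟨hbZ 0, hb 0⟩
  exact Set.image_mono Set.inter_subset_right this

/-- Stability of iterated images for an étale regular endomorphism `f` of a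
cofinite subset `Ω ⊆ ℂ^n` (`n > 1`) whose image is cofinite in `Ω`; the stable image is an
open, simply connected, cofinite subset of `Ω`. -/
theorem iterated_images_stabilize_etale
    (n : ℕ) (hn : 1 < n)
    (Ω : Set (Fin n → ℂ)) (hΩcof : Ωᶜ.Finite)
    (F : (Fin n → ℂ) → (Fin n → ℂ))
    (q : Fin n → MvPolynomial (Fin n) ℂ)
    (hq : ∀ x i, F x i = MvPolynomial.eval x (q i))
    (hmaps : Set.MapsTo F Ω Ω)
    (hetale : ∀ x ∈ Ω,
      (Matrix.of fun i j => MvPolynomial.eval x (MvPolynomial.pderiv j (q i))).det ≠ 0)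
    (himgcof : (Ω \ F '' Ω).Finite) :
    (∃ K > 0, ∀ k ≥ K, F^[k] '' Ω = F^[K] '' Ω) ∧
    (∃ U : Set (Fin n → ℂ), IsOpen U ∧ (⋂ k > 0, F^[k] '' Ω) = U ∩ Ω) ∧
    SimplyConnectedSpace ↥(⋂ k > 0, F^[k] '' Ω) ∧
    (Ω \ ⋂ k > 0, F^[k] '' Ω).Finite := by
  obtain ⟨k0, hk0⟩ := comb_main hmaps himgcof
    (chain_contra n Ω hΩcof F q hq hmaps hetale)
  have hst : ∀ k ≥ k0, F^[k] '' Ω = F^[k0] '' Ω := by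
    intro k hk
    induction k, hk using Nat.le_induction with
    | base => rfl
    | succ k _ ih => rw [iter_image_succ, ih, ← iter_image_succ, hk0]
  have hanti := iter_anti hmaps
  have hinter : (⋂ k > 0, F^[k] '' Ω) = F^[k0 + 1] '' Ω := by
    apply le_antisymm
    · exact Set.iInter₂_subset (k0 + 1) (Nat.succ_pos k0)
    · refine Set.subset_iInter₂ fun k _ => ?_
      rcases le_total k (k0 + 1) with h | h
      · exact hanti h
      · rw [hk0, hst k (by omega)]
  have hfin := iter_cofin himgcof (k0 + 1)
  have hsub : F^[k0 + 1] '' Ω ⊆ Ω := by simpa using hanti (Nat.zero_le (k0 + 1))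
  have hcfin : (F^[k0 + 1] '' Ω)ᶜ.Finite := by
    refine (hΩcof.union hfin).subset ?_
    intro x hx
    by_cases h : x ∈ Ω
    · exact Or.inr ⟨h, hx⟩
    · exact Or.inl h
  rw [hinter]
  refine ⟨⟨k0 + 1, Nat.succ_pos _, fun k hk => ?_⟩, ⟨_, ?_, (Set.inter_eq_left.2 hsub).symm⟩, ?_, hfin⟩
  · rw [hk0, hst k (by omega)]
  · simpa using hcfin.isClosed.isOpen_compl
  · have := sc_main (E := Fin n → ℂ) (by
      rw [Module.finrank_pi_fintype ℝ (M := fun _ : Fin n => ℂ)]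
      simp [Complex.finrank_real_complex]; omega) hcfin
    rwa [compl_compl] at this
end

section
/- Let n > 1, let Ω be a cofinite subset of ℂ^n, and let f : Ω → Ω be the restriction of a polynomial map F : ℂ^n → ℂ^n such that f maps Ω into Ω, f has finite fibers (for every y ∈ Ω the set {x ∈ Ω : f(x) = y} is finite), and f(Ω) is a cofinite subset of Ω. Then the iterated images f^k(Ω) stabilize: there exists K > 0 with f^k(Ω) = f^K(Ω) for all k ≥ K, and the stable image ⋂_{k>0} f^k(Ω) is an open, simply connected, cofinite subset of Ω. -/
open MvPolynomial in
lemma sep_finite {σ : Type*} (S : Set (σ → ℂ)) (hS : S.Finite) (p : σ → ℂ)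
    (hp : p ∉ S) : ∃ s : MvPolynomial σ ℂ, (∀ x ∈ S, eval x s = 0) ∧ eval p s ≠ 0 := by
  induction S, hS using Set.Finite.induction_on with
  | empty => exact ⟨1, by simp, by simp⟩
  | @insert a S ha hS ih =>
    rw [Set.mem_insert_iff, not_or] at hp
    obtain ⟨s, hs, hs'⟩ := ih hp.2
    obtain ⟨i, hi⟩ := Function.ne_iff.mp hp.1
    refine ⟨(X i - C (a i)) * s, ?_, ?_⟩
    · rintro x (rfl | hx)
      · simp
      · simp [hs x hx]
    · simp [hs', sub_ne_zero, hi]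

lemma hasGoingDown_of_zmp {A B : Type*} [CommRing A] [CommRing B] [IsDomain B]
    [IsIntegrallyClosed A] [Algebra A B] [FaithfulSMul A B]
    (h : ∀ Q : Ideal B, Q.IsPrime → Algebra.ZariskisMainProperty A Q) :
    Algebra.HasGoingDown A B := by
  constructor
  intro p _ Q hQ hlt
  obtain ⟨r, hrQ, hr, hx⟩ := Algebra.zariskisMainProperty_iff.mp (h Q hQ)
  let A' := integralClosure A B
  have hfs : FaithfulSMul A A' := by
    rw [faithfulSMul_iff_algebraMap_injective]
    intro a b hab
    exact FaithfulSMul.algebraMap_injective A B (congrArg Subtype.val hab)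
  have hgd : Algebra.HasGoingDown A A' := inferInstance
  have hlt' : p < (Q.under A').under A := by rwa [Ideal.under_under]
  obtain ⟨P', hP'Q, hP', hP'p⟩ := hgd.exists_ideal_le_liesOver_of_lt (Q.under A') hlt'
  let r' : A' := ⟨r, hr⟩
  have hr' : r' ∉ P' := fun hh => hrQ (hP'Q hh)
  have hrm : ∀ m : ℕ, r' ^ m ∉ P' := fun m hh => hr' (hP'.mem_of_pow_mem m hh)
  let P : Ideal B :=
    { carrier := {x | ∃ m : ℕ, ∃ z ∈ P', (z : B) = r ^ m * x}
      zero_mem' := ⟨0, 0, P'.zero_mem, by simp⟩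
      add_mem' := by
        rintro x y ⟨m, z, hz, e⟩ ⟨k, w, hw, e'⟩
        refine ⟨m + k, r' ^ k * z + r' ^ m * w,
          P'.add_mem (P'.mul_mem_left _ hz) (P'.mul_mem_left _ hw), ?_⟩
        push_cast
        rw [e, e']; ring
      smul_mem' := by
        rintro c x ⟨m, z, hz, e⟩
        obtain ⟨k, hk⟩ := hx c
        refine ⟨k + m, ⟨r ^ k * c, hk⟩ * z, P'.mul_mem_left _ hz, ?_⟩
        push_cast
        rw [e, smul_eq_mul]; ring }
  have hmem : ∀ x, x ∈ P ↔ ∃ m : ℕ, ∃ z ∈ P', (z : B) = r ^ m * x := fun x => Iff.rfl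
  have hPQ : P ≤ Q := by
    rintro x ⟨m, z, hz, e⟩
    have : (z : B) ∈ Q := hP'Q hz
    rw [e] at this
    exact (hQ.mem_or_mem this).resolve_left (fun hh => hrQ (hQ.mem_of_pow_mem m hh))
  refine ⟨P, hPQ, ⟨?_, ?_⟩, ⟨?_⟩⟩
  · intro htop
    exact hQ.ne_top (top_le_iff.mp (htop ▸ hPQ))
  · rintro x y ⟨m, z, hz, e⟩
    obtain ⟨a, ha⟩ := hx x
    obtain ⟨b, hb⟩ := hx y
    have h1 : r' ^ m * ((⟨r ^ a * x, ha⟩ : A') * ⟨r ^ b * y, hb⟩) = r' ^ (a + b) * z := by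
      apply Subtype.ext
      push_cast
      rw [e]; ring
    have h2 : r' ^ m * ((⟨r ^ a * x, ha⟩ : A') * ⟨r ^ b * y, hb⟩) ∈ P' := by
      rw [h1]; exact P'.mul_mem_left _ hz
    rcases hP'.mem_or_mem ((hP'.mem_or_mem h2).resolve_left (hrm m)) with h3 | h3
    · exact Or.inl ⟨a, _, h3, rfl⟩
    · exact Or.inr ⟨b, _, h3, rfl⟩
  · ext a
    rw [hP'p.over, Ideal.mem_comap, Ideal.mem_comap, hmem]
    constructor
    · intro ha
      exact ⟨0, _, ha, by simp⟩
    · rintro ⟨m, z, hz, e⟩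
      have : z = r' ^ m * algebraMap A A' a := Subtype.ext (by push_cast; rw [e])
      rw [this] at hz
      exact (hP'.mem_or_mem hz).resolve_left (hrm m)

open MvPolynomial in
lemma open_image {σ τ : Type*} [Finite σ] [Finite τ] (q : τ → MvPolynomial σ ℂ)
    (hfin : ∀ y : τ → ℂ, {x : σ → ℂ | (fun i => eval x (q i)) = y}.Finite)
    (hinj : Function.Injective (aeval q : MvPolynomial τ ℂ →ₐ[ℂ] MvPolynomial σ ℂ))
    (h : MvPolynomial σ ℂ) (x0 : σ → ℂ) (hx0 : eval x0 h ≠ 0) :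
    ∃ g : MvPolynomial τ ℂ, eval (fun i => eval x0 (q i)) g ≠ 0 ∧
      ∀ y, eval y g ≠ 0 → ∃ x, eval x h ≠ 0 ∧ (fun i => eval x (q i)) = y := by
  let φ : MvPolynomial τ ℂ →ₐ[ℂ] MvPolynomial σ ℂ := aeval q
  let : Algebra (MvPolynomial τ ℂ) (MvPolynomial σ ℂ) := φ.toRingHom.toAlgebra
  have halg : ∀ a, algebraMap (MvPolynomial τ ℂ) (MvPolynomial σ ℂ) a = aeval q a := fun a => rfl
  have hev : ∀ (x : σ → ℂ) (a : MvPolynomial τ ℂ),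
      eval x (aeval q a) = eval (fun i => eval x (q i)) a := by
    intro x a
    induction a using MvPolynomial.induction_on with
    | C a => simp
    | add a b ha hb => rw [map_add, map_add, map_add, ha, hb]
    | mul_X a i ha => rw [map_mul, map_mul, map_mul, ha, aeval_X, eval_X]
  have : IsScalarTower ℂ (MvPolynomial τ ℂ) (MvPolynomial σ ℂ) :=
    IsScalarTower.of_algebraMap_eq (fun c => by rw [halg]; simp)
  have hFT : Algebra.FiniteType (MvPolynomial τ ℂ) (MvPolynomial σ ℂ) :=
    Algebra.FiniteType.of_restrictScalars_finiteType ℂ _ _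
  have hFP : Algebra.FinitePresentation (MvPolynomial τ ℂ) (MvPolynomial σ ℂ) :=
    Algebra.FinitePresentation.of_finiteType.mp hFT
  have : FaithfulSMul (MvPolynomial τ ℂ) (MvPolynomial σ ℂ) := by
    rw [faithfulSMul_iff_algebraMap_injective]; exact hinj
  have hnull : ∀ (Q : Ideal (MvPolynomial σ ℂ)), Q.IsPrime → ∀ f,
      (∀ x ∈ zeroLocus ℂ Q, eval x f = 0) → f ∈ Q := by
    intro Q hQ f hf
    rw [← IsPrime.vanishingIdeal_zeroLocus (K := ℂ) Q]
    intro x hx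
    simpa [aeval_eq_eval] using hf x hx
  -- points of the zero locus of a prime over a point
  have hover : ∀ (Q : Ideal (MvPolynomial σ ℂ)) (y : τ → ℂ),
      (∀ i, aeval q (X i - C (y i) : MvPolynomial τ ℂ) ∈ Q) →
      ∀ x ∈ zeroLocus ℂ Q, (fun i => eval x (q i)) = y := by
    intro Q y hQ x hx
    funext i
    have := hx _ (hQ i)
    have h2 : eval x (q i) - y i = 0 := by simpa [aeval_eq_eval] using this
    exact sub_eq_zero.mp h2
  have hqf : ∀ M : Ideal (MvPolynomial σ ℂ), ∀ hM : M.IsMaximal,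
      haveI := hM.isPrime; Algebra.QuasiFiniteAt (MvPolynomial τ ℂ) M := by
    intro M hM
    obtain ⟨x, hx⟩ := isMaximal_iff_eq_vanishingIdeal_singleton.mp hM
    have := hM.isPrime
    apply Algebra.QuasiFiniteAt.of_isOpen_singleton_fiber (R := MvPolynomial τ ℂ)
      (⟨M, inferInstance⟩ : PrimeSpectrum (MvPolynomial σ ℂ))
    have hMmem : ∀ f, f ∈ M ↔ eval x f = 0 := by
      intro f
      rw [hx, mem_vanishingIdeal_singleton_iff, aeval_eq_eval]
    let y : τ → ℂ := fun i => eval x (q i)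
    obtain ⟨s, hs, hs'⟩ := sep_finite ({x' | (fun i => eval x' (q i)) = y} \ {x})
      ((hfin y).subset Set.sdiff_subset) x (by simp)
    refine ⟨PrimeSpectrum.basicOpen s, (PrimeSpectrum.basicOpen s).isOpen, ?_⟩
    ext ⟨⟨Q, hQp⟩, hQ⟩
    simp only [Set.mem_preimage, SetLike.mem_coe, PrimeSpectrum.mem_basicOpen,
      Set.mem_singleton_iff]
    rw [Subtype.ext_iff, PrimeSpectrum.ext_iff]
    change s ∉ Q ↔ Q = M
    constructor
    · intro hsQ
      have hQ1 : Q.comap (algebraMap (MvPolynomial τ ℂ) (MvPolynomial σ ℂ)) =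
          M.comap (algebraMap (MvPolynomial τ ℂ) (MvPolynomial σ ℂ)) :=
        congrArg PrimeSpectrum.asIdeal hQ
      have hQ2 : ∀ i, aeval q (X i - C (y i) : MvPolynomial τ ℂ) ∈ Q := by
        intro i
        have : (X i - C (y i) : MvPolynomial τ ℂ) ∈
            M.comap (algebraMap (MvPolynomial τ ℂ) (MvPolynomial σ ℂ)) := by
          rw [Ideal.mem_comap, hMmem, halg, hev]
          simp [y]
        rw [← hQ1] at this
        exact this
      have hQ3 := hover Q y hQ2
      symm
      apply hM.eq_of_le hQp.ne_top
      intro g hg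
      rw [hMmem] at hg
      have : g * s ∈ Q := by
        apply hnull Q hQp
        intro z hz
        rw [map_mul]
        by_cases hzx : z = x
        · rw [hzx, hg, zero_mul]
        · rw [hs z ⟨hQ3 z hz, hzx⟩, mul_zero]
      exact (hQp.mem_or_mem this).resolve_right hsQ
    · rintro rfl
      rw [hMmem]; exact hs'
  have hgd : Algebra.HasGoingDown (MvPolynomial τ ℂ) (MvPolynomial σ ℂ) := by
    apply hasGoingDown_of_zmp
    intro Q hQ
    obtain ⟨M, hM, hQM⟩ := Ideal.exists_le_maximal Q hQ.ne_top
    have := hM.isPrime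
    have := hqf M hM
    have : Algebra.QuasiFiniteAt (MvPolynomial τ ℂ) Q := Algebra.QuasiFiniteAt.of_le hQM
    exact Algebra.ZariskisMainProperty.of_finiteType Q
  have hopen := PrimeSpectrum.isOpenMap_comap_of_hasGoingDown_of_finitePresentation
    (R := MvPolynomial τ ℂ) (S := MvPolynomial σ ℂ)
  have hO := hopen _ (PrimeSpectrum.basicOpen h).isOpen
  have hmemO : PrimeSpectrum.comap (algebraMap (MvPolynomial τ ℂ) (MvPolynomial σ ℂ))
      (pointToPoint x0) ∈ PrimeSpectrum.comap (algebraMap (MvPolynomial τ ℂ) (MvPolynomial σ ℂ)) ''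
        (PrimeSpectrum.basicOpen h : Set (PrimeSpectrum (MvPolynomial σ ℂ))) := by
    refine ⟨_, ?_, rfl⟩
    change h ∉ vanishingIdeal ℂ {x0}
    rw [mem_vanishingIdeal_singleton_iff]
    exact hx0
  obtain ⟨_, ⟨g, rfl⟩, hg1, hg2⟩ :=
    PrimeSpectrum.isTopologicalBasis_basic_opens.exists_subset_of_mem_open hmemO hO
  refine ⟨g, ?_, ?_⟩
  · intro h0
    apply hg1
    change aeval q g ∈ vanishingIdeal ℂ {x0}
    rw [mem_vanishingIdeal_singleton_iff]
    change eval x0 (aeval q g) = 0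
    rw [hev, h0]
  · intro y hy
    have hyg : (pointToPoint y : PrimeSpectrum (MvPolynomial τ ℂ)) ∈
        (PrimeSpectrum.basicOpen g : Set (PrimeSpectrum (MvPolynomial τ ℂ))) := by
      change g ∉ vanishingIdeal ℂ {y}
      rw [mem_vanishingIdeal_singleton_iff]
      exact hy
    obtain ⟨⟨Q, hQp⟩, hQh, hQ⟩ := hg2 hyg
    have hQ1 : Q.comap (algebraMap (MvPolynomial τ ℂ) (MvPolynomial σ ℂ)) =
        vanishingIdeal ℂ {y} := congrArg PrimeSpectrum.asIdeal hQ
    have hQ2 : ∀ i, aeval q (X i - C (y i) : MvPolynomial τ ℂ) ∈ Q := by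
      intro i
      have : (X i - C (y i) : MvPolynomial τ ℂ) ∈ vanishingIdeal ℂ {y} := by
        rw [mem_vanishingIdeal_singleton_iff]
        simp
      rw [← hQ1] at this
      exact this
    by_contra hcon
    apply hQh
    apply hnull Q hQp
    intro x hx
    by_contra hxh
    exact hcon ⟨x, hxh, hover Q y hQ2 x hx⟩


open MvPolynomial in
lemma aeval_injective_of_dense {σ τ : Type*} (q : τ → MvPolynomial σ ℂ)
    (hd : ∀ g : MvPolynomial τ ℂ, (∀ x : σ → ℂ, eval (fun i => eval x (q i)) g = 0) →
      ∀ y, eval y g = 0) :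
    Function.Injective (aeval q : MvPolynomial τ ℂ →ₐ[ℂ] MvPolynomial σ ℂ) := by
  rw [injective_iff_map_eq_zero]
  intro g hg
  apply MvPolynomial.funext
  intro y
  rw [map_zero]
  apply hd
  intro x
  have hev : ∀ (a : MvPolynomial τ ℂ),
      eval x (aeval q a) = eval (fun i => eval x (q i)) a := by
    intro a
    induction a using MvPolynomial.induction_on with
    | C a => simp
    | add a b ha hb => rw [map_add, map_add, map_add, ha, hb]
    | mul_X a i ha => rw [map_mul, map_mul, map_mul, ha, aeval_X, eval_X]
  rw [← hev, hg, map_zero]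

open MvPolynomial in
lemma two_pre_open {σ : Type*} [Finite σ] (q : σ → MvPolynomial σ ℂ)
    (hfin : ∀ y : σ → ℂ, {x : σ → ℂ | (fun i => eval x (q i)) = y}.Finite)
    (hdense : DenseRange (fun (x : σ → ℂ) i => eval x (q i)))
    (Ω : Set (σ → ℂ)) (hΩ : Ωᶜ.Finite) (a b : σ → ℂ) (ha : a ∈ Ω) (hb : b ∈ Ω) (hab : a ≠ b)
    (hF : (fun i => eval a (q i)) = (fun i => eval b (q i))) :
    ∃ g : MvPolynomial σ ℂ, eval (fun i => eval b (q i)) g ≠ 0 ∧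
      ∀ y, eval y g ≠ 0 → ∃ a' ∈ Ω, ∃ b' ∈ Ω, a' ≠ b' ∧
        (fun i => eval a' (q i)) = y ∧ (fun i => eval b' (q i)) = y := by
  have hzero : ∀ f : (σ → ℂ) → ℂ, Continuous f → (∀ x : σ → ℂ, f (fun i => eval x (q i)) = 0) →
      ∀ y, f y = 0 := by
    intro f hf h0 y
    have := hdense.equalizer hf continuous_const (funext h0)
    exact congrFun this y
  let q' : σ ⊕ σ → MvPolynomial (σ ⊕ σ) ℂ :=
    Sum.elim (fun i => rename Sum.inl (q i)) (fun i => X (Sum.inr i))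
  have hq' : ∀ z : σ ⊕ σ → ℂ, (fun i => eval z (q' i)) =
      Sum.elim (fun i => eval (z ∘ Sum.inl) (q i)) (z ∘ Sum.inr) := by
    intro z
    funext i
    rcases i with i | i
    · simp [q', eval_rename]
    · simp [q']
  have hinj' : Function.Injective (aeval q' : MvPolynomial (σ ⊕ σ) ℂ →ₐ[ℂ] _) := by
    apply aeval_injective_of_dense
    intro g hg y
    have := hzero (fun u => eval (Sum.elim u (y ∘ Sum.inr)) g) ?_ ?_ (y ∘ Sum.inl)
    · simpa [Sum.elim_comp_inl_inr] using this
    · apply (MvPolynomial.continuous_eval g).comp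
      apply continuous_pi
      rintro (i | i)
      · exact continuous_apply i
      · exact continuous_const
    · intro x
      have := hg (Sum.elim x (y ∘ Sum.inr))
      rw [hq'] at this
      simpa using this
  have hfin' : ∀ y : σ ⊕ σ → ℂ, {x : σ ⊕ σ → ℂ | (fun i => eval x (q' i)) = y}.Finite := by
    intro y
    refine ((hfin (y ∘ Sum.inl)).image (fun x => Sum.elim x (y ∘ Sum.inr))).subset ?_
    intro z hz
    have hz' : Sum.elim (fun i => eval (z ∘ Sum.inl) (q i)) (z ∘ Sum.inr) = y := by
      rw [← hq']; exact hz
    refine ⟨z ∘ Sum.inl, ?_, ?_⟩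
    · rw [← hz']; rfl
    · rw [← hz']
      simp [Sum.elim_comp_inl_inr]
  obtain ⟨sa, hsa, hsa'⟩ := sep_finite _ hΩ a (by simpa using ha)
  obtain ⟨sb, hsb, hsb'⟩ := sep_finite _ hΩ b (by simpa using hb)
  obtain ⟨i, hi⟩ := Function.ne_iff.mp hab
  let h : MvPolynomial (σ ⊕ σ) ℂ :=
    (X (Sum.inl i) - X (Sum.inr i)) * (rename Sum.inl sa * rename Sum.inr sb)
  have hh : ∀ z : σ ⊕ σ → ℂ, eval z h = (z (Sum.inl i) - z (Sum.inr i)) *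
      (eval (z ∘ Sum.inl) sa * eval (z ∘ Sum.inr) sb) := by
    intro z; simp [h, eval_rename]
  obtain ⟨g, hg1, hg2⟩ := open_image q' hfin' hinj' h (Sum.elim a b) (by
    rw [hh]
    simp [sub_ne_zero, hi, hsa', hsb'])
  rw [hq'] at hg1
  simp only [Sum.elim_comp_inl, Sum.elim_comp_inr, hF] at hg1
  let g2 : MvPolynomial σ ℂ := aeval (Sum.elim q X : σ ⊕ σ → MvPolynomial σ ℂ) g
  have hg2e : ∀ x : σ → ℂ, eval x g2 = eval (Sum.elim (fun i => eval x (q i)) x) g := by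
    intro x
    have hev : ∀ (a : MvPolynomial (σ ⊕ σ) ℂ),
      eval x (aeval (Sum.elim q X : σ ⊕ σ → MvPolynomial σ ℂ) a) =
        eval (Sum.elim (fun i => eval x (q i)) x) a := by
      intro a
      induction a using MvPolynomial.induction_on with
      | C a => simp
      | add a b ha hb => rw [map_add, map_add, map_add, ha, hb]
      | mul_X a i ha =>
        rw [map_mul, map_mul, map_mul, ha, aeval_X, eval_X]
        rcases i with i | i <;> simp
    exact hev g
  have hinj : Function.Injective (aeval q : MvPolynomial σ ℂ →ₐ[ℂ] _) := by
    apply aeval_injective_of_dense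
    intro g hg y
    exact hzero (fun u => eval u g) (MvPolynomial.continuous_eval g) hg y
  obtain ⟨g3, hg31, hg32⟩ := open_image q hfin hinj g2 b (by rw [hg2e]; exact hg1)
  refine ⟨g3, hg31, ?_⟩
  intro y hy
  obtain ⟨b', hb', hb'y⟩ := hg32 y hy
  rw [hg2e] at hb'
  obtain ⟨z, hz, hzy⟩ := hg2 _ hb'
  rw [hq'] at hzy
  have hz1 : (fun i => eval (z ∘ Sum.inl) (q i)) = (fun i => eval b' (q i)) := by
    have := congrArg (fun w => w ∘ Sum.inl) hzy
    simpa using this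
  have hz2 : z ∘ Sum.inr = b' := by
    have := congrArg (fun w => w ∘ Sum.inr) hzy
    simpa using this
  rw [hh] at hz
  simp only [mul_ne_zero_iff, hz2] at hz
  obtain ⟨hz3, hz4, hz5⟩ := hz
  refine ⟨z ∘ Sum.inl, ?_, b', ?_, ?_, ?_, hb'y⟩
  · by_contra hcon
    exact hz4 (hsa _ hcon)
  · by_contra hcon
    exact hz5 (hsb _ hcon)
  · intro heq
    apply hz3
    have h1 : z (Sum.inl i) = b' i := congrFun heq i
    have h2 : z (Sum.inr i) = b' i := congrFun hz2 i
    rw [h1, h2, sub_self]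
  · rw [hz1, hb'y]

open MvPolynomial FirstOrder FirstOrder.Ring in
lemma ax_step {σ : Type*} [Finite σ] (q : σ → MvPolynomial σ ℂ)
    (Ω : Set (σ → ℂ)) (hΩ : Ωᶜ.Finite) (I : Ideal (MvPolynomial σ ℂ))
    (hm : (Ω ∩ zeroLocus ℂ I).MapsTo (fun v i => eval v (q i)) (Ω ∩ zeroLocus ℂ I))
    (hi : (Ω ∩ zeroLocus ℂ I).InjOn (fun v i => eval v (q i))) :
    (Ω ∩ zeroLocus ℂ I).SurjOn (fun v i => eval v (q i)) (Ω ∩ zeroLocus ℂ I) := by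
  let := compatibleRingOfRing ℂ
  have hdef : ∀ J : Ideal (MvPolynomial σ ℂ),
      (Set.univ : Set ℂ).Definable Language.ring (zeroLocus ℂ J) := by
    intro J
    obtain ⟨s, rfl⟩ : J.FG := IsNoetherian.noetherian J
    exact (mvPolynomial_zeroLocus_definable s).mono (Set.subset_univ _)
  have hΩeq : Ω = (zeroLocus ℂ (vanishingIdeal ℂ Ωᶜ))ᶜ := by
    ext x
    constructor
    · intro hx hz
      obtain ⟨s, hs, hs'⟩ := sep_finite _ hΩ x (by simpa using hx)
      exact hs' (hz s (fun y hy => hs y hy))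
    · intro hx
      by_contra hcon
      exact hx (zeroLocus_vanishingIdeal_le _ hcon)
  refine ax_grothendieck_of_definable (c := Set.univ) _ ?_ q hm hi
  refine Set.Definable.inter ?_ (hdef I)
  rw [hΩeq]
  exact (hdef _).compl


lemma exists_smooth_approx {n : ℕ} (U : Set (Fin n → ℂ)) (hU : IsOpen U) {x y : Fin n → ℂ}
    (γ : Path x y) (hγ : ∀ t, γ t ∈ U) :
    ∃ c : ℝ → (Fin n → ℂ), ContDiff ℝ 1 c ∧ c 0 = x ∧ c 1 = y ∧
      ∀ t : unitInterval, ∀ s : unitInterval,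
        (1 - (s : ℝ)) • γ t + (s : ℝ) • c t ∈ U := by
  obtain ⟨δ, hδ, hδU⟩ := (isCompact_range γ.continuous).exists_thickening_subset_open hU
    (by rintro _ ⟨t, rfl⟩; exact hγ t)
  have htend := bernsteinApproximation_uniform (γ : C(unitInterval, Fin n → ℂ))
  rw [Metric.tendsto_atTop] at htend
  obtain ⟨N, hN⟩ := htend δ hδ
  have hN1 := hN (N + 1) (by omega)
  let B := bernsteinApproximation (N + 1) (γ : C(unitInterval, Fin n → ℂ))
  let c : ℝ → (Fin n → ℂ) := fun t => ∑ k : Fin (N + 1 + 1),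
    (((N + 1).choose k : ℝ) * t ^ (k : ℕ) * (1 - t) ^ (N + 1 - (k : ℕ))) •
      γ (bernstein.z k)
  have hc : ∀ t : unitInterval, c t = B t := by
    intro t
    simp only [c, B, bernsteinApproximation.apply, bernstein_apply]
    rfl
  refine ⟨c, ?_, ?_, ?_, ?_⟩
  · fun_prop
  · have := hc 0
    rw [bernsteinApproximation.apply_zero] at this
    simpa using this
  · have := hc 1
    rw [bernsteinApproximation.apply_one (by omega)] at this
    simpa using this
  · intro t s
    apply hδU
    rw [Metric.mem_thickening_iff]
    refine ⟨γ t, ⟨t, rfl⟩, ?_⟩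
    have h1 : dist (c t) (γ t) < δ := by
      rw [hc]
      exact lt_of_le_of_lt (ContinuousMap.dist_apply_le_dist t) hN1
    rw [dist_eq_norm] at h1 ⊢
    have h2 : (1 - (s : ℝ)) • γ t + (s : ℝ) • c t - γ t = (s : ℝ) • (c t - γ t) := by
      module
    rw [h2, norm_smul]
    have h3 : ‖(s : ℝ)‖ ≤ 1 := by
      rw [Real.norm_of_nonneg s.2.1]; exact s.2.2
    calc ‖(s : ℝ)‖ * ‖c t - γ t‖ ≤ 1 * ‖c t - γ t‖ := by gcongr
      _ < δ := by rw [one_mul]; exact h1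

lemma exists_generic_point {n : ℕ} (hn : 1 < n) (P : Set (Fin n → ℂ)) (hP : P.Finite)
    (c₁ c₂ : ℝ → (Fin n → ℂ)) (h₁ : ContDiff ℝ 1 c₁) (h₂ : ContDiff ℝ 1 c₂) :
    ∃ v : Fin n → ℂ, ∀ p ∈ P, ∀ t s : ℝ, 0 < s →
      (1 - s) • c₁ t + s • v ≠ p ∧ (1 - s) • c₂ t + s • v ≠ p := by
  have key : ∀ c : ℝ → (Fin n → ℂ), ContDiff ℝ 1 c → ∀ p : Fin n → ℂ,
      dimH (Set.range (fun w : ℝ × ℝ => w.2 • (p - c w.1) + c w.1)) ≤ 2 := by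
    intro c hc p
    have hcd : ContDiff ℝ 1 (fun w : ℝ × ℝ => w.2 • (p - c w.1) + c w.1) := by fun_prop
    have := hcd.dimH_range_le
    simpa using this
  let Bad : Set (Fin n → ℂ) := ⋃ p ∈ P,
    (Set.range (fun w : ℝ × ℝ => w.2 • (p - c₁ w.1) + c₁ w.1) ∪
      Set.range (fun w : ℝ × ℝ => w.2 • (p - c₂ w.1) + c₂ w.1))
  have hBad : dimH Bad ≤ 2 := by
    simp only [Bad]
    rw [dimH_bUnion hP.countable]
    refine iSup₂_le fun p _ => ?_
    rw [dimH_union]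
    exact max_le (key c₁ h₁ p) (key c₂ h₂ p)
  have hd : Dense Badᶜ := by
    apply dense_compl_of_dimH_lt_finrank
    refine lt_of_le_of_lt hBad ?_
    have : Module.finrank ℝ (Fin n → ℂ) = n * 2 := by
      rw [Module.finrank_pi_fintype]
      simp [Complex.finrank_real_complex]
    rw [this]
    exact_mod_cast (by omega : 2 < n * 2)
  obtain ⟨v, hv⟩ := hd.nonempty
  refine ⟨v, ?_⟩
  have aux : ∀ (c : ℝ → (Fin n → ℂ)) (p : Fin n → ℂ) (t s : ℝ), 0 < s →
      (1 - s) • c t + s • v = p → v ∈ Set.range (fun w : ℝ × ℝ => w.2 • (p - c w.1) + c w.1) := by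
    intro c p t s hs h
    refine ⟨(t, s⁻¹), ?_⟩
    simp only
    rw [← h]
    have : (1 - s) • c t + s • v - c t = s • (v - c t) := by module
    rw [this, smul_smul, inv_mul_cancel₀ hs.ne', one_smul]
    abel
  intro p hp t s hs
  constructor
  · intro h
    exact hv (Set.mem_biUnion hp (Or.inl (aux c₁ p t s hs h)))
  · intro h
    exact hv (Set.mem_biUnion hp (Or.inr (aux c₂ p t s hs h)))

lemma simplyConnected_of_cofinite {n : ℕ} (hn : 1 < n) (U : Set (Fin n → ℂ))
    (hU : Uᶜ.Finite) : SimplyConnectedSpace U := by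
  have hUo : IsOpen U := by
    have := hU.isClosed.isOpen_compl
    rwa [compl_compl] at this
  rw [simply_connected_iff_paths_homotopic']
  constructor
  · rw [← isPathConnected_iff_pathConnectedSpace]
    have hr : 1 < Module.rank ℝ (Fin n → ℂ) := by
      rw [← Module.finrank_eq_rank, Module.finrank_pi_fintype]
      simp only [Complex.finrank_real_complex, Finset.sum_const, Finset.card_univ,
        Fintype.card_fin, smul_eq_mul]
      exact_mod_cast (by omega : 1 < n * 2)
    have := hU.countable.isPathConnected_compl_of_one_lt_rank hr
    rwa [compl_compl] at this
  · intro x y p₁ p₂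
    -- smooth approximations
    have approx : ∀ p : Path x y, ∃ c : ℝ → (Fin n → ℂ), ContDiff ℝ 1 c ∧
        ∃ p' : Path x y, (∀ t : unitInterval, (p' t : Fin n → ℂ) = c t) ∧ p.Homotopic p' := by
      intro p
      obtain ⟨c, hc, hc0, hc1, hcU⟩ := exists_smooth_approx U hUo
        (p.map continuous_subtype_val) (fun t => (p t).2)
      have hcU1 : ∀ t : unitInterval, c t ∈ U := fun t => by simpa using hcU t 1
      refine ⟨c, hc, ⟨⟨fun t => ⟨c t, hcU1 t⟩, ?_⟩, ?_, ?_⟩, fun t => rfl, ⟨?_⟩⟩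
      · exact (hc.continuous.comp continuous_subtype_val).subtype_mk _
      · exact Subtype.ext (by simpa using hc0)
      · exact Subtype.ext (by simpa using hc1)
      · refine
          { toFun := fun w => ⟨(1 - (w.1 : ℝ)) • (p w.2 : Fin n → ℂ) + (w.1 : ℝ) • c w.2,
              hcU w.2 w.1⟩
            continuous_toFun := ?_
            map_zero_left := ?_
            map_one_left := ?_
            prop' := ?_ }
        · refine Continuous.subtype_mk ?_ _
          have := hc.continuous
          fun_prop
        · intro t
          apply Subtype.ext; simp
        · intro t
          apply Subtype.ext; simp
        · intro s t ht
          apply Subtype.ext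
          rcases ht with rfl | ht
          · simp only [ContinuousMap.coe_mk]
            simp [hc0]
            module
          · rw [Set.mem_singleton_iff] at ht
            subst ht
            simp only [ContinuousMap.coe_mk]
            simp [hc1]
            module
    obtain ⟨c₁, hc₁, p₁', hp₁', hh₁⟩ := approx p₁
    obtain ⟨c₂, hc₂, p₂', hp₂', hh₂⟩ := approx p₂
    obtain ⟨v, hv⟩ := exists_generic_point hn _ hU c₁ c₂ hc₁ hc₂
    let D : Set (Fin n → ℂ) := {z | segment ℝ v z ⊆ U}
    have hDU : D ⊆ U := fun z hz => hz (right_mem_segment ℝ v z)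
    have hDstar : StarConvex ℝ v D := by
      rw [starConvex_iff_segment_subset]
      intro z hz w hw
      have hz' : segment ℝ v z ⊆ U := hz
      show segment ℝ v w ⊆ U
      exact Set.Subset.trans
        ((convex_segment v z).segment_subset (left_mem_segment ℝ v z) hw) hz'
    have hmem : ∀ (c : ℝ → (Fin n → ℂ)) (p : Path x y),
        (∀ t : unitInterval, (p t : Fin n → ℂ) = c t) →
        (∀ b ∈ Uᶜ, ∀ t s : ℝ, 0 < s → (1 - s) • c t + s • v ≠ b) →
        ∀ t, (p t : Fin n → ℂ) ∈ D := by
      intro c p hpc hb t w hw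
      rw [segment_symm, segment_eq_image] at hw
      obtain ⟨s, hs, rfl⟩ := hw
      rcases hs.1.eq_or_lt with h0 | h0
      · rw [← h0]
        simp
      · by_contra hcon
        have := hb _ hcon t s h0
        rw [hpc] at this
        exact this rfl
    have hm₁ := hmem c₁ p₁' hp₁' (fun b hb t s hs => (hv b hb t s hs).1)
    have hm₂ := hmem c₂ p₂' hp₂' (fun b hb t s hs => (hv b hb t s hs).2)
    have hxD : (x : Fin n → ℂ) ∈ D := by simpa using hm₁ 0
    have hyD : (y : Fin n → ℂ) ∈ D := by simpa using hm₁ 1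
    have hcontr : ContractibleSpace D := hDstar.contractibleSpace ⟨_, hxD⟩
    let lift : ∀ p : Path x y, (∀ t, (p t : Fin n → ℂ) ∈ D) →
        Path (⟨x, hxD⟩ : D) ⟨y, hyD⟩ := fun p hp =>
      { toFun := fun t => ⟨p t, hp t⟩
        continuous_toFun := by
          refine Continuous.subtype_mk ?_ _
          fun_prop
        source' := Subtype.ext (by simp)
        target' := Subtype.ext (by simp) }
    have hhD : (lift p₁' hm₁).Homotopic (lift p₂' hm₂) :=
      SimplyConnectedSpace.paths_homotopic _ _
    have hh : p₁'.Homotopic p₂' := by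
      obtain ⟨H⟩ := hhD
      refine ⟨{ toFun := fun w => ⟨(H w).1, hDU (H w).2⟩
                continuous_toFun := ?_
                map_zero_left := ?_
                map_one_left := ?_
                prop' := ?_ }⟩
      · exact Continuous.subtype_mk (continuous_subtype_val.comp H.continuous) _
      · intro t
        apply Subtype.ext
        have h := H.map_zero_left t
        exact congrArg (fun u : D => (u : Fin n → ℂ)) h
      · intro t
        apply Subtype.ext
        have h := H.map_one_left t
        exact congrArg (fun u : D => (u : Fin n → ℂ)) h
      · intro s t ht
        apply Subtype.ext
        have h := H.prop' s t ht
        exact congrArg (fun u : D => (u : Fin n → ℂ)) h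
    exact (hh₁.trans hh).trans hh₂.symm


/-- `y` has at most one preimage in `Ω`. -/
def OnePre {α : Type*} (Ω : Set α) (F : α → α) (y : α) : Prop :=
  ∀ a ∈ Ω, ∀ b ∈ Ω, F a = y → F b = y → a = b

lemma stab_claim {α : Type*} (Ω : Set α) (F : α → α) (hmaps : Set.MapsTo F Ω Ω)
    (hE : (Ω \ F '' Ω).Finite)
    (hX : Set.SurjOn F {y | y ∈ Ω ∧ ∀ j ≥ 1, OnePre Ω F (F^[j] y)}
      {y | y ∈ Ω ∧ ∀ j ≥ 1, OnePre Ω F (F^[j] y)})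
    (e : α) (he : e ∈ Ω \ F '' Ω) : ∃ m, F^[m] e ∈ F^[m+1] '' Ω := by
  by_contra hcon
  push Not at hcon
  have hit : ∀ k, F^[k] e ∈ Ω := fun k => (hmaps.iterate k) he.1
  have hlt : ∀ i j, i < j → F^[i] e ≠ F^[j] e := by
    intro i j hij h
    apply hcon i
    refine ⟨F^[j - (i+1)] e, hit _, ?_⟩
    rw [← Function.iterate_add_apply, h]
    congr 2
    omega
  have hinj : ∀ i j, F^[i] e = F^[j] e → i = j := by
    intro i j h
    rcases lt_trichotomy i j with h1 | h1 | h1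
    · exact absurd h (hlt _ _ h1)
    · exact h1
    · exact absurd h.symm (hlt _ _ h1)
  have hbad : {k | 1 ≤ k ∧ ¬ OnePre Ω F (F^[k] e)}.Finite := by
    have hch : ∀ k, 1 ≤ k → ¬ OnePre Ω F (F^[k] e) →
        ∃ d i, d ∈ Ω \ F '' Ω ∧ F^[i+1] d = F^[k] e ∧ F^[i] d ≠ F^[k-1] e := by
      intro k hk hb
      obtain ⟨z, hz, hzF, hzne⟩ : ∃ z ∈ Ω, F z = F^[k] e ∧ z ≠ F^[k-1] e := by
        by_contra hno
        push Not at hno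
        apply hb
        intro a ha b hb' h1 h2
        rw [hno a ha h1, hno b hb' h2]
      have hznot : ¬ z ∈ F^[k] '' Ω := by
        rintro ⟨x, hx, rfl⟩
        apply hcon k
        exact ⟨x, hx, by rw [Function.iterate_succ_apply', hzF]⟩
      classical
      have hex : ∃ i, ¬ z ∈ F^[i] '' Ω := ⟨k, hznot⟩
      have h0 : Nat.find hex ≠ 0 := by
        intro h0
        have := Nat.find_spec hex
        rw [h0] at this
        exact this ⟨z, hz, rfl⟩
      obtain ⟨i, hi⟩ := Nat.exists_eq_succ_of_ne_zero h0
      have h1 := Nat.find_spec hex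
      rw [hi] at h1
      have h2 : z ∈ F^[i] '' Ω := by
        by_contra h
        have := Nat.find_min' hex h
        omega
      obtain ⟨d, hd, rfl⟩ := h2
      refine ⟨d, i, ⟨hd, ?_⟩, ?_, hzne⟩
      · rintro ⟨x, hx, rfl⟩
        exact h1 ⟨x, hx, by rw [Nat.succ_eq_add_one, Function.iterate_succ_apply]⟩
      · rw [Function.iterate_succ_apply', hzF]
    haveI : Nonempty α := ⟨e⟩
    choose! d i hd h1 h2 using hch
    refine Set.Finite.of_finite_image (f := d) (hE.subset ?_) ?_
    · rintro _ ⟨k, hk, rfl⟩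
      exact hd k hk.1 hk.2
    · have key : ∀ k l, 1 ≤ k → ¬ OnePre Ω F (F^[k] e) → 1 ≤ l → ¬ OnePre Ω F (F^[l] e) →
          d k = d l → k < l → False := by
        intro k l hk hkb hl hlb hdl hkl
        have a1 := h1 k hk hkb
        have b1 := h1 l hl hlb
        have b2 := h2 l hl hlb
        rw [← hdl] at b1 b2
        rcases Nat.lt_or_ge (i k) (i l) with h | h
        · obtain ⟨m, hm⟩ := Nat.exists_eq_add_of_lt h
          have e1 : F^[i l] (d k) = F^[m + k] e := by
            rw [Function.iterate_add_apply, ← a1, ← Function.iterate_add_apply]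
            congr 2
            omega
          have e2 : F^[m + k + 1] e = F^[l] e := by
            rw [← b1, Function.iterate_succ_apply', Function.iterate_succ_apply', e1]
          have e3 := hinj _ _ e2
          apply b2
          rw [e1]
          congr 2
          omega
        · obtain ⟨m, hm⟩ := Nat.exists_eq_add_of_le h
          have e1 : F^[k] e = F^[m + l] e := by
            rw [Function.iterate_add_apply, ← b1, ← a1, ← Function.iterate_add_apply]
            exact congrArg (fun r => F^[r] (d k)) (by omega)
          have := hinj _ _ e1
          omega
      intro k hk l hl hdl
      rcases lt_trichotomy k l with h | h | h
      · exact (key k l hk.1 hk.2 hl.1 hl.2 hdl h).elim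
      · exact h
      · exact (key l k hl.1 hl.2 hk.1 hk.2 hdl.symm h).elim
  obtain ⟨K, hK, hK0⟩ : ∃ K, (∀ k > K, OnePre Ω F (F^[k] e)) ∧
      (K = 0 ∨ ¬ OnePre Ω F (F^[K] e)) := by
    rcases Set.eq_empty_or_nonempty {k | 1 ≤ k ∧ ¬ OnePre Ω F (F^[k] e)} with h | h
    · refine ⟨0, ?_, Or.inl rfl⟩
      intro k hk
      by_contra hc
      have : k ∈ {k | 1 ≤ k ∧ ¬ OnePre Ω F (F^[k] e)} := ⟨hk, hc⟩
      rw [h] at this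
      exact this
    · obtain ⟨K, hKm, hKmax⟩ := hbad.exists_maximal h
      refine ⟨K, ?_, Or.inr hKm.2⟩
      intro k hk
      by_contra hc
      have := hKmax (show k ∈ {k | 1 ≤ k ∧ ¬ OnePre Ω F (F^[k] e)} from
        ⟨by omega, hc⟩) hk.le
      omega
  have hmem : F^[K] e ∈ {y | y ∈ Ω ∧ ∀ j ≥ 1, OnePre Ω F (F^[j] y)} := by
    refine ⟨hit K, fun j hj => ?_⟩
    rw [← Function.iterate_add_apply]
    exact hK _ (by omega)
  obtain ⟨x, hx, hxe⟩ := hX hmem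
  rcases hK0 with rfl | hK0
  · exact he.2 ⟨x, hx.1, hxe⟩
  · apply hK0
    rw [← hxe]
    exact hx.2 1 le_rfl

lemma iterates_stab {α : Type*} (Ω : Set α) (F : α → α) (hmaps : Set.MapsTo F Ω Ω)
    (hE : (Ω \ F '' Ω).Finite)
    (hcl : ∀ e ∈ Ω \ F '' Ω, ∃ m, F^[m] e ∈ F^[m+1] '' Ω) :
    ∃ K > 0, ∀ k ≥ K, F^[k] '' Ω = F^[K] '' Ω := by
  choose! m hm using hcl
  obtain ⟨B, hB⟩ := (hE.image m).bddAbove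
  refine ⟨B + 1, Nat.succ_pos _, ?_⟩
  have hstep : ∀ k ≥ B + 1, F^[k+1] '' Ω = F^[k] '' Ω := by
    intro k hk
    apply Set.Subset.antisymm
    · rintro _ ⟨x, hx, rfl⟩
      exact ⟨F x, hmaps hx, by rw [Function.iterate_succ_apply]⟩
    · rintro _ ⟨x, hx, rfl⟩
      by_cases hxF : x ∈ F '' Ω
      · obtain ⟨w, hw, rfl⟩ := hxF
        exact ⟨w, hw, by rw [Function.iterate_succ_apply]⟩
      · have hxE : x ∈ Ω \ F '' Ω := ⟨hx, hxF⟩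
        have hle : m x ≤ B := hB ⟨x, hxE, rfl⟩
        obtain ⟨w, hw, hwx⟩ := hm x hxE
        refine ⟨w, hw, ?_⟩
        obtain ⟨r, rfl⟩ := Nat.exists_eq_add_of_le (show m x ≤ k by omega)
        rw [show m x + r + 1 = r + (m x + 1) by omega, Function.iterate_add_apply, hwx,
          ← Function.iterate_add_apply, add_comm]
  intro k hk
  induction k, hk using Nat.le_induction with
  | base => rfl
  | succ k hk ih => rw [hstep k hk, ih]

lemma iterates_cofinite {α : Type*} (Ω : Set α) (F : α → α)
    (hE : (Ω \ F '' Ω).Finite) (k : ℕ) : (Ω \ F^[k] '' Ω).Finite := by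
  induction k with
  | zero => simp
  | succ k ih =>
    refine (ih.union (hE.image F^[k])).subset ?_
    rintro x ⟨hx, hx'⟩
    by_cases h : x ∈ F^[k] '' Ω
    · right
      obtain ⟨w, hw, rfl⟩ := h
      refine ⟨w, ⟨hw, ?_⟩, rfl⟩
      rintro ⟨u, hu, rfl⟩
      exact hx' ⟨u, hu, by rw [Function.iterate_succ_apply]⟩
    · exact Or.inl ⟨hx, h⟩


open MvPolynomial in
lemma eval_aeval_iter {σ : Type*} (q : σ → MvPolynomial σ ℂ) (g : MvPolynomial σ ℂ) (j : ℕ)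
    (x : σ → ℂ) : eval x ((aeval q : MvPolynomial σ ℂ →ₐ[ℂ] MvPolynomial σ ℂ)^[j] g) =
      eval ((fun (x : σ → ℂ) i => eval x (q i))^[j] x) g := by
  have hev : ∀ (x : σ → ℂ) (a : MvPolynomial σ ℂ),
      eval x (aeval q a) = eval (fun i => eval x (q i)) a := by
    intro x a
    induction a using MvPolynomial.induction_on with
    | C r => simp
    | add p r hp hr => rw [map_add, map_add, map_add, hp, hr]
    | mul_X p i hp => rw [map_mul, map_mul, map_mul, hp, aeval_X, eval_X]
  induction j generalizing x with
  | zero => rfl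
  | succ j ih => rw [Function.iterate_succ_apply', hev, ih, Function.iterate_succ_apply]

/-- Stability of iterated images for a regular endomorphism `f` of a cofinite
subset `Ω ⊆ ℂ^n` (`n > 1`) with finite fibers whose image is cofinite in `Ω`; the stable
image is an open, simply connected, cofinite subset of `Ω`. -/
theorem iterated_images_stabilize_finite_fibers
    (n : ℕ) (hn : 1 < n)
    (Ω : Set (Fin n → ℂ)) (hΩcof : Ωᶜ.Finite)
    (F : (Fin n → ℂ) → (Fin n → ℂ))
    (hFpoly : ∃ q : Fin n → MvPolynomial (Fin n) ℂ,
      ∀ x i, F x i = MvPolynomial.eval x (q i))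
    (hmaps : Set.MapsTo F Ω Ω)
    (hfib : ∀ y ∈ Ω, {x ∈ Ω | F x = y}.Finite)
    (himgcof : (Ω \ F '' Ω).Finite) :
    (∃ K > 0, ∀ k ≥ K, F^[k] '' Ω = F^[K] '' Ω) ∧
    (∃ U : Set (Fin n → ℂ), IsOpen U ∧ (⋂ k > 0, F^[k] '' Ω) = U ∩ Ω) ∧
    SimplyConnectedSpace ↥(⋂ k > 0, F^[k] '' Ω) ∧
    (Ω \ ⋂ k > 0, F^[k] '' Ω).Finite := by
  classical
  obtain ⟨q, hq⟩ := hFpoly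
  obtain rfl : F = fun x i => MvPolynomial.eval x (q i) := funext fun x => funext fun i => hq x i
  clear hq
  set F : (Fin n → ℂ) → (Fin n → ℂ) := fun x i => MvPolynomial.eval x (q i) with hF
  have hfin : ∀ y, {x | F x = y}.Finite := by
    intro y
    by_cases hy : y ∈ Ω
    · refine (hΩcof.union (hfib y hy)).subset fun x hx => ?_
      by_cases h : x ∈ Ω
      · exact Or.inr ⟨h, hx⟩
      · exact Or.inl h
    · refine hΩcof.subset fun x hx h => hy ?_
      have := hmaps h
      rwa [show F x = y from hx] at this
  have hdense : DenseRange F := by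
    have hc : (Set.range F)ᶜ.Finite := by
      refine (hΩcof.union himgcof).subset fun x hx => ?_
      by_cases h : x ∈ Ω
      · exact Or.inr ⟨h, fun h' => hx (Set.image_subset_range _ _ h')⟩
      · exact Or.inl h
    haveI : Nonempty (Fin n) := ⟨⟨0, by omega⟩⟩
    have := hc.countable.dense_compl ℝ
    rwa [compl_compl] at this
  have hgood : ∀ y, (∀ g : MvPolynomial (Fin n) ℂ,
      (∀ z, MvPolynomial.eval z g ≠ 0 → ¬ OnePre Ω F z) → MvPolynomial.eval y g = 0) →
      OnePre Ω F y := by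
    intro y hy a ha b hb hay hby
    by_contra hab
    obtain ⟨g, hg, hg'⟩ := two_pre_open q hfin hdense Ω hΩcof a b ha hb hab (hay.trans hby.symm)
    apply hg
    have hyb : (fun i => MvPolynomial.eval b (q i)) = y := hby
    rw [hyb]
    apply hy
    intro z hz h1
    obtain ⟨a', ha', b', hb', hne, h2, h3⟩ := hg' z hz
    exact hne (h1 a' ha' b' hb' h2 h3)
  let S : Set (MvPolynomial (Fin n) ℂ) :=
    {p | ∃ g : MvPolynomial (Fin n) ℂ, (∀ z, MvPolynomial.eval z g ≠ 0 → ¬ OnePre Ω F z) ∧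
      ∃ j ≥ 1, p = (MvPolynomial.aeval q :
        MvPolynomial (Fin n) ℂ →ₐ[ℂ] MvPolynomial (Fin n) ℂ)^[j] g}
  have hXeq : {y | y ∈ Ω ∧ ∀ j ≥ 1, OnePre Ω F (F^[j] y)} =
      Ω ∩ MvPolynomial.zeroLocus ℂ (Ideal.span S) := by
    ext y
    rw [MvPolynomial.zeroLocus_span]
    constructor
    · rintro ⟨h1, h2⟩
      refine ⟨h1, ?_⟩
      rintro p ⟨g, hg, j, hj, rfl⟩
      rw [MvPolynomial.aeval_eq_eval, eval_aeval_iter]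
      by_contra hc
      exact hg _ hc (h2 j hj)
    · rintro ⟨h1, h2⟩
      refine ⟨h1, fun j hj => hgood _ fun g hg => ?_⟩
      have := h2 _ ⟨g, hg, j, hj, rfl⟩
      rwa [MvPolynomial.aeval_eq_eval, eval_aeval_iter] at this
  have hmX : Set.MapsTo F {y | y ∈ Ω ∧ ∀ j ≥ 1, OnePre Ω F (F^[j] y)}
      {y | y ∈ Ω ∧ ∀ j ≥ 1, OnePre Ω F (F^[j] y)} := by
    rintro y ⟨h1, h2⟩
    refine ⟨hmaps h1, fun j hj => ?_⟩
    rw [← Function.iterate_succ_apply]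
    exact h2 _ (by omega)
  have hiX : Set.InjOn F {y | y ∈ Ω ∧ ∀ j ≥ 1, OnePre Ω F (F^[j] y)} := by
    rintro a ⟨h1, h2⟩ b ⟨h3, h4⟩ hab
    exact h2 1 le_rfl a h1 b h3 rfl hab.symm
  have hsX : Set.SurjOn F {y | y ∈ Ω ∧ ∀ j ≥ 1, OnePre Ω F (F^[j] y)}
      {y | y ∈ Ω ∧ ∀ j ≥ 1, OnePre Ω F (F^[j] y)} := by
    rw [hXeq] at hmX hiX ⊢
    exact ax_step q Ω hΩcof _ hmX hiX
  obtain ⟨K, hK0, hK⟩ := iterates_stab Ω F hmaps himgcof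
    (stab_claim Ω F hmaps himgcof hsX)
  have hsub : F^[K] '' Ω ⊆ Ω := by
    rintro _ ⟨x, hx, rfl⟩
    exact (hmaps.iterate K) hx
  have hstab : (⋂ k > 0, F^[k] '' Ω) = F^[K] '' Ω := by
    apply Set.Subset.antisymm
    · exact Set.iInter₂_subset K hK0
    · refine Set.subset_iInter₂ fun k hk => ?_
      rcases Nat.le_total K k with h | h
      · rw [hK k h]
      · obtain ⟨r, rfl⟩ := Nat.exists_eq_add_of_le h
        rintro _ ⟨x, hx, rfl⟩
        exact ⟨F^[r] x, (hmaps.iterate r) hx, by rw [Function.iterate_add_apply]⟩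
  have hcofK := iterates_cofinite Ω F himgcof K
  have hcompl : (F^[K] '' Ω)ᶜ.Finite := by
    refine (hΩcof.union hcofK).subset fun x hx => ?_
    by_cases h : x ∈ Ω
    · exact Or.inr ⟨h, hx⟩
    · exact Or.inl h
  rw [hstab]
  refine ⟨⟨K, hK0, hK⟩, ⟨F^[K] '' Ω, ?_, ?_⟩, simplyConnected_of_cofinite hn _ hcompl, hcofK⟩
  · exact isClosed_compl_iff.mp hcompl.isClosed
  · exact (Set.inter_eq_left.mpr hsub).symm
end

section
/- Let f : ℂ² → ℂ² be a polynomial map that is open (with respect to the Euclidean topology). Then the iterated images f^k(ℂ²) stabilize: there exists K > 0 with f^k(ℂ²) = f^K(ℂ²) for all k ≥ K, and the stable image ⋂_{k>0} f^k(ℂ²) is an open, simply connected, cofinite subset of ℂ². Moreover, if Ω ⊂ ℂ² is any cofinite subset with f(Ω) ⊆ Ω, then the iterated images f^k(Ω) also stabilize and the stable image is an open, simply connected, cofinite subset of Ω. -/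
section SC
open unitInterval

theorem homotopic_of_segment {V : Type*} [NormedAddCommGroup V] [NormedSpace ℝ V] {S : Set V}
    {a b : S} (p q : Path a b)
    (h : ∀ s t : I, (1 - (s : ℝ)) • (p t : V) + (s : ℝ) • (q t : V) ∈ S) : p.Homotopic q := by
  refine ⟨{ toFun := fun st => ⟨_, h st.1 st.2⟩, continuous_toFun := ?_, map_zero_left := ?_,
            map_one_left := ?_, prop' := ?_ }⟩
  · fun_prop
  · intro t; ext; simp
  · intro t; ext; simp
  · intro s t ht
    apply Subtype.ext
    rcases ht with rfl | ht
    · simp [← add_smul]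
    · rw [Set.mem_singleton_iff] at ht
      subst ht
      simp [← add_smul]

theorem simplyConnected_of_compl_finite {V : Type*} [NormedAddCommGroup V] [NormedSpace ℝ V]
    [FiniteDimensional ℝ V] (hV : 3 < Module.finrank ℝ V)
    (S : Set V) (hS : Sᶜ.Finite) : SimplyConnectedSpace S := by
  have hrank : 1 < Module.rank ℝ V := by
    rw [← Module.finrank_eq_rank]; exact_mod_cast (by omega : 1 < Module.finrank ℝ V)
  have hpc : IsPathConnected S := by
    have := hS.countable.isPathConnected_compl_of_one_lt_rank hrank
    rwa [compl_compl] at this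
  have hSo : IsOpen S := by
    have := hS.isClosed.isOpen_compl
    rwa [compl_compl] at this
  rw [simply_connected_iff_loops_nullhomotopic]
  refine ⟨isPathConnected_iff_pathConnectedSpace.mp hpc, fun x γ => ?_⟩
  let g : C(I, V) := ⟨fun t => (γ t : V), by fun_prop⟩
  have hK : IsCompact (Set.range g) := isCompact_range g.continuous
  obtain ⟨δ, hδ, hδS⟩ := hK.exists_thickening_subset_open hSo
    (by rintro _ ⟨t, rfl⟩; exact (γ t).2)
  have hnear : ∀ t : I, ∀ w : V, dist w (γ t : V) < δ → w ∈ S := by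
    intro t w hw
    apply hδS
    rw [Metric.mem_thickening_iff]
    exact ⟨_, ⟨t, rfl⟩, hw⟩
  obtain ⟨n, hn, hn0⟩ := (((bernsteinApproximation_uniform g).eventually
    (Metric.ball_mem_nhds g (half_pos hδ))).and (Filter.eventually_ne_atTop 0)).exists
  set B := bernsteinApproximation n g with hB
  have hBn : ∀ t, dist (B t) (γ t : V) < δ / 2 := fun t =>
    lt_of_le_of_lt (ContinuousMap.dist_apply_le_dist (f := B) (g := g) t) hn
  have hB0 : B 0 = x := by simp [hB, g]
  have hB1 : B 1 = x := by simp [hB, g, hn0]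
  obtain ⟨P, hPc, hPB⟩ : ∃ P : ℝ → V, ContDiff ℝ 1 P ∧ ∀ t : I, P t = B t := by
    refine ⟨fun t => ∑ k : Fin (n + 1), ((n.choose k : ℝ) * t ^ (k : ℕ) * (1 - t) ^ (n - k)) •
      g (bernstein.z k), by fun_prop, fun t => ?_⟩
    rw [hB, bernsteinApproximation.apply]
    simp [bernstein_apply]
  -- generic perturbation
  have hdense : Dense (⋂ q ∈ Sᶜ, (Set.range
      (fun z : ℝ × ℝ × ℝ => z.2.2 • (z.1 • q + (1 - z.1) • (x : V) - P z.2.1)))ᶜ) := by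
    have : (⋂ q ∈ Sᶜ, (Set.range
      (fun z : ℝ × ℝ × ℝ => z.2.2 • (z.1 • q + (1 - z.1) • (x : V) - P z.2.1)))ᶜ) =
      (⋃ q ∈ Sᶜ, (Set.range
      (fun z : ℝ × ℝ × ℝ => z.2.2 • (z.1 • q + (1 - z.1) • (x : V) - P z.2.1))))ᶜ := by
      simp only [Set.compl_iUnion]
    rw [this]
    apply dense_compl_of_dimH_lt_finrank
    rw [dimH_bUnion hS.countable]
    refine lt_of_le_of_lt (b := (3 : ENNReal)) (iSup₂_le fun q _ => ?_) (by exact_mod_cast hV)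
    have hc : ContDiff ℝ 1
        (fun z : ℝ × ℝ × ℝ => z.2.2 • (z.1 • q + (1 - z.1) • (x : V) - P z.2.1)) := by
      fun_prop
    refine hc.dimH_range_le.trans ?_
    simp
  obtain ⟨v, hv, hvδ⟩ : ∃ v, v ∈ (⋂ q ∈ Sᶜ, (Set.range
      (fun z : ℝ × ℝ × ℝ => z.2.2 • (z.1 • q + (1 - z.1) • (x : V) - P z.2.1)))ᶜ) ∧ ‖v‖ < δ / 2 := by
    obtain ⟨v, hv1, hv2⟩ := hdense.exists_mem_open (Metric.isOpen_ball (x := (0:V)) (ε := δ / 2))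
      ⟨0, by simpa using hδ⟩
    exact ⟨v, hv1, by simpa using hv2⟩
  let Q : I → V := fun t => B t + ((t : ℝ) * (1 - t)) • v
  have hQn : ∀ t, dist (Q t) (γ t : V) < δ := by
    intro t
    have h1 : ‖((t : ℝ) * (1 - t)) • v‖ < δ / 2 := by
      rw [norm_smul]
      refine lt_of_le_of_lt ?_ hvδ
      have : ‖((t : ℝ) * (1 - t))‖ ≤ 1 := by
        rw [Real.norm_eq_abs, abs_le]
        have := t.2.1; have := t.2.2
        constructor <;> nlinarith
      exact mul_le_of_le_one_left (norm_nonneg _) this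
    have h2 := hBn t
    rw [dist_eq_norm] at h2 ⊢
    calc ‖Q t - γ t‖ = ‖(B t - γ t) + ((t : ℝ) * (1 - t)) • v‖ := by congr 1; simp only [Q]; abel
      _ ≤ _ := norm_add_le _ _
      _ < δ := by linarith
  let q : Path x x :=
    { toFun := fun t => ⟨Q t, hnear t _ (hQn t)⟩
      continuous_toFun := by
        have : Continuous Q := by fun_prop
        fun_prop
      source' := by apply Subtype.ext; simp [Q, hB0]
      target' := by apply Subtype.ext; simp [Q, hB1] }
  have hq : ∀ t, (q t : V) = Q t := fun t => rfl
  refine Path.Homotopic.trans (homotopic_of_segment γ q ?_) (homotopic_of_segment q (Path.refl x) ?_)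
  · intro s t
    apply hnear t
    rw [hq]
    have h2 := hQn t
    rw [dist_eq_norm] at h2 ⊢
    have : (1 - (s:ℝ)) • (γ t : V) + (s:ℝ) • Q t - (γ t : V) = (s:ℝ) • (Q t - γ t) := by
      module
    rw [this, norm_smul, Real.norm_eq_abs, abs_of_nonneg s.2.1]
    exact lt_of_le_of_lt (mul_le_of_le_one_left (norm_nonneg _) s.2.2) h2
  · intro s t
    rw [hq]
    by_contra hbad
    by_cases hs : (s : ℝ) = 1
    · apply hbad; simp [hs]
    by_cases ht : (t : ℝ) * (1 - t) = 0
    · apply hbad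
      have : Q t = x := by
        rcases mul_eq_zero.mp ht with h | h
        · have : t = 0 := by ext; simpa using h
          subst this; simp [Q, hB0]
        · have : t = 1 := by ext; simp only [Set.Icc.coe_one]; linarith
          subst this; simp [Q, hB1]
      rw [this]
      simp [← add_smul]
    · have hv' := hv
      rw [Set.mem_iInter₂] at hv'
      apply hv' _ hbad
      refine ⟨(1 / (1 - (s:ℝ)), (t : ℝ), 1 / ((t : ℝ) * (1 - t))), ?_⟩
      have hs' : 1 - (s : ℝ) ≠ 0 := fun h => hs (by linarith)
      simp only [hPB, Path.refl_apply, Q]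
      have e1 : (1 / (1 - (s:ℝ))) • ((1 - (s:ℝ)) • (B t + ((t:ℝ) * (1 - t)) • v) + (s:ℝ) • (x:V)) +
          (1 - 1 / (1 - (s:ℝ))) • (x:V) - B t = ((t:ℝ) * (1 - t)) • v := by
        match_scalars <;> field_simp <;> ring
      rw [e1, smul_smul, one_div, inv_mul_cancel₀ ht, one_smul]

end SC

open MvPolynomial in
theorem generic_lift_s4 {B A : Type*} [CommRing B] [IsDomain B] [IsNoetherianRing B] [CommRing A]
    (f : B →+* A) (hf : f.FiniteType) (hinj : Function.Injective f) :
    ∃ b : B, b ≠ 0 ∧ ∀ p : Ideal B, p.IsPrime → b ∉ p → ∃ Q : Ideal A, Q.IsPrime ∧ Q.comap f = p := by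
  have hfp : f.FinitePresentation := RingHom.FinitePresentation.of_finiteType.mp hf
  obtain ⟨S, hS⟩ := PrimeSpectrum.exists_constructibleSetData_iff.mpr
    (PrimeSpectrum.isConstructible_range_comap hfp)
  obtain ⟨Q, hQ, hQ'⟩ := Ideal.exists_comap_eq_of_mem_minimalPrimes_of_injective hinj ⊥
    (by rw [IsDomain.minimalPrimes_eq_singleton_bot]; rfl)
  have hmem : (⟨⊥, Ideal.isPrime_bot⟩ : PrimeSpectrum B) ∈ S.toSet := by
    rw [hS]
    exact ⟨⟨Q, hQ⟩, PrimeSpectrum.ext hQ'⟩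
  simp only [PrimeSpectrum.ConstructibleSetData.toSet, Set.mem_iUnion] at hmem
  obtain ⟨C, hC, hCm, hCf⟩ := hmem
  have hg : ∀ i, C.g i = 0 := fun i => by
    have := hCm (Set.mem_range_self i)
    simpa using this
  refine ⟨C.f, fun h => hCf (by simp [h]), fun p hp hbp => ?_⟩
  have : (⟨p, hp⟩ : PrimeSpectrum B) ∈ S.toSet := by
    simp only [PrimeSpectrum.ConstructibleSetData.toSet, Set.mem_iUnion]
    refine ⟨C, hC, ?_, ?_⟩
    · rintro _ ⟨i, rfl⟩
      rw [hg]; exact p.zero_mem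
    · intro h; apply hbp; simpa using h
  rw [hS] at this
  obtain ⟨q, hq⟩ := this
  exact ⟨q.asIdeal, q.isPrime, congrArg PrimeSpectrum.asIdeal hq⟩

open MvPolynomial in
theorem exists_zero_of_ne_top {σ : Type*} [Finite σ] (Q : Ideal (MvPolynomial σ ℂ)) (hQ : Q ≠ ⊤) :
    ∃ z : σ → ℂ, ∀ g ∈ Q, eval z g = 0 := by
  obtain ⟨m, hm, hQm⟩ := Q.exists_le_maximal hQ
  obtain ⟨z, rfl⟩ := isMaximal_iff_eq_vanishingIdeal_singleton.mp hm
  refine ⟨z, fun g hg => ?_⟩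
  have := hQm hg
  rw [mem_vanishingIdeal_singleton_iff] at this
  simpa [aeval_eq_eval] using this

open MvPolynomial in
theorem krullDim_le_zero {S : Type*} [CommRing S] (f : MvPolynomial (Fin 2) ℂ →+* S)
    (hf : Function.Surjective f) {h g : MvPolynomial (Fin 2) ℂ} (hh : Prime h) (hg : ¬ h ∣ g)
    (h0 : f h = 0) (g0 : f g = 0) : ringKrullDim S ≤ 0 := by
  have h1 := ringKrullDim_quotient_succ_le_of_nonZeroDivisor (mem_nonZeroDivisors_of_ne_zero hh.ne_zero)
  have h2 : ringKrullDim (MvPolynomial (Fin 2) ℂ) = 2 := by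
    rw [MvPolynomial.ringKrullDim_of_isNoetherianRing]; simp
  have : (Ideal.span {h}).IsPrime := (Ideal.span_singleton_prime hh.ne_zero).mpr hh
  have hle' : Ideal.span {h} ≤ RingHom.ker f := by
    rw [Ideal.span_singleton_le_iff_mem]; exact h0
  have hle : ∀ a ∈ Ideal.span {h}, f a = 0 := fun a ha => hle' ha
  have h3 := ringKrullDim_succ_le_of_surjective (Ideal.Quotient.lift (Ideal.span {h}) f hle)
    (Ideal.Quotient.lift_surjective_of_surjective _ _ hf)
    (r := Ideal.Quotient.mk _ g) (mem_nonZeroDivisors_of_ne_zero (by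
      rw [Ne, Ideal.Quotient.eq_zero_iff_mem, Ideal.mem_span_singleton]; exact hg)) (by rw [Ideal.Quotient.lift_mk]; exact g0)
  rw [h2] at h1
  generalize ringKrullDim (MvPolynomial (Fin 2) ℂ ⧸ Ideal.span {h}) = a at *
  generalize ringKrullDim S = c at *
  have h4 : c + 1 + 1 ≤ 2 := (add_le_add_left h3 1).trans h1
  induction c with
  | bot => simp
  | coe c =>
    induction c with
    | top => exact absurd h4 (by decide)
    | coe n => 
      have h5 : ((n + 1 + 1 : ℕ) : WithBot ℕ∞) ≤ ((2 : ℕ) : WithBot ℕ∞) := by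
        push_cast; exact h4
      have h6 : n + 1 + 1 ≤ 2 := (Nat.cast_le (α := WithBot ℕ∞)).mp h5
      have h7 : n = 0 := by omega
      subst h7; simp

open MvPolynomial in
theorem isMaximal_of_two {P : Ideal (MvPolynomial (Fin 2) ℂ)} (hP : P.IsPrime)
    {h g : MvPolynomial (Fin 2) ℂ} (hh : Prime h) (hg : ¬ h ∣ g) (h0 : h ∈ P) (g0 : g ∈ P) :
    P.IsMaximal := by
  have := krullDim_le_zero (Ideal.Quotient.mk P) Ideal.Quotient.mk_surjective hh hg
    (Ideal.Quotient.eq_zero_iff_mem.mpr h0) (Ideal.Quotient.eq_zero_iff_mem.mpr g0)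
  have : Ring.KrullDimLE 0 (MvPolynomial (Fin 2) ℂ ⧸ P) := by
    rw [Ring.krullDimLE_iff]; simpa using this
  exact Ideal.Quotient.maximal_of_isField _ (Ring.KrullDimLE.isField_of_isDomain)

open MvPolynomial in
theorem finite_common_zeros {h g : MvPolynomial (Fin 2) ℂ} (hh : Prime h) (hg : ¬ h ∣ g) :
    {p : Fin 2 → ℂ | eval p h = 0 ∧ eval p g = 0}.Finite := by
  let J := Ideal.span {h, g}
  have := krullDim_le_zero (Ideal.Quotient.mk J) Ideal.Quotient.mk_surjective hh hg
    (Ideal.Quotient.eq_zero_iff_mem.mpr (Ideal.subset_span (by simp)))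
    (Ideal.Quotient.eq_zero_iff_mem.mpr (Ideal.subset_span (by simp)))
  have : Ring.KrullDimLE 0 (MvPolynomial (Fin 2) ℂ ⧸ J) := by
    rw [Ring.krullDimLE_iff]; simpa using this
  have hart : IsArtinianRing (MvPolynomial (Fin 2) ℂ ⧸ J) :=
    isArtinianRing_iff_isNoetherianRing_krullDimLE_zero.mpr ⟨inferInstance, this⟩
  have hfin : Finite (PrimeSpectrum (MvPolynomial (Fin 2) ℂ ⧸ J)) := inferInstance
  have hJ : ∀ p : {p : Fin 2 → ℂ | eval p h = 0 ∧ eval p g = 0}, ∀ a ∈ J, eval p.1 a = 0 := by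
    intro p a ha
    have : J ≤ RingHom.ker (eval p.1) := by
      rw [Ideal.span_le]
      rintro _ (rfl | rfl)
      exacts [p.2.1, p.2.2]
    exact this ha
  let ψ : {p : Fin 2 → ℂ | eval p h = 0 ∧ eval p g = 0} → PrimeSpectrum (MvPolynomial (Fin 2) ℂ ⧸ J) :=
    fun p => ⟨RingHom.ker (Ideal.Quotient.lift J (eval p.1) (hJ p)), RingHom.ker_isPrime _⟩
  refine Set.finite_coe_iff.mp (Finite.of_injective ψ ?_)
  intro p q hpq
  have h1 := congrArg PrimeSpectrum.asIdeal hpq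
  apply Subtype.ext
  funext i
  have : Ideal.Quotient.mk J (X i - C (p.1 i)) ∈ (ψ q).asIdeal := by
    rw [← h1]; simp [ψ, RingHom.mem_ker]
  have h2 : q.1 i - p.1 i = 0 := by simpa [ψ, RingHom.mem_ker] using this
  exact (sub_eq_zero.mp h2).symm

open MvPolynomial in
theorem eval_bind (q : Fin 2 → MvPolynomial (Fin 2) ℂ) (z : Fin 2 → ℂ) (g : MvPolynomial (Fin 2) ℂ) :
    eval z (bind₁ q g) = eval (fun i => eval z (q i)) g := by
  rw [eval, eval₂Hom_bind₁]; rfl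

open MvPolynomial in
theorem eq_zero_of_open {g : MvPolynomial (Fin 2) ℂ} {U : Set (Fin 2 → ℂ)} (hU : IsOpen U) (hne : U.Nonempty)
    (h : ∀ x ∈ U, eval x g = 0) : g = 0 := by
  obtain ⟨x, hx⟩ := hne
  obtain ⟨ε, hε, hb⟩ := Metric.isOpen_iff.mp hU x hx
  have hinf : ∀ i : Fin 2, (Metric.ball (x i) ε).Infinite := fun i => 
    infinite_of_mem_nhds (x i) (Metric.ball_mem_nhds _ hε)
  refine MvPolynomial.funext_set (fun i => Metric.ball (x i) ε) hinf (fun y hy => ?_)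
  rw [map_zero]
  apply h y (hb _)
  rw [ball_pi _ hε]; exact hy

open MvPolynomial in
theorem tau_injective (F : (Fin 2 → ℂ) → (Fin 2 → ℂ)) (q : Fin 2 → MvPolynomial (Fin 2) ℂ)
    (hq : ∀ x i, F x i = eval x (q i)) (hopen : IsOpenMap F) : Function.Injective (bind₁ q : MvPolynomial (Fin 2) ℂ →ₐ[ℂ] MvPolynomial (Fin 2) ℂ) := by
  rw [injective_iff_map_eq_zero]
  intro g hg
  refine eq_zero_of_open hopen.isOpen_range (Set.range_nonempty _) ?_
  rintro _ ⟨z, rfl⟩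
  have := eval_bind q z g
  rw [hg, map_zero] at this
  rw [this]; congr 1; congr 1; funext i; exact hq z i

theorem cone_not_nhds (c : Fin 2 → ℂ) (i j : Fin 2) (hij : i ≠ j) (r : ℝ)
    (W : Set (Fin 2 → ℂ)) (hW : W ∈ nhds c) (h : ∀ w ∈ W, ‖w j - c j‖ ≤ r * ‖w i - c i‖) : False := by
  obtain ⟨ε, hε, hb⟩ := Metric.mem_nhds_iff.mp hW
  have hmem : c + Pi.single j ((ε / 2 : ℝ) : ℂ) ∈ Metric.ball c ε := by
    rw [Metric.mem_ball, dist_eq_norm, add_sub_cancel_left, Pi.norm_single, Complex.norm_real]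
    rw [Real.norm_of_nonneg (by positivity)]; linarith
  have := h _ (hb hmem)
  simp [hij] at this
  rw [abs_of_pos hε] at this; linarith

open MvPolynomial in
theorem cont_eval (g : MvPolynomial (Fin 2) ℂ) : Continuous fun x : Fin 2 → ℂ => eval x g := MvPolynomial.continuous_eval g

open MvPolynomial in
theorem toolO_aux (F : (Fin 2 → ℂ) → (Fin 2 → ℂ)) (hopen : IsOpenMap F) (i j : Fin 2) (hij : i ≠ j)
    (c : Fin 2 → ℂ) (a b d : MvPolynomial (Fin 2) ℂ)
    (ha : ∀ x, F x i - c i = eval x d * eval x a) (hb : ∀ x, F x j - c j = eval x d * eval x b) 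
    (z : Fin 2 → ℂ) (hz : F z = c) (haz : eval z a ≠ 0) : False := by
  have h1 : ∀ᶠ x in nhds z, ‖eval x b‖ ≤ (‖eval z b‖ + 1) / (‖eval z a‖ / 2) * ‖eval x a‖ := by
    have hpos : 0 < ‖eval z a‖ := norm_pos_iff.mpr haz
    have h2 : ∀ᶠ x in nhds z, ‖eval x b‖ < ‖eval z b‖ + 1 :=
      (cont_eval b).norm.continuousAt.eventually_lt continuousAt_const (by simp)
    have h3 : ∀ᶠ x in nhds z, ‖eval z a‖ / 2 < ‖eval x a‖ := 
      continuousAt_const.eventually_lt (cont_eval a).norm.continuousAt (by linarith)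
    filter_upwards [h2, h3] with x h2 h3
    calc ‖eval x b‖ ≤ ‖eval z b‖ + 1 := h2.le
      _ = (‖eval z b‖ + 1) / (‖eval z a‖ / 2) * (‖eval z a‖ / 2) := by field_simp
      _ ≤ _ := by gcongr
  have hW := hopen.image_mem_nhds h1
  rw [hz] at hW
  refine cone_not_nhds c i j hij ((‖eval z b‖ + 1) / (‖eval z a‖ / 2)) _ hW ?_
  rintro _ ⟨x, hx, rfl⟩
  rw [ha, hb, norm_mul, norm_mul]
  have hx : ‖eval x b‖ ≤ (‖eval z b‖ + 1) / (‖eval z a‖ / 2) * ‖eval x a‖ := hx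
  have := mul_le_mul_of_nonneg_left hx (norm_nonneg (eval x d))
  linarith

open MvPolynomial in
theorem toolO (F : (Fin 2 → ℂ) → (Fin 2 → ℂ)) (q : Fin 2 → MvPolynomial (Fin 2) ℂ)
    (hq : ∀ x i, F x i = eval x (q i)) (hopen : IsOpenMap F) (k : MvPolynomial (Fin 2) ℂ)
    (hk : Prime k) (c : Fin 2 → ℂ) (hdiv : ∀ i, k ∣ q i - C (c i)) : False := by
  have hne : ∀ i, q i - C (c i) ≠ 0 := by
    intro i h0
    obtain ⟨z, hz⟩ : ∃ z : Fin 2 → ℂ, True := ⟨0, trivial⟩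
    have hFi : ∀ x, F x i = c i := fun x => by
      rw [hq, sub_eq_zero.mp h0, eval_C]
    have hU := hopen.isOpen_range.mem_nhds (Set.mem_range_self z)
    obtain ⟨j, hj⟩ : ∃ j : Fin 2, j ≠ i := exists_ne i
    refine cone_not_nhds (F z) j i hj 0 _ hU ?_
    rintro _ ⟨x, rfl⟩
    simp [hFi]
  obtain ⟨a, b, d, hrel, ha, hb⟩ := UniqueFactorizationMonoid.exists_reduced_factors (q 0 - C (c 0)) (hne 0) (q 1 - C (c 1))
  have hab : ¬ (k ∣ a ∧ k ∣ b) := fun h => hk.not_isUnit (hrel h.1 h.2)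
  have hkd : k ∣ d := by
    by_contra hkd
    apply hab
    refine ⟨?_, ?_⟩
    · have := hdiv 0
      rw [← ha] at this
      exact (hk.dvd_or_dvd this).resolve_left hkd
    · have := hdiv 1
      rw [← hb] at this
      exact (hk.dvd_or_dvd this).resolve_left hkd
  have hz : ∃ z, eval z k = 0 ∧ (eval z a ≠ 0 ∨ eval z b ≠ 0) := by
    by_contra! hcon
    have hP : (Ideal.span {k}).IsPrime := (Ideal.span_singleton_prime hk.ne_zero).mpr hk
    have key := IsPrime.vanishingIdeal_zeroLocus (K := ℂ) (Ideal.span {k})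
    apply hab
    constructor
    · rw [← Ideal.mem_span_singleton, ← key, mem_vanishingIdeal_iff]
      intro x hx
      rw [mem_zeroLocus_iff] at hx
      have := hx k (Ideal.mem_span_singleton_self k)
      rw [aeval_eq_eval] at this ⊢
      exact (hcon x this).1
    · rw [← Ideal.mem_span_singleton, ← key, mem_vanishingIdeal_iff]
      intro x hx
      rw [mem_zeroLocus_iff] at hx
      have := hx k (Ideal.mem_span_singleton_self k)
      rw [aeval_eq_eval] at this ⊢
      exact (hcon x this).2
  obtain ⟨z, hzk, hz⟩ := hz
  have hFz : F z = c := by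
    funext i
    obtain ⟨m, hm⟩ := hdiv i
    have := congrArg (eval z) hm
    rw [map_mul, hzk, zero_mul, map_sub, eval_C, ← hq] at this
    exact sub_eq_zero.mp this
  have hFa : ∀ x, F x 0 - c 0 = eval x d * eval x a := fun x => by
    rw [← map_mul, ha, map_sub, hq, eval_C]
  have hFb : ∀ x, F x 1 - c 1 = eval x d * eval x b := fun x => by
    rw [← map_mul, hb, map_sub, hq, eval_C]
  rcases hz with hz | hz
  · exact toolO_aux F hopen 0 1 (by decide) c a b d hFa hFb z hFz hz
  · exact toolO_aux F hopen 1 0 (by decide) c b a d hFb hFa z hFz hz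

open MvPolynomial in
theorem lift_point {σ : Type*} [Finite σ] (q : Fin 2 → MvPolynomial σ ℂ) (J : Ideal (MvPolynomial σ ℂ))
    (p : Fin 2 → ℂ) (Q : Ideal (MvPolynomial σ ℂ ⧸ J)) (hQ : Q ≠ ⊤)
    (h : ∀ g, eval p g = 0 → Ideal.Quotient.mk J (bind₁ q g) ∈ Q) :
    ∃ z : σ → ℂ, (∀ g ∈ J, eval z g = 0) ∧ ∀ i, eval z (q i) = p i := by
  have hQ' : Q.comap (Ideal.Quotient.mk J) ≠ ⊤ := by
    exact Ideal.comap_ne_top _ hQ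
  obtain ⟨z, hz⟩ := exists_zero_of_ne_top _ hQ'
  refine ⟨z, fun g hg => hz g ?_, fun i => ?_⟩
  · rw [Ideal.mem_comap, Ideal.Quotient.eq_zero_iff_mem.mpr hg]; exact Q.zero_mem
  · have h1 := h (X i - C (p i)) (by simp)
    have := hz _ (Ideal.mem_comap.mpr h1)
    simpa [sub_eq_zero, bind₁_X_right] using this

open MvPolynomial in
theorem finiteType_quot {σ : Type*} [Finite σ] (q : Fin 2 → MvPolynomial σ ℂ) (J : Ideal (MvPolynomial σ ℂ)) :
    ((Ideal.Quotient.mk J).comp (bind₁ q : MvPolynomial (Fin 2) ℂ →ₐ[ℂ] MvPolynomial σ ℂ).toRingHom).FiniteType := by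
  apply RingHom.FiniteType.of_comp_finiteType (f := (C : ℂ →+* MvPolynomial (Fin 2) ℂ))
  have : (((Ideal.Quotient.mk J).comp (bind₁ q : MvPolynomial (Fin 2) ℂ →ₐ[ℂ] MvPolynomial σ ℂ).toRingHom).comp (C : ℂ →+* MvPolynomial (Fin 2) ℂ)) = algebraMap ℂ (MvPolynomial σ ℂ ⧸ J) := by
    ext x
    simp
    rfl
  rw [this, RingHom.finiteType_algebraMap]
  infer_instance

open MvPolynomial in
theorem ker_eval_isPrime (p : Fin 2 → ℂ) : (RingHom.ker (eval p)).IsPrime := RingHom.ker_isPrime _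

open MvPolynomial in
theorem generic_point {σ : Type*} [Finite σ] (q : Fin 2 → MvPolynomial σ ℂ) (J : Ideal (MvPolynomial σ ℂ))
    (hinj : ∀ g, bind₁ q g ∈ J → g = 0) :
    ∃ b : MvPolynomial (Fin 2) ℂ, b ≠ 0 ∧ ∀ p : Fin 2 → ℂ, eval p b ≠ 0 →
      ∃ z : σ → ℂ, (∀ g ∈ J, eval z g = 0) ∧ ∀ i, eval z (q i) = p i := by
  obtain ⟨b, hb, hlift⟩ := generic_lift_s4 _ (finiteType_quot q J) (by
    rw [injective_iff_map_eq_zero]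
    intro g hg
    exact hinj g (Ideal.Quotient.eq_zero_iff_mem.mp hg))
  refine ⟨b, hb, fun p hp => ?_⟩
  obtain ⟨Q, hQ, hc⟩ := hlift (RingHom.ker (eval p)) (ker_eval_isPrime p) hp
  refine lift_point q J p Q hQ.ne_top fun g hg => ?_
  have : g ∈ Q.comap _ := hc ▸ (show g ∈ RingHom.ker (eval p) from hg)
  exact this

open MvPolynomial in
theorem missed_on_prime (F : (Fin 2 → ℂ) → (Fin 2 → ℂ)) (q : Fin 2 → MvPolynomial (Fin 2) ℂ)
    (hq : ∀ x i, F x i = eval x (q i)) (hopen : IsOpenMap F) (h : MvPolynomial (Fin 2) ℂ) (hh : Prime h) :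
    {p | eval p h = 0 ∧ p ∉ Set.range F}.Finite := by
  have hinj := tau_injective F q hq hopen
  obtain ⟨k, hk, hkd⟩ : ∃ k, Prime k ∧ k ∣ bind₁ q h := by
    have h0 : bind₁ q h ≠ 0 := fun h0 => hh.ne_zero (hinj (by rw [h0, map_zero]))
    have hu : ¬ IsUnit (bind₁ q h) := by
      intro hu
      obtain ⟨c, hc, hc'⟩ := MvPolynomial.isUnit_iff_eq_C_of_isReduced.mp hu
      apply hh.not_isUnit
      have : h = C c := hinj (by rw [hc', bind₁_C_right])
      rw [this]; exact hc.map C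
    obtain ⟨k, hk, hkd⟩ := WfDvdMonoid.exists_irreducible_factor hu h0
    exact ⟨k, hk.prime, hkd⟩
  have hKP : (Ideal.span {k}).IsPrime := (Ideal.span_singleton_prime hk.ne_zero).mpr hk
  have hHP : (Ideal.span {h}).IsPrime := (Ideal.span_singleton_prime hh.ne_zero).mpr hh
  let φ : MvPolynomial (Fin 2) ℂ →+* MvPolynomial (Fin 2) ℂ := (bind₁ q : MvPolynomial (Fin 2) ℂ →ₐ[ℂ] MvPolynomial (Fin 2) ℂ).toRingHom
  have hφ : ∀ g, φ g = bind₁ q g := fun g => rfl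
  let P := (Ideal.span {k}).comap φ
  have hP : P.IsPrime := Ideal.comap_isPrime _ _
  have hhP : h ∈ P := Ideal.mem_span_singleton.mpr hkd
  have hPh : ∀ g ∈ P, h ∣ g := by
    by_contra! hcon
    obtain ⟨g, hg, hgh⟩ := hcon
    have hmax := isMaximal_of_two hP hh hgh hhP hg
    obtain ⟨c, hc⟩ := isMaximal_iff_eq_vanishingIdeal_singleton.mp hmax
    refine toolO F q hq hopen k hk c fun i => ?_
    have : X i - C (c i) ∈ P := by
      rw [hc, mem_vanishingIdeal_singleton_iff]; simp
    have := Ideal.mem_span_singleton.mp (Ideal.mem_comap.mp this)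
    rwa [hφ, map_sub, bind₁_X_right, bind₁_C_right] at this
  have hle : Ideal.span {h} ≤ P := by rwa [Ideal.span_singleton_le_iff_mem]
  have hft : (Ideal.quotientMap (Ideal.span {k}) φ hle).FiniteType := by
    apply RingHom.FiniteType.of_comp_finiteType (f := Ideal.Quotient.mk (Ideal.span {h}))
    rw [Ideal.quotientMap_comp_mk]
    exact finiteType_quot q _
  obtain ⟨b, hb, hlift⟩ := generic_lift_s4 _ hft (Ideal.quotientMap_injective' (by
    intro g hg
    exact Ideal.mem_span_singleton.mpr (hPh g hg)))
  obtain ⟨b, rfl⟩ := Ideal.Quotient.mk_surjective b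
  have hhb : ¬ h ∣ b := by
    rwa [Ne, Ideal.Quotient.eq_zero_iff_mem, Ideal.mem_span_singleton] at hb
  refine (finite_common_zeros hh hhb).subset ?_
  rintro p ⟨hp, hpr⟩
  refine ⟨hp, ?_⟩
  by_contra hbp
  apply hpr
  have hz : ∀ a ∈ Ideal.span {h}, eval p a = 0 := by
    intro a ha
    obtain ⟨m, rfl⟩ := Ideal.mem_span_singleton.mp ha
    rw [map_mul, hp, zero_mul]
  obtain ⟨Q, hQ, hQc⟩ := hlift (RingHom.ker (Ideal.Quotient.lift _ (eval p) hz)) (RingHom.ker_isPrime _) (by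
    rw [RingHom.mem_ker, Ideal.Quotient.lift_mk]; exact hbp)
  obtain ⟨z, -, hz⟩ := lift_point q _ p Q hQ.ne_top (fun g hg => by
    have : Ideal.Quotient.mk _ g ∈ Q.comap _ := hQc ▸ (show Ideal.Quotient.mk _ g ∈ RingHom.ker (Ideal.Quotient.lift _ (eval p) hz) by
      rw [RingHom.mem_ker, Ideal.Quotient.lift_mk]; exact hg)
    rw [Ideal.mem_comap, Ideal.quotientMap_mk] at this
    exact this)
  refine ⟨z, ?_⟩
  funext i
  rw [hq, hz]

open MvPolynomial in
theorem missed_finite (F : (Fin 2 → ℂ) → (Fin 2 → ℂ)) (q : Fin 2 → MvPolynomial (Fin 2) ℂ)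
    (hq : ∀ x i, F x i = eval x (q i)) (hopen : IsOpenMap F) : (Set.range F)ᶜ.Finite := by
  have hinj := tau_injective F q hq hopen
  obtain ⟨b, hb, hb'⟩ := generic_point q ⊥ (fun g hg => hinj (by rw [Ideal.mem_bot.mp hg, map_zero]))
  have : ∀ b : MvPolynomial (Fin 2) ℂ, b ≠ 0 → {p | eval p b = 0 ∧ p ∉ Set.range F}.Finite := by
    intro b
    refine UniqueFactorizationMonoid.induction_on_prime b ?_ ?_ ?_
    · intro h; exact absurd rfl h
    · intro u hu _
      convert Set.finite_empty
      ext p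
      simp only [Set.mem_ofPred_eq, Set.mem_empty_iff_false, iff_false, not_and]
      intro h
      exact absurd h (hu.map (eval p)).ne_zero
    · intro a r ha hr ih hne
      refine ((missed_on_prime F q hq hopen r hr).union (ih ha)).subset ?_
      rintro p ⟨hp, hpr⟩
      rw [map_mul, mul_eq_zero] at hp
      rcases hp with hp | hp
      · exact Or.inl ⟨hp, hpr⟩
      · exact Or.inr ⟨hp, hpr⟩
  refine (this b hb).subset ?_
  intro p hp
  refine ⟨?_, hp⟩
  by_contra hbp
  obtain ⟨z, -, hz⟩ := hb' p hbp
  exact hp ⟨z, by funext i; rw [hq, hz]⟩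

open MvPolynomial in
theorem two_preimages (F : (Fin 2 → ℂ) → (Fin 2 → ℂ)) (q : Fin 2 → MvPolynomial (Fin 2) ℂ)
    (hq : ∀ x i, F x i = eval x (q i)) (hopen : IsOpenMap F) (hni : ¬ Function.Injective F) :
    ∃ b : MvPolynomial (Fin 2) ℂ, b ≠ 0 ∧ ∀ p, eval p b ≠ 0 → ∃ z w, z ≠ w ∧ F z = p ∧ F w = p := by
  have hcont : Continuous F := by
    refine continuous_pi fun i => ?_
    simp only [hq]
    exact cont_eval _
  obtain ⟨z0, w0, hF, hne⟩ : ∃ z w, F z = F w ∧ z ≠ w := by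
    simpa [Function.Injective] using hni
  obtain ⟨i, hi⟩ := Function.ne_iff.mp hne
  obtain ⟨A, B, hA, hB, hzA, hwB, hAB⟩ := t2_separation hi
  have hAi : IsOpen ((fun z : Fin 2 → ℂ => z i) ⁻¹' A) := hA.preimage (continuous_apply i)
  have hBi : IsOpen ((fun z : Fin 2 → ℂ => z i) ⁻¹' B) := hB.preimage (continuous_apply i)
  have hU := (hopen _ hAi).inter (hopen _ hBi)
  let S : Set (Option (Fin 2 ⊕ Fin 2) → ℂ) :=
    {v | F (fun j => v (some (Sum.inl j))) = F (fun j => v (some (Sum.inr j))) ∧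
      v none * (v (some (Sum.inl i)) - v (some (Sum.inr i))) = 1}
  obtain ⟨b, hb, hb'⟩ := generic_point (fun j => rename (fun t => some (Sum.inl t)) (q j)) (vanishingIdeal ℂ S) (by
    intro g hg
    refine eq_zero_of_open hU ⟨F z0, ⟨z0, hzA, rfl⟩, ⟨w0, hwB, hF.symm⟩⟩ ?_
    rintro p ⟨⟨z, hz, hzp⟩, ⟨w, hw, hwp⟩⟩
    have hzw : z i - w i ≠ 0 := by
      intro h
      have h2 : z i = w i := sub_eq_zero.mp h
      exact Set.disjoint_left.mp hAB hz (by show z i ∈ B; rw [h2]; exact hw)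
    rw [mem_vanishingIdeal_iff] at hg
    have := hg (fun o => o.elim (z i - w i)⁻¹ (Sum.elim z w)) (by
      refine ⟨?_, ?_⟩
      · change F z = F w
        rw [hzp, hwp]
      · exact inv_mul_cancel₀ hzw)
    rw [aeval_eq_eval, eval, eval₂Hom_bind₁] at this
    rw [← hzp]
    convert this using 1
    apply eval₂Hom_congr rfl _ rfl
    funext j
    rw [hq]
    symm
    change eval _ (rename _ (q j)) = _
    rw [eval_rename]; rfl)
  refine ⟨b, hb, fun p hp => ?_⟩
  obtain ⟨v, hv, hvp⟩ := hb' p hp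
  have h1 : F (fun j => v (some (Sum.inl j))) = p := by
    funext j
    rw [← hvp, hq, eval_rename]; rfl
  have h2 : F (fun j => v (some (Sum.inr j))) = p := by
    rw [← h1]
    funext j
    have := hv (rename (fun t => some (Sum.inr t)) (q j) - rename (fun t => some (Sum.inl t)) (q j)) (by
      rw [mem_vanishingIdeal_iff]
      rintro u ⟨hu, -⟩
      rw [aeval_eq_eval, map_sub, eval_rename, eval_rename]
      have := congrFun hu j
      rw [hq, hq] at this
      exact sub_eq_zero.mpr this.symm)
    rw [map_sub, eval_rename, eval_rename] at this
    rw [hq, hq]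
    exact sub_eq_zero.mp this
  have h3 := hv (X none * (X (some (Sum.inl i)) - X (some (Sum.inr i))) - 1) (by
      rw [mem_vanishingIdeal_iff]
      rintro u ⟨-, hu⟩
      rw [aeval_eq_eval]
      simp [hu])
  refine ⟨_, _, ?_, h1, h2⟩
  intro h
  have h4 : v (some (Sum.inl i)) = v (some (Sum.inr i)) := congrFun h i
  simp [h4] at h3

open Polynomial in
theorem rel_poly (b : ℂ[X][X]) (hb : b ≠ 0) : ∃ r : ℕ, ∀ u : ℂ[X][X], ∃ e : Fin (r + 1) → ℂ[X],
    (∃ i, e i ≠ 0) ∧ b ∣ ∑ k, C (e k) * u ^ (k : ℕ) := by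
  let K := FractionRing ℂ[X]
  let ι : ℂ[X][X] →+* K[X] := mapRingHom (algebraMap ℂ[X] K)
  have hι : Function.Injective ι := map_injective _ (IsFractionRing.injective ℂ[X] K)
  have hf : ι b ≠ 0 := fun h => hb (hι (by rw [h, map_zero]))
  refine ⟨Module.finrank K (AdjoinRoot (ι b)), fun u => ?_⟩
  have : Module.Finite K (AdjoinRoot (ι b)) := (AdjoinRoot.powerBasis hf).finite
  have hnl : ¬ LinearIndependent ℂ[X] (fun k : Fin (Module.finrank K (AdjoinRoot (ι b)) + 1) => (AdjoinRoot.mk (ι b) (ι u)) ^ (k : ℕ)) := by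
    rw [LinearIndependent.iff_fractionRing ℂ[X] K]
    intro h
    have := h.fintype_card_le_finrank
    simp at this
  obtain ⟨c, hc, i, hi⟩ := Fintype.not_linearIndependent_iff.mp hnl
  have h1 : AdjoinRoot.mk (ι b) (ι (∑ k, C (c k) * u ^ (k : ℕ))) = 0 := by
    rw [← hc, map_sum, map_sum]
    refine Finset.sum_congr rfl fun k _ => ?_
    rw [map_mul, map_mul, map_pow, map_pow, Algebra.smul_def]
    congr 1
    rw [IsScalarTower.algebraMap_apply ℂ[X] K (AdjoinRoot (ι b))]
    simp [ι]
    rfl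
  rw [AdjoinRoot.mk_eq_zero] at h1
  obtain ⟨g, hg⟩ := h1
  obtain ⟨d, hd, hdg⟩ := IsLocalization.integerNormalization_spec (nonZeroDivisors ℂ[X]) g
  refine ⟨fun k => d * c k, ⟨i, mul_ne_zero (nonZeroDivisors.ne_zero hd) hi⟩, IsLocalization.integerNormalization (nonZeroDivisors ℂ[X]) g, ?_⟩
  apply hι
  rw [map_mul]
  have h2 : ι (IsLocalization.integerNormalization (nonZeroDivisors ℂ[X]) g) = ι (C d) * g := by
    change Polynomial.map _ _ = _
    rw [hdg, Algebra.smul_def]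
    congr 1
    simp [ι]
  rw [h2]
  have h3 : ∑ k, C (d * c k) * u ^ (k : ℕ) = C d * ∑ k, C (c k) * u ^ (k : ℕ) := by
    rw [Finset.mul_sum]
    refine Finset.sum_congr rfl fun k _ => ?_
    rw [C_mul, mul_assoc]
  rw [h3, map_mul, hg]
  ring

open MvPolynomial in
theorem rel_mv (b : MvPolynomial (Fin 2) ℂ) (hb : b ≠ 0) (j : Fin 2) : ∃ r : ℕ, ∀ u : MvPolynomial (Fin 2) ℂ, ∃ χ : Polynomial (Polynomial ℂ),
    χ ≠ 0 ∧ (∀ m, (χ.coeff m).natDegree ≤ r) ∧ Polynomial.aevalAeval u (X j : MvPolynomial (Fin 2) ℂ) χ ∈ Ideal.span {b} := by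
  obtain ⟨j', hj'⟩ : ∃ j' : Fin 2, j' ≠ j := exists_ne j
  let α : MvPolynomial (Fin 2) ℂ →ₐ[ℂ] Polynomial (Polynomial ℂ) := aeval (fun i => if i = j then Polynomial.C Polynomial.X else Polynomial.X)
  let γ : Polynomial (Polynomial ℂ) →ₐ[ℂ] MvPolynomial (Fin 2) ℂ := Polynomial.aevalAeval (X j : MvPolynomial (Fin 2) ℂ) (X j')
  have hγα : ∀ g, γ (α g) = g := by
    intro g
    have : γ.comp α = AlgHom.id ℂ _ := by
      apply MvPolynomial.algHom_ext
      intro i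
      by_cases hi : i = j
      · simp [α, γ, hi]
      · have : i = j' := by omega
        subst this
        simp [α, γ, hi]
    exact congrArg (fun f => f g) this
  obtain ⟨r, hr⟩ := rel_poly (α b) (fun h => hb (by rw [← hγα b, h, map_zero]))
  refine ⟨r, fun u => ?_⟩
  obtain ⟨e, ⟨i, hi⟩, w, hw⟩ := hr (α u)
  let θ : Polynomial (Polynomial ℂ) := ∑ k, Polynomial.C (e k) * Polynomial.X ^ (k : ℕ)
  have hθ : θ ≠ 0 := by
    intro h
    apply hi
    have := congrArg (fun p => Polynomial.coeff p (i : ℕ)) h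
    simp only [θ, Polynomial.finsetSum_coeff, Polynomial.coeff_C_mul_X_pow, Polynomial.coeff_zero] at this
    rw [Finset.sum_eq_single i] at this
    · simpa using this
    · intro k _ hk
      rw [if_neg]
      intro h; exact hk (Fin.ext h.symm)
    · simp
  refine ⟨Polynomial.Bivariate.swap θ, ?_, ?_, ?_⟩
  · intro h; exact hθ (Polynomial.Bivariate.swap.injective (by rw [h, map_zero]))
  · intro m
    simp only [θ, map_sum, map_mul, map_pow, Polynomial.Bivariate.swap_C, Polynomial.Bivariate.swap_Y, Polynomial.finsetSum_coeff]
    refine Polynomial.natDegree_sum_le_of_forall_le _ _ fun k _ => ?_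
    rw [← Polynomial.C_pow, Polynomial.coeff_mul_C, Polynomial.coeff_map]
    refine (Polynomial.natDegree_C_mul_X_pow_le _ _).trans ?_
    omega
  · rw [Polynomial.Bivariate.aevalAeval_swap]
    rw [Ideal.mem_span_singleton]
    refine ⟨γ w, ?_⟩
    have := congrArg γ hw
    rw [map_mul, hγα, map_sum] at this
    rw [← this, map_sum]
    refine Finset.sum_congr rfl fun k _ => ?_
    rw [map_mul, map_mul, map_pow, map_pow, hγα, Polynomial.aevalAeval_C, Polynomial.aevalAeval_Y, Polynomial.aevalAeval_C]

theorem local_lift {R A : Type*} [CommRing R] [CommRing A] (P : Ideal R) [hP : P.IsPrime] (φ : R →+* A)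
    (hker : ∀ m, φ m = 0 → m ∈ P)
    (hint : ∀ a : A, (IsLocalization.map (Localization (P.primeCompl.map φ)) φ P.primeCompl.le_comap_map : Localization P.primeCompl →+* _).IsIntegralElem (algebraMap A (Localization (P.primeCompl.map φ)) a)) :
    ∃ Q : Ideal A, Q ≠ ⊤ ∧ ∀ g ∈ P, φ g ∈ Q := by
  let Rm := Localization P.primeCompl
  let Am := Localization (P.primeCompl.map φ)
  let ψ : Rm →+* Am := IsLocalization.map Am φ P.primeCompl.le_comap_map
  have hψ : ∀ g, ψ (algebraMap R Rm g) = algebraMap A Am (φ g) := fun g => IsLocalization.map_eq _ g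
  have hψi : ψ.IsIntegral := by
    intro z
    obtain ⟨a, ⟨_, m, hm, rfl⟩, rfl⟩ := IsLocalization.exists_mk'_eq (P.primeCompl.map φ) z
    rw [IsLocalization.mk'_eq_mul_mk'_one]
    refine RingHom.IsIntegralElem.mul _ (hint a) ?_
    have : IsLocalization.mk' Am (1 : A) (⟨φ m, Submonoid.mem_map_of_mem φ hm⟩ : P.primeCompl.map φ) = ψ (IsLocalization.mk' Rm (1 : R) ⟨m, hm⟩) := by
      rw [IsLocalization.map_mk']
      simp
    exact this ▸ RingHom.isIntegralElem_map _
  have hnt : Nontrivial Am := by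
    rw [← not_subsingleton_iff_nontrivial, IsLocalization.subsingleton_iff (M := P.primeCompl.map φ)]
    rintro ⟨m, hm, h0⟩
    exact hm (hker m h0)
  obtain ⟨Q, hQ⟩ := Ideal.exists_maximal Am
  have hmax := Ideal.isMaximal_comap_of_isIntegral_of_isMaximal' ψ hψi Q
  have heq := IsLocalRing.eq_maximalIdeal hmax
  refine ⟨Q.comap (algebraMap A Am), Ideal.comap_ne_top _ hQ.ne_top, fun g hg => ?_⟩
  rw [Ideal.mem_comap, ← hψ, ← Ideal.mem_comap, heq]
  exact (IsLocalization.AtPrime.to_map_mem_maximal_iff Rm P g).mpr hg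

theorem aevalAeval_eq_eval₂ {A : Type*} [CommRing A] [Algebra ℂ A] (u x : A) (χ : Polynomial (Polynomial ℂ)) :
    Polynomial.aevalAeval u x χ = χ.eval₂ (Polynomial.aeval u : Polynomial ℂ →ₐ[ℂ] A).toRingHom x := by
  have : (Polynomial.aevalAeval (R := ℂ) u x).toRingHom = Polynomial.eval₂RingHom (Polynomial.aeval u : Polynomial ℂ →ₐ[ℂ] A).toRingHom x := by
    apply Polynomial.ringHom_ext
    · intro a; simp
    · simp
  exact congrArg (fun f => f χ) this

open MvPolynomial in
theorem hit_of_ne (I : Ideal (MvPolynomial (Fin 2) ℂ)) (q : Fin 2 → MvPolynomial (Fin 2) ℂ)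
    (hI : ∀ g, bind₁ q g ∈ I → g ∈ I) (i : Fin 2) (χ : Fin 2 → Polynomial (Polynomial ℂ))
    (hχ : ∀ j, Polynomial.aevalAeval (bind₁ q (X i)) (X j : MvPolynomial (Fin 2) ℂ) (χ j) ∈ I)
    (p : Fin 2 → ℂ) (hp : ∀ g ∈ I, eval p g = 0) (hne : ∀ j, (χ j).leadingCoeff.eval (p i) ≠ 0) :
    ∃ z, ∀ i, eval z (q i) = p i := by
  have hPp := ker_eval_isPrime p
  let φ := (Ideal.Quotient.mk I).comp (bind₁ q : MvPolynomial (Fin 2) ℂ →ₐ[ℂ] MvPolynomial (Fin 2) ℂ).toRingHom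
  let δ : Polynomial ℂ →+* MvPolynomial (Fin 2) ℂ := (Polynomial.aeval (X i : MvPolynomial (Fin 2) ℂ) : Polynomial ℂ →ₐ[ℂ] _).toRingHom
  have hδ : ∀ f : Polynomial ℂ, eval p (δ f) = f.eval (p i) := by
    intro f
    have : (eval p).comp δ = Polynomial.evalRingHom (p i) := by
      apply Polynomial.ringHom_ext
      · intro a; simp [δ, algebraMap_eq]
      · simp [δ]
    exact congrArg (fun f' => f' f) this
  have hgen : ∀ j, (IsLocalization.map (Localization ((RingHom.ker (eval p)).primeCompl.map φ)) φ (RingHom.ker (eval p)).primeCompl.le_comap_map : Localization (RingHom.ker (eval p)).primeCompl →+* _).IsIntegralElem (algebraMap _ (Localization ((RingHom.ker (eval p)).primeCompl.map φ)) (Ideal.Quotient.mk I (X j))) := by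
    intro j
    refine RingHom.isIntegralElem_localization_at_leadingCoeff φ _ ((χ j).map δ) ?_ _ ?_
    · rw [Polynomial.eval₂_map]
      have h1 := Ideal.Quotient.eq_zero_iff_mem.mpr (hχ j)
      rw [aevalAeval_eq_eval₂, Polynomial.hom_eval₂] at h1
      rw [← h1]
      congr 1
      apply Polynomial.ringHom_ext
      · intro a; simp [φ, δ]
      · simp [φ, δ]
    · have : δ (χ j).leadingCoeff ≠ 0 := by
        intro h
        apply hne j
        rw [← hδ, h, map_zero]
      rw [Polynomial.leadingCoeff_map_of_leadingCoeff_ne_zero _ this]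
      change ¬ (eval p (δ (χ j).leadingCoeff) = 0)
      rw [hδ]; exact hne j
  obtain ⟨Q, hQ, hQ'⟩ := local_lift (RingHom.ker (eval p)) φ (fun m hm => hp m (hI m (Ideal.Quotient.eq_zero_iff_mem.mp hm))) (by
    intro a
    obtain ⟨g, rfl⟩ := Ideal.Quotient.mk_surjective a
    induction g using MvPolynomial.induction_on with
    | C c =>
      have : Ideal.Quotient.mk I (C c) = φ (C c) := by simp [φ]
      rw [this, ← IsLocalization.map_eq (Q := Localization ((RingHom.ker (eval p)).primeCompl.map φ)) (S := Localization (RingHom.ker (eval p)).primeCompl) (RingHom.ker (eval p)).primeCompl.le_comap_map]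
      exact RingHom.isIntegralElem_map _
    | add a b ha hb => 
      rw [map_add, map_add]
      exact RingHom.IsIntegralElem.add _ ha hb
    | mul_X a j ha => 
      rw [map_mul, map_mul]
      exact RingHom.IsIntegralElem.mul _ ha (hgen j))
  obtain ⟨z, -, hz⟩ := lift_point q I p Q hQ (fun g hg => hQ' g hg)
  exact ⟨z, hz⟩

open MvPolynomial in
theorem bound_lemma (b : MvPolynomial (Fin 2) ℂ) (hb : b ≠ 0) : ∃ r : ℕ, 
    ∀ I : Ideal (MvPolynomial (Fin 2) ℂ), b ∈ I → ∀ q : Fin 2 → MvPolynomial (Fin 2) ℂ, 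
    (∀ g, bind₁ q g ∈ I → g ∈ I) → 
    {p : Fin 2 → ℂ | (∀ g ∈ I, eval p g = 0) ∧ ¬ ∃ z, ∀ i, eval z (q i) = p i}.encard ≤ r := by
  choose r hr using rel_mv b hb
  refine ⟨(r 0 + r 1) * (r 0 + r 1), fun I hbI q hI => ?_⟩
  choose χ hχ0 hχd hχ using fun i j => hr j (bind₁ q (X i))
  let Z : Fin 2 → Finset ℂ := fun i => ((χ i 0).leadingCoeff * (χ i 1).leadingCoeff).roots.toFinset
  have hnz : ∀ i, (χ i 0).leadingCoeff * (χ i 1).leadingCoeff ≠ 0 := fun i => 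
    mul_ne_zero (Polynomial.leadingCoeff_ne_zero.mpr (hχ0 i 0)) (Polynomial.leadingCoeff_ne_zero.mpr (hχ0 i 1))
  have hZ : ∀ i, (Z i).card ≤ r 0 + r 1 := by
    intro i
    refine (Multiset.toFinset_card_le _).trans ((Polynomial.card_roots' _).trans ?_)
    refine Polynomial.natDegree_mul_le.trans ?_
    exact Nat.add_le_add (hχd i 0 _) (hχd i 1 _)
  have hsub : {p : Fin 2 → ℂ | (∀ g ∈ I, eval p g = 0) ∧ ¬ ∃ z, ∀ i, eval z (q i) = p i} ⊆ (Fintype.piFinset Z : Set (Fin 2 → ℂ)) := by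
    rintro p ⟨hpI, hp⟩
    rw [Finset.mem_coe, Fintype.mem_piFinset]
    intro i
    rw [Multiset.mem_toFinset, Polynomial.mem_roots (hnz i), Polynomial.IsRoot.def]
    by_contra hcon
    rw [Polynomial.eval_mul] at hcon
    apply hp
    refine hit_of_ne I q hI i (χ i) (fun j => (Ideal.span_singleton_le_iff_mem I).mpr hbI (hχ i j)) p hpI ?_
    rw [Fin.forall_fin_two]
    exact ⟨left_ne_zero_of_mul hcon, right_ne_zero_of_mul hcon⟩
  refine (Set.encard_le_encard hsub).trans ?_
  rw [Set.encard_coe_eq_coe_finsetCard, Fintype.card_piFinset, Fin.prod_univ_two]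
  exact_mod_cast Nat.mul_le_mul (hZ 0) (hZ 1)

theorem stab_of_bounded {α : Type*} (E : ℕ → Set α) (hmono : Monotone E) (B : ℕ) (hfin : ∀ k, (E k).Finite)
    (hB : ∀ k, (E k).ncard ≤ B) : ∃ K > 0, ∀ k ≥ K, E k = E K := by
  have hbdd : BddAbove (Set.range fun k => (E k).ncard) := ⟨B, by rintro _ ⟨k, rfl⟩; exact hB k⟩
  obtain ⟨K, hK⟩ := Nat.sSup_mem (Set.range_nonempty _) hbdd
  have key : ∀ k ≥ K, E K = E k := by
    intro k hk
    refine Set.eq_of_subset_of_ncard_le (hmono hk) ?_ (hfin k)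
    have h1 : (E k).ncard ≤ sSup (Set.range fun k => (E k).ncard) := le_csSup hbdd ⟨k, rfl⟩
    rw [← hK] at h1
    exact h1
  refine ⟨K + 1, Nat.succ_pos _, fun k hk => ?_⟩
  rw [← key k (by omega), ← key (K + 1) (by omega)]

theorem T_finite {α : Type*} [Nonempty α] (F : α → α) (E : ℕ → Set α) (hmono : Monotone E) (hfin : ∀ k, (E k).Finite)
    (hM : (Set.range F)ᶜ.Finite) (hE : ∀ k x, x ∈ E (k + 1) ↔ ∀ y, F y = x → y ∈ E k) :
    {y | (∃ k, y ∈ E k) ∧ Function.invFun F (F y) ≠ y}.Finite := by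
  set T := {y | (∃ k, y ∈ E k) ∧ Function.invFun F (F y) ≠ y} with hT
  have hinv : ∀ x ∈ Set.range F, F (Function.invFun F x) = x := fun x hx => Function.invFun_eq hx
  have hbound : ∀ k, (T ∩ E k).ncard ≤ (Set.range F)ᶜ.ncard := by
    intro k
    have h1 : (E k).ncard ≤ (E (k + 1)).ncard := Set.ncard_le_ncard (hmono (Nat.le_succ k)) (hfin _)
    have h2 : (E (k + 1)).ncard ≤ (E (k + 1) ∩ Set.range F).ncard + (Set.range F)ᶜ.ncard := by
      rw [← Set.ncard_inter_add_ncard_sdiff_eq_ncard (E (k + 1)) (Set.range F) (hfin _)]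
      exact Nat.add_le_add le_rfl (Set.ncard_le_ncard (fun x hx => hx.2) hM)
    have h3 : (Function.invFun F '' (E (k + 1) ∩ Set.range F)).ncard = (E (k + 1) ∩ Set.range F).ncard := by
      apply Set.InjOn.ncard_image
      intro x hx y hy hxy
      rw [← hinv x hx.2, hxy, hinv y hy.2]
    have hfi : (Function.invFun F '' (E (k + 1) ∩ Set.range F)).Finite := ((hfin _).inter_of_left _).image _
    have hdisj : Disjoint (T ∩ E k) (Function.invFun F '' (E (k + 1) ∩ Set.range F)) := by
      rw [Set.disjoint_left]
      rintro _ ⟨⟨-, hy⟩, -⟩ ⟨x, ⟨-, hx⟩, rfl⟩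
      exact hy (by rw [hinv x hx])
    have h4 := Set.ncard_union_eq hdisj ((hfin k).inter_of_right _) hfi
    have h5 : ((T ∩ E k) ∪ (Function.invFun F '' (E (k + 1) ∩ Set.range F))).ncard ≤ (E k).ncard := by
      refine Set.ncard_le_ncard ?_ (hfin k)
      rintro y (hy | ⟨x, ⟨hx, hxr⟩, rfl⟩)
      · exact hy.2
      · exact (hE k x).mp hx _ (hinv x hxr)
    omega
  by_contra hinf
  obtain ⟨t, htT, htc⟩ := Set.Infinite.exists_subset_card_eq hinf ((Set.range F)ᶜ.ncard + 1)
  have : ∃ k, ∀ y ∈ t, y ∈ E k := by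
    have : ∀ y, ∃ k, y ∈ t → y ∈ E k := fun y => by
      by_cases hy : y ∈ t
      · obtain ⟨k, hk⟩ := (htT hy).1
        exact ⟨k, fun _ => hk⟩
      · exact ⟨0, fun h => absurd h hy⟩
    choose k hk using this
    exact ⟨t.sup k, fun y hy => hmono (Finset.le_sup hy) (hk y hy)⟩
  obtain ⟨k, hk⟩ := this
  have h6 : (t : Set α).ncard ≤ (T ∩ E k).ncard := Set.ncard_le_ncard (fun y hy => ⟨htT hy, hk y hy⟩) ((hfin k).inter_of_right _)
  rw [Set.ncard_coe_finset] at h6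
  have := hbound k
  omega

open MvPolynomial in
/-- The ideal of polynomials vanishing at all but finitely many points of a set. -/
def cofinVanish (X : Set (Fin 2 → ℂ)) : Ideal (MvPolynomial (Fin 2) ℂ) where
  carrier := {g | {x | x ∈ X ∧ eval x g ≠ 0}.Finite}
  add_mem' := by
    intro a b ha hb
    refine (Set.Finite.union ha hb).subset ?_
    rintro x ⟨hx, h⟩
    by_cases h1 : eval x a = 0
    · refine Or.inr ⟨hx, fun h2 => h ?_⟩
      rw [map_add, h1, h2, add_zero]
    · exact Or.inl ⟨hx, h1⟩
  zero_mem' := by simp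
  smul_mem' := by
    intro c a ha
    refine Set.Finite.subset ha ?_
    rintro x ⟨hx, h⟩
    refine ⟨hx, fun h2 => h ?_⟩
    rw [smul_eq_mul, map_mul, h2, mul_zero]

open MvPolynomial in
theorem mem_cofinVanish (X : Set (Fin 2 → ℂ)) (g : MvPolynomial (Fin 2) ℂ) : g ∈ cofinVanish X ↔ {x | x ∈ X ∧ eval x g ≠ 0}.Finite := Iff.rfl

open MvPolynomial in
theorem iterate_poly (F : (Fin 2 → ℂ) → (Fin 2 → ℂ)) (q : Fin 2 → MvPolynomial (Fin 2) ℂ)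
    (hq : ∀ x i, F x i = eval x (q i)) (N : ℕ) : ∃ Q : Fin 2 → MvPolynomial (Fin 2) ℂ, ∀ x i, F^[N] x i = eval x (Q i) := by
  induction N with
  | zero => exact ⟨X, fun x i => by simp⟩
  | succ N ih =>
    obtain ⟨Q, hQ⟩ := ih
    refine ⟨fun i => bind₁ q (Q i), fun x i => ?_⟩
    rw [Function.iterate_succ_apply, hQ, eval_bind]
    congr 2
    funext i
    exact hq x i

open MvPolynomial in
theorem E_stab (F : (Fin 2 → ℂ) → (Fin 2 → ℂ)) (q : Fin 2 → MvPolynomial (Fin 2) ℂ)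
    (hq : ∀ x i, F x i = eval x (q i)) (hopen : IsOpenMap F) (E : ℕ → Set (Fin 2 → ℂ)) 
    (hmono : Monotone E) (h0 : (E 0).Finite)
    (hE : ∀ k x, x ∈ E (k + 1) ↔ ∀ y, F y = x → y ∈ E k) : 
    (∀ k, (E k).Finite) ∧ ∃ K > 0, ∀ k ≥ K, E k = E K := by
  have hM := missed_finite F q hq hopen
  have hsub : ∀ k, E (k + 1) ⊆ (Set.range F)ᶜ ∪ F '' (E k) := by
    intro k x hx
    by_cases hr : x ∈ Set.range F
    · obtain ⟨y, rfl⟩ := hr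
      exact Or.inr ⟨y, (hE k _).mp hx y rfl, rfl⟩
    · exact Or.inl hr
  have hfin : ∀ k, (E k).Finite := by
    intro k
    induction k with
    | zero => exact h0
    | succ k ih => exact (hM.union (ih.image F)).subset (hsub k)
  refine ⟨hfin, ?_⟩
  by_cases hinj : Function.Injective F
  · have hsurj : Function.Surjective F := by
      have hF : F = fun v i => eval v (q i) := by funext v i; exact hq v i
      rw [hF] at hinj ⊢
      exact ax_grothendieck_univ q hinj
    refine stab_of_bounded E hmono (E 0).ncard hfin fun k => ?_
    induction k with
    | zero => exact le_rfl
    | succ k ih =>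
      refine le_trans ?_ ih
      have h1 := hsub k
      rw [hsurj.range_eq, Set.compl_univ, Set.empty_union] at h1
      exact (Set.ncard_le_ncard h1 ((hfin k).image F)).trans (Set.ncard_image_le (hfin k))
  · obtain ⟨b, hb, hb2⟩ := two_preimages F q hq hopen hinj
    have hT := T_finite F E hmono hfin hM hE
    let Y : Set (Fin 2 → ℂ) := {x | ∃ k, x ∈ E k}
    have hY : ∀ y, F y ∈ Y → y ∈ Y := by
      rintro y ⟨k, hk⟩
      exact ⟨k, (hE k _).mp (hmono (Nat.le_succ k) hk) y rfl⟩
    have hbI : b ∈ cofinVanish Y := by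
      rw [mem_cofinVanish]
      refine (hT.image F).subset ?_
      rintro x ⟨hx, hbx⟩
      obtain ⟨z, w, hzw, hz, hw⟩ := hb2 x hbx
      by_cases h : Function.invFun F x = z
      · refine ⟨w, ⟨hY w (by rw [hw]; exact hx), ?_⟩, hw⟩
        rw [hw, h]; exact hzw
      · refine ⟨z, ⟨hY z (by rw [hz]; exact hx), ?_⟩, hz⟩
        rw [hz]; exact h
    have hI1 : ∀ p : (Fin 2 → ℂ) → Prop, {y | y ∈ Y ∧ p (F y)}.Finite → {x | x ∈ Y ∧ p x}.Finite := by
      intro p hp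
      refine (hM.union (hp.image F)).subset ?_
      rintro x ⟨hx, hpx⟩
      by_cases hr : x ∈ Set.range F
      · obtain ⟨y, rfl⟩ := hr
        exact Or.inr ⟨y, ⟨hY y hx, hpx⟩, rfl⟩
      · exact Or.inl hr
    have hIN : ∀ N, ∀ p : (Fin 2 → ℂ) → Prop, {y | y ∈ Y ∧ p (F^[N] y)}.Finite → {x | x ∈ Y ∧ p x}.Finite := by
      intro N
      induction N with
      | zero => intro p hp; exact hp
      | succ N ih =>
        intro p hp
        refine ih p (hI1 (fun y => p (F^[N] y)) ?_)
        exact hp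
    have hV : {x | x ∈ Y ∧ ¬ ∀ g ∈ cofinVanish Y, eval x g = 0}.Finite := by
      obtain ⟨S, hS⟩ := (isNoetherianRing_iff_ideal_fg _).mp inferInstance (cofinVanish Y)
      have h1 : (⋃ g ∈ S, {x | x ∈ Y ∧ eval x g ≠ 0}).Finite := by
        refine Set.Finite.biUnion S.finite_toSet fun g hg => ?_
        rw [← mem_cofinVanish, ← hS]
        exact Ideal.subset_span hg
      refine h1.subset ?_
      rintro x ⟨hx, hne⟩
      by_contra hcon
      apply hne
      have : cofinVanish Y ≤ RingHom.ker (eval x) := by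
        rw [← hS, Ideal.span_le]
        intro g hg
        by_contra hgx
        apply hcon
        rw [Set.mem_iUnion₂]
        exact ⟨g, hg, hx, hgx⟩
      exact fun g hg => this hg
    obtain ⟨r, hr⟩ := bound_lemma b hb
    refine stab_of_bounded E hmono ({x | x ∈ Y ∧ ¬ ∀ g ∈ cofinVanish Y, eval x g = 0}.ncard + r + (E 0).ncard) hfin fun N => ?_
    obtain ⟨Q, hQ⟩ := iterate_poly F q hq N
    have hr' := hr (cofinVanish Y) hbI Q (by
      intro g hg
      rw [mem_cofinVanish] at hg ⊢
      refine hIN N (fun x => eval x g ≠ 0) ?_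
      convert hg using 5 with x
      rw [eval_bind]
      congr 2
      funext i
      rw [hQ])
    set W := {p : Fin 2 → ℂ | (∀ g ∈ cofinVanish Y, eval p g = 0) ∧ ¬ ∃ z, ∀ i, eval z (Q i) = p i}
    have hWf : W.Finite := Set.finite_of_encard_le_coe hr'
    have hWc : W.ncard ≤ r := by
      rw [← hWf.cast_ncard_eq] at hr'
      exact_mod_cast hr'
    have hiter : ∀ N y, F^[N] y ∈ E N → y ∈ E 0 := by
      intro N
      induction N with
      | zero => intro y hy; exact hy
      | succ N ih =>
        intro y hy
        rw [Function.iterate_succ_apply'] at hy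
        exact ih y ((hE N _).mp hy _ rfl)
    have hcov : E N ⊆ ({x | x ∈ Y ∧ ¬ ∀ g ∈ cofinVanish Y, eval x g = 0} ∪ W) ∪ F^[N] '' (E 0) := by
      intro x hx
      by_cases h1 : ∀ g ∈ cofinVanish Y, eval x g = 0
      · by_cases h2 : ∃ z, ∀ i, eval z (Q i) = x i
        · obtain ⟨z, hz⟩ := h2
          have hzx : F^[N] z = x := by funext i; rw [hQ, hz]
          exact Or.inr ⟨z, hiter N z (by rw [hzx]; exact hx), hzx⟩
        · exact Or.inl (Or.inr ⟨h1, h2⟩)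
      · exact Or.inl (Or.inl ⟨⟨N, hx⟩, h1⟩)
    refine (Set.ncard_le_ncard hcov ((hV.union hWf).union (h0.image _))).trans ?_
    refine (Set.ncard_union_le _ _).trans ?_
    refine Nat.add_le_add ((Set.ncard_union_le _ _).trans (Nat.add_le_add le_rfl hWc)) (Set.ncard_image_le h0)


open MvPolynomial in
theorem omega_case (F : (Fin 2 → ℂ) → (Fin 2 → ℂ)) (q : Fin 2 → MvPolynomial (Fin 2) ℂ)
    (hq : ∀ x i, F x i = eval x (q i)) (hopen : IsOpenMap F) (Ω : Set (Fin 2 → ℂ)) (hΩ : Ωᶜ.Finite)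
    (hF : F '' Ω ⊆ Ω) :
    (∃ K > 0, ∀ k ≥ K, F^[k] '' Ω = F^[K] '' Ω) ∧
      (⋂ k > 0, F^[k] '' Ω)ᶜ.Finite ∧ (⋂ k > 0, F^[k] '' Ω) ⊆ Ω := by
  have hstep : ∀ k, F^[k + 1] '' Ω ⊆ F^[k] '' Ω := by
    intro k
    rw [Function.iterate_succ, Set.image_comp]
    exact Set.image_mono hF
  have hanti : Antitone fun k => F^[k] '' Ω := antitone_nat_of_succ_le hstep
  obtain ⟨hfin, K, hK, hst⟩ := E_stab F q hq hopen (fun k => (F^[k] '' Ω)ᶜ)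
    (fun a b hab => Set.compl_subset_compl.mpr (hanti hab)) (by simpa using hΩ) (by
      intro k x
      rw [Function.iterate_succ', Set.image_comp]
      constructor
      · intro h y hy hy'
        exact h ⟨y, hy', hy⟩
      · rintro h ⟨y, hy, hyx⟩
        exact h y hyx hy)
  have hst' : ∀ k ≥ K, F^[k] '' Ω = F^[K] '' Ω := fun k hk => compl_injective (hst k hk)
  have heq : (⋂ k > 0, F^[k] '' Ω) = F^[K] '' Ω := by
    apply Set.Subset.antisymm
    · exact Set.biInter_subset_of_mem (show K ∈ {k | k > 0} from hK)
    · refine Set.subset_iInter₂ fun k _ => ?_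
      rcases le_total k K with h | h
      · exact hanti h
      · exact (hst' k h).ge
  refine ⟨⟨K, hK, hst'⟩, ?_, ?_⟩
  · rw [heq]; exact hfin K
  · rw [heq]
    have := hanti (Nat.zero_le K)
    simpa using this

theorem sc_plane (S : Set (Fin 2 → ℂ)) (hS : Sᶜ.Finite) : SimplyConnectedSpace S := by
  apply simplyConnected_of_compl_finite _ S hS
  rw [Module.finrank_pi_fintype]
  simp [Complex.finrank_real_complex]

/-- For an open polynomial self-map of `ℂ²`, the iterated images of `ℂ²`
stabilize, with open, simply connected, cofinite stable image; likewise for any cofinite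
invariant subset `Ω ⊆ ℂ²`. -/
theorem iterated_images_stabilize_open_plane
    (F : (Fin 2 → ℂ) → (Fin 2 → ℂ))
    (hFpoly : ∃ q : Fin 2 → MvPolynomial (Fin 2) ℂ,
      ∀ x i, F x i = MvPolynomial.eval x (q i))
    (hopen : IsOpenMap F) :
    ((∃ K > 0, ∀ k ≥ K, F^[k] '' Set.univ = F^[K] '' Set.univ) ∧
      IsOpen (⋂ k > 0, F^[k] '' Set.univ) ∧
      SimplyConnectedSpace ↥(⋂ k > 0, F^[k] '' Set.univ) ∧
      (⋂ k > 0, F^[k] '' Set.univ)ᶜ.Finite) ∧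
    (∀ Ω : Set (Fin 2 → ℂ), Ωᶜ.Finite → F '' Ω ⊆ Ω →
      (∃ K > 0, ∀ k ≥ K, F^[k] '' Ω = F^[K] '' Ω) ∧
      (∃ U : Set (Fin 2 → ℂ), IsOpen U ∧ (⋂ k > 0, F^[k] '' Ω) = U ∩ Ω) ∧
      SimplyConnectedSpace ↥(⋂ k > 0, F^[k] '' Ω) ∧
      (Ω \ ⋂ k > 0, F^[k] '' Ω).Finite) := by
  obtain ⟨q, hq⟩ := hFpoly
  constructor
  · obtain ⟨h1, h2, -⟩ := omega_case F q hq hopen Set.univ (by simp) (Set.subset_univ _)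
    exact ⟨h1, isClosed_compl_iff.mp h2.isClosed, sc_plane _ h2, h2⟩
  · intro Ω hΩ hF
    obtain ⟨h1, h2, h3⟩ := omega_case F q hq hopen Ω hΩ hF
    exact ⟨h1, ⟨_, isClosed_compl_iff.mp h2.isClosed, (Set.inter_eq_left.mpr h3).symm⟩, sc_plane _ h2,
      h2.subset fun x hx => hx.2⟩
end
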